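/- Assume σ satisfies |σ(x)| ≤ C₀(1+|x|)^{C₀}, μ_k(σ) ≠ 0 for every k = 0,…,ℓ, and μ_{>ℓ}(σ)² > 0, where ℓ = ⌈min(κ₁,κ₂)⌉. Set r = min(n,p), s = max(n,p), and Z̃ = σ(XWᵀ)/√s (σ applied entrywise), and let σ₁(Z̃) ≥ σ₂(Z̃) ≥ … denote the singular values of Z̃ in decreasing order. Then there exists K > 0 such that for every D > 0 and all sufficiently large d: P(σ_{N_{<ℓ}}(Z̃) < K·√(r·d^{−(ℓ−1)})) ≤ d^{−D}. -/

import Mathlib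

/-!
Lower bound on the top `N_{<ℓ}` singular values of the normalized feature matrix
(Proposition "SVD of the feature matrix", part (a)).
-/

open MeasureTheory Filter

noncomputable section

/-- Uniform probability measure on the sphere of radius `r` in `ℝ^d`
(normalized `(d-1)`-dimensional Hausdorff measure). -/
def sphereUniform (d : ℕ) (r : ℝ) : Measure (EuclideanSpace ℝ (Fin d)) :=
  ((Measure.hausdorffMeasure ((d : ℝ) - 1) :
        Measure (EuclideanSpace ℝ (Fin d))) (Metric.sphere 0 r))⁻¹ •
    (Measure.hausdorffMeasure ((d : ℝ) - 1) :
        Measure (EuclideanSpace ℝ (Fin d))).restrict (Metric.sphere 0 r)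

/-- Euclidean inner product. -/
def dotp {d : ℕ} (u v : EuclideanSpace ℝ (Fin d)) : ℝ := ∑ i, u i * v i

/-- Law of `n` i.i.d. uniform points on the sphere of radius `√d`. -/
def Xmeas (d n : ℕ) : Measure (Fin n → EuclideanSpace ℝ (Fin d)) :=
  Measure.pi fun _ => sphereUniform d (Real.sqrt d)

/-- Law of `p` i.i.d. uniform points on the unit sphere. -/
def Wmeas (d p : ℕ) : Measure (Fin p → EuclideanSpace ℝ (Fin d)) :=
  Measure.pi fun _ => sphereUniform d 1

/-- Joint law of the (independent) covariates and weights. -/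
def XWmeas (d n p : ℕ) :
    Measure ((Fin n → EuclideanSpace ℝ (Fin d)) × (Fin p → EuclideanSpace ℝ (Fin d))) :=
  (Xmeas d n).prod (Wmeas d p)

/-- Entrywise application `σ(X Wᵀ)`. -/
def entrywise (d n p : ℕ) (f : ℝ → ℝ) (x : Fin n → EuclideanSpace ℝ (Fin d))
    (w : Fin p → EuclideanSpace ℝ (Fin d)) : Matrix (Fin n) (Fin p) ℝ :=
  Matrix.of fun i j => f (dotp (x i) (w j))

/-- Standard Gaussian measure on `ℝ`. -/
def stdGaussian : Measure ℝ := ProbabilityTheory.gaussianReal 0 1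

/-- Degree-`k` probabilists' Hermite polynomial, normalized in `L²` of the Gaussian. -/
def hermiteL2 (k : ℕ) (s : ℝ) : ℝ :=
  Polynomial.aeval s (Polynomial.hermite k) / Real.sqrt (Nat.factorial k)

/-- `μ_k(σ) = E[σ(G) He_k(G)]`. -/
def hermiteCoeff (σ : ℝ → ℝ) (k : ℕ) : ℝ := ∫ g, σ g * hermiteL2 k g ∂stdGaussian

/-- `μ_{>ℓ}(σ)² = E[σ(G)²] − ∑_{k=0}^{ℓ} μ_k(σ)²`. -/
def muGtSq (σ : ℝ → ℝ) (l : ℕ) : ℝ :=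
  (∫ g, σ g ^ 2 ∂stdGaussian) - ∑ k ∈ Finset.range (l + 1), hermiteCoeff σ k ^ 2

/-- Dimension `N_{d,k}` of the space of degree-`k` spherical harmonics in dimension `d`. -/
def sphDim (d k : ℕ) : ℕ :=
  if k = 0 then 1
  else if k = 1 then d
  else ((d + 2 * k - 2) * Nat.choose (d + k - 3) (k - 1)) / k

/-- `N_{<ℓ} = N_0 + ⋯ + N_{ℓ-1}`. -/
def sphDimLT (d l : ℕ) : ℕ := ∑ k ∈ Finset.range l, sphDim d k

/-- The `j`-th largest singular value of a matrix, via the Courant–Fischer max-min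
characterization. -/
def singVal {n p : ℕ} (A : Matrix (Fin n) (Fin p) ℝ) (j : ℕ) : ℝ :=
  sSup {s : ℝ | 0 ≤ s ∧ ∃ V : Submodule ℝ (EuclideanSpace ℝ (Fin p)),
    Module.finrank ℝ V = j ∧ ∀ v ∈ V, s * ‖v‖ ≤ ‖Matrix.toEuclideanLin A v‖}

/-! ### Trace inequalities for real symmetric matrices -/

section TraceInequalities

open Matrix

variable {ι : Type*} [Fintype ι]

lemma trace_vecMulVec_mul (x : ι → ℝ) (M : Matrix ι ι ℝ) :
    (vecMulVec x x * M).trace = x ⬝ᵥ M *ᵥ x := by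
  rw [vecMulVec_mul, trace_vecMulVec, dotProduct_comm, dotProduct_mulVec, dotProduct_comm,
    dotProduct_comm x]

variable [DecidableEq ι]

lemma exists_orthogonal_diagonalization {A : Matrix ι ι ℝ} (hA : A.IsHermitian) :
    ∃ (U : Matrix ι ι ℝ) (α : ι → ℝ), Uᵀ * U = 1 ∧ U * Uᵀ = 1 ∧ A = U * diagonal α * Uᵀ := by
  refine ⟨hA.eigenvectorUnitary, hA.eigenvalues, ?_, ?_, ?_⟩
  · simpa [star_eq_conjTranspose] using Unitary.coe_star_mul_self hA.eigenvectorUnitary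
  · simpa [star_eq_conjTranspose] using Unitary.coe_mul_star_self hA.eigenvectorUnitary
  · conv_lhs => rw [hA.spectral_theorem]
    simp [Unitary.conjStarAlgAut_apply, star_eq_conjTranspose]

lemma conj_diagonal_pow {U : Matrix ι ι ℝ} (hU : Uᵀ * U = 1) (hU' : U * Uᵀ = 1) (α : ι → ℝ)
    (a : ℕ) : (U * diagonal α * Uᵀ) ^ a = U * diagonal (fun i => α i ^ a) * Uᵀ := by
  induction a with
  | zero => simp [hU']
  | succ a ih =>
    rw [pow_succ, ih]
    calc U * diagonal (fun i => α i ^ a) * Uᵀ * (U * diagonal α * Uᵀ)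
        = U * diagonal (fun i => α i ^ a) * (Uᵀ * U) * diagonal α * Uᵀ := by
          simp only [Matrix.mul_assoc]
      _ = _ := by
          rw [hU, Matrix.mul_one, Matrix.mul_assoc U, diagonal_mul_diagonal]
          simp [pow_succ]

/-- Joint spectral expansion of the mixed traces of two real symmetric matrices. -/
lemma exists_trace_pow_mul_pow {A B : Matrix ι ι ℝ} (hA : A.IsHermitian) (hB : B.IsHermitian) :
    ∃ (w : ι → ι → ℝ) (α β : ι → ℝ), (∀ i j, 0 ≤ w i j) ∧
      ∀ a b : ℕ, (A ^ a * B ^ b).trace = ∑ i, ∑ j, w i j * (α i ^ a * β j ^ b) := by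
  obtain ⟨U, α, hU, hU', rfl⟩ := exists_orthogonal_diagonalization hA
  obtain ⟨V, β, hV, hV', rfl⟩ := exists_orthogonal_diagonalization hB
  refine ⟨fun i j => (Uᵀ * V) i j ^ 2, α, β, fun i j => sq_nonneg _, fun a b => ?_⟩
  rw [conj_diagonal_pow hU hU', conj_diagonal_pow hV hV']
  have h1 : (U * diagonal (fun i => α i ^ a) * Uᵀ * (V * diagonal (fun i => β i ^ b) * Vᵀ)).trace
      = (diagonal (fun i => α i ^ a) * (Uᵀ * V) * (diagonal (fun i => β i ^ b) * (Uᵀ * V)ᵀ)).trace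
      := by
    rw [transpose_mul, transpose_transpose]
    rw [show U * diagonal (fun i => α i ^ a) * Uᵀ * (V * diagonal (fun i => β i ^ b) * Vᵀ)
      = U * (diagonal (fun i => α i ^ a) * Uᵀ * (V * diagonal (fun i => β i ^ b) * Vᵀ)) by
        simp only [Matrix.mul_assoc], trace_mul_comm]
    simp only [Matrix.mul_assoc]
  rw [h1, trace]
  refine Finset.sum_congr rfl fun i _ => ?_
  rw [diag_apply, mul_apply]
  refine Finset.sum_congr rfl fun j _ => ?_
  rw [diagonal_mul, diagonal_mul, transpose_apply]
  ring

lemma sub_mul_pow_sub_pow_le (x y : ℝ) (q : ℕ) :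
    (x - y) * (x ^ (2 * q + 1) - y ^ (2 * q + 1)) ≤
      ((2 * q + 1 : ℝ) / 2) * ((x - y) ^ 2 * (x ^ (2 * q) + y ^ (2 * q))) := by
  have hg : (x - y) * (x ^ (2 * q + 1) - y ^ (2 * q + 1)) =
      (x - y) ^ 2 * ∑ i ∈ Finset.range (2 * q + 1), x ^ i * y ^ (2 * q - i) := by
    rw [← (Commute.all x y).mul_geom_sum₂ (2 * q + 1)]
    simp only [Nat.add_sub_cancel_right]
    ring
  have key : ∀ i ∈ Finset.range (2 * q + 1), x ^ i * y ^ (2 * q - i) + y ^ i * x ^ (2 * q - i) ≤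
      x ^ (2 * q) + y ^ (2 * q) := by
    intro i hi
    have hi : i ≤ 2 * q := by simpa [Nat.lt_succ_iff] using hi
    have e : ∀ z : ℝ, z ^ (2 * q) = |z| ^ i * |z| ^ (2 * q - i) := fun z => by
      rw [← pow_add, Nat.add_sub_cancel' hi, pow_mul, pow_mul, sq_abs]
    have h0 : 0 ≤ (|x| ^ i - |y| ^ i) * (|x| ^ (2 * q - i) - |y| ^ (2 * q - i)) := by
      rcases le_total |x| |y| with h | h
      · exact mul_nonneg_of_nonpos_of_nonpos
          (sub_nonpos.2 (pow_le_pow_left₀ (abs_nonneg _) h _))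
          (sub_nonpos.2 (pow_le_pow_left₀ (abs_nonneg _) h _))
      · exact mul_nonneg
          (sub_nonneg.2 (pow_le_pow_left₀ (abs_nonneg _) h _))
          (sub_nonneg.2 (pow_le_pow_left₀ (abs_nonneg _) h _))
    have h1 : x ^ i * y ^ (2 * q - i) ≤ |x| ^ i * |y| ^ (2 * q - i) := by
      refine (le_abs_self _).trans_eq ?_
      rw [abs_mul, abs_pow, abs_pow]
    have h2 : y ^ i * x ^ (2 * q - i) ≤ |y| ^ i * |x| ^ (2 * q - i) := by
      refine (le_abs_self _).trans_eq ?_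
      rw [abs_mul, abs_pow, abs_pow]
    rw [e x, e y]
    nlinarith
  have hrefl : ∑ i ∈ Finset.range (2 * q + 1), y ^ i * x ^ (2 * q - i) =
      ∑ i ∈ Finset.range (2 * q + 1), x ^ i * y ^ (2 * q - i) := by
    rw [← Finset.sum_range_reflect]
    refine Finset.sum_congr rfl fun i hi => ?_
    have hi : i ≤ 2 * q := by simpa [Nat.lt_succ_iff] using hi
    rw [show 2 * q + 1 - 1 - i = 2 * q - i by omega, show 2 * q - (2 * q - i) = i by omega,
      mul_comm]
  have hs := Finset.sum_le_sum key
  rw [Finset.sum_add_distrib, hrefl, Finset.sum_const, Finset.card_range, nsmul_eq_mul] at hs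
  push_cast at hs
  rw [hg]
  nlinarith [sq_nonneg (x - y)]

/-- Mean value inequality for the trace of odd powers. -/
lemma trace_sub_mul_pow_sub_pow_le {A B : Matrix ι ι ℝ} (hA : A.IsHermitian) (hB : B.IsHermitian)
    (q : ℕ) :
    ((A - B) * (A ^ (2 * q + 1) - B ^ (2 * q + 1))).trace ≤
      ((2 * q + 1 : ℝ) / 2) *
        (((A - B) * (A - B) * A ^ (2 * q)).trace + ((A - B) * (A - B) * B ^ (2 * q)).trace) := by
  obtain ⟨w, α, β, hw, h⟩ := exists_trace_pow_mul_pow hA hB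
  have hl : ((A - B) * (A ^ (2 * q + 1) - B ^ (2 * q + 1))).trace =
      ∑ i, ∑ j, w i j * ((α i - β j) * (α i ^ (2 * q + 1) - β j ^ (2 * q + 1))) := by
    have : ((A - B) * (A ^ (2 * q + 1) - B ^ (2 * q + 1))).trace =
        (A ^ (2 * q + 2) * B ^ 0).trace - (A ^ 1 * B ^ (2 * q + 1)).trace
        - (A ^ (2 * q + 1) * B ^ 1).trace + (A ^ 0 * B ^ (2 * q + 2)).trace := by
      rw [trace_mul_comm (A ^ (2 * q + 1)) (B ^ 1)]
      simp only [Matrix.sub_mul, Matrix.mul_sub, trace_sub, pow_zero, pow_one, Matrix.mul_one,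
        Matrix.one_mul, ← pow_succ']
      ring
    rw [this]
    simp only [h, ← Finset.sum_sub_distrib, ← Finset.sum_add_distrib]
    exact Finset.sum_congr rfl fun i _ => Finset.sum_congr rfl fun j _ => by ring
  have hr : ((A - B) * (A - B) * A ^ (2 * q)).trace + ((A - B) * (A - B) * B ^ (2 * q)).trace =
      ∑ i, ∑ j, w i j * ((α i - β j) ^ 2 * (α i ^ (2 * q) + β j ^ (2 * q))) := by
    have e1 : ((A - B) * (A - B) * A ^ (2 * q)).trace = (A ^ (2 * q + 2) * B ^ 0).trace
        - 2 * (A ^ (2 * q + 1) * B ^ 1).trace + (A ^ (2 * q) * B ^ 2).trace := by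
      have h1 : (A * B * A ^ (2 * q)).trace = (A ^ (2 * q + 1) * B).trace := by
        rw [trace_mul_comm, ← Matrix.mul_assoc, ← pow_succ]
      have h2 : (B * A * A ^ (2 * q)).trace = (A ^ (2 * q + 1) * B).trace := by
        rw [Matrix.mul_assoc, ← pow_succ', trace_mul_comm]
      have h3 : (A * A * A ^ (2 * q)) = A ^ (2 * q + 2) := by
        rw [Matrix.mul_assoc, ← pow_succ', ← pow_succ']
      have h4 : (B * B * A ^ (2 * q)).trace = (A ^ (2 * q) * B ^ 2).trace := by
        rw [trace_mul_comm, sq]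
      simp only [Matrix.sub_mul, Matrix.mul_sub, trace_sub, h1, h2, h3, h4, pow_zero, pow_one,
        Matrix.mul_one]
      ring
    have e2 : ((A - B) * (A - B) * B ^ (2 * q)).trace = (A ^ 2 * B ^ (2 * q)).trace
        - 2 * (A ^ 1 * B ^ (2 * q + 1)).trace + (A ^ 0 * B ^ (2 * q + 2)).trace := by
      have h1 : (B * A * B ^ (2 * q)).trace = (A * B ^ (2 * q + 1)).trace := by
        rw [Matrix.mul_assoc, trace_mul_comm, Matrix.mul_assoc, ← pow_succ]
      have h2 : (A * B * B ^ (2 * q)) = (A * B ^ (2 * q + 1)) := by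
        rw [Matrix.mul_assoc, ← pow_succ']
      have h3 : (B * B * B ^ (2 * q)) = B ^ (2 * q + 2) := by
        rw [Matrix.mul_assoc, ← pow_succ', ← pow_succ']
      simp only [Matrix.sub_mul, Matrix.mul_sub, trace_sub, h1, h2, h3, pow_zero, pow_one,
        Matrix.one_mul, sq A]
      ring
    rw [e1, e2]
    simp only [h, Finset.mul_sum, ← Finset.sum_sub_distrib, ← Finset.sum_add_distrib]
    exact Finset.sum_congr rfl fun i _ => Finset.sum_congr rfl fun j _ => by ring
  rw [hl, hr, Finset.mul_sum]
  refine Finset.sum_le_sum fun i _ => ?_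
  rw [Finset.mul_sum]
  refine Finset.sum_le_sum fun j _ => ?_
  have := mul_le_mul_of_nonneg_left (sub_mul_pow_sub_pow_le (α i) (β j) q) (hw i j)
  linarith

lemma trace_pow_two_mul_nonneg {A : Matrix ι ι ℝ} (hA : A.IsHermitian) (q : ℕ) :
    0 ≤ (A ^ (2 * q)).trace := by
  obtain ⟨U, α, hU, hU', rfl⟩ := exists_orthogonal_diagonalization hA
  rw [conj_diagonal_pow hU hU', Matrix.trace_mul_comm, ← Matrix.mul_assoc, hU, Matrix.one_mul,
    trace_diagonal]
  exact Finset.sum_nonneg fun i _ => by rw [pow_mul]; positivity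

/-- Young's inequality for traces of consecutive powers. -/
lemma mul_trace_pow_odd_le {A : Matrix ι ι ℝ} (hA : A.IsHermitian) (q : ℕ) (c : ℝ) :
    c * (A ^ (2 * q + 1)).trace ≤
      (1 / 2) * (A ^ (2 * q + 2)).trace + (c ^ 2 / 2) * (A ^ (2 * q)).trace := by
  obtain ⟨U, α, hU, hU', rfl⟩ := exists_orthogonal_diagonalization hA
  have e : ∀ a, ((U * diagonal α * Uᵀ) ^ a).trace = ∑ i, α i ^ a := fun a => by
    rw [conj_diagonal_pow hU hU', Matrix.trace_mul_comm, ← Matrix.mul_assoc, hU, Matrix.one_mul,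
      trace_diagonal]
  simp only [e, Finset.mul_sum, ← Finset.sum_add_distrib]
  refine Finset.sum_le_sum fun i _ => ?_
  have h0 : 0 ≤ α i ^ (2 * q) := by rw [pow_mul]; positivity
  have h1 : α i ^ (2 * q + 1) = α i ^ (2 * q) * α i := pow_succ _ _
  have h2 : α i ^ (2 * q + 2) = α i ^ (2 * q) * α i ^ 2 := pow_add _ _ _
  rw [h1, h2]
  nlinarith [mul_nonneg h0 (sq_nonneg (α i - c))]

/-- Even trace powers dominate even powers of the quadratic form. -/
lemma pow_le_trace_pow {A : Matrix ι ι ℝ} (hA : A.IsHermitian) (q : ℕ) {t : ℝ} (ht : 0 ≤ t)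
    {b : ι → ℝ} (hb : b ≠ 0) (h : t * (b ⬝ᵥ b) ≤ |b ⬝ᵥ A *ᵥ b|) :
    t ^ (2 * q) ≤ (A ^ (2 * q)).trace := by
  obtain ⟨U, α, hU, hU', rfl⟩ := exists_orthogonal_diagonalization hA
  rw [conj_diagonal_pow hU hU', Matrix.trace_mul_comm, ← Matrix.mul_assoc, hU, Matrix.one_mul,
    trace_diagonal]
  set c := Uᵀ *ᵥ b with hc
  have hbb : b ⬝ᵥ b = ∑ i, c i ^ 2 := by
    have : c ⬝ᵥ c = b ⬝ᵥ b := by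
      rw [hc, dotProduct_mulVec, vecMul_transpose, mulVec_mulVec, hU', one_mulVec]
    rw [← this]; simp [dotProduct, sq]
  have hq : b ⬝ᵥ (U * diagonal α * Uᵀ) *ᵥ b = ∑ i, α i * c i ^ 2 := by
    rw [← mulVec_mulVec, ← hc, ← mulVec_mulVec, dotProduct_mulVec, ← mulVec_transpose, ← hc]
    simp only [dotProduct, mulVec_diagonal]
    exact Finset.sum_congr rfl fun i _ => by ring
  have hpos : 0 < ∑ i, c i ^ 2 := by
    rw [← hbb]
    exact lt_of_le_of_ne (Finset.sum_nonneg fun i _ => mul_self_nonneg (b i))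
      (Ne.symm (mt dotProduct_self_eq_zero.1 hb))
  rw [hbb, hq] at h
  obtain ⟨i, hi⟩ : ∃ i, t ≤ |α i| := by
    by_contra! hcon
    have : |∑ i, α i * c i ^ 2| < t * ∑ i, c i ^ 2 := by
      refine (Finset.abs_sum_le_sum_abs _ _).trans_lt ?_
      rw [Finset.mul_sum]
      obtain ⟨i, -, hi⟩ := Finset.exists_ne_zero_of_sum_ne_zero hpos.ne'
      refine Finset.sum_lt_sum (fun i _ => ?_) ⟨i, Finset.mem_univ _, ?_⟩
      · rw [abs_mul, abs_of_nonneg (sq_nonneg (c i))]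
        exact mul_le_mul_of_nonneg_right (hcon i).le (sq_nonneg _)
      · rw [abs_mul, abs_of_nonneg (sq_nonneg (c i))]
        exact mul_lt_mul_of_pos_right (hcon i) (lt_of_le_of_ne (sq_nonneg _) (Ne.symm hi))
    linarith
  calc t ^ (2 * q) ≤ |α i| ^ (2 * q) := pow_le_pow_left₀ ht hi _
    _ = α i ^ (2 * q) := by rw [pow_mul, sq_abs, pow_mul]
    _ ≤ _ := Finset.single_le_sum (f := fun i => α i ^ (2 * q))
        (fun j _ => by simp only [pow_mul]; positivity) (Finset.mem_univ i)

lemma trace_vecMulVec_mul_pow_nonneg {S : Matrix ι ι ℝ} (hS : S.IsHermitian) (x : ι → ℝ) (q : ℕ) :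
    0 ≤ (vecMulVec x x * S ^ (2 * q)).trace := by
  have hST : (S ^ q)ᵀ = S ^ q := by
    have := hS.pow q
    simpa [IsHermitian, conjTranspose_eq_transpose_of_trivial] using this
  have e : x ⬝ᵥ (S ^ (2 * q)) *ᵥ x = (S ^ q *ᵥ x) ⬝ᵥ (S ^ q *ᵥ x) := by
    rw [two_mul, pow_add, ← mulVec_mulVec, dotProduct_mulVec, ← mulVec_transpose, hST]
  rw [trace_vecMulVec_mul, e]
  exact Finset.sum_nonneg fun i _ => mul_self_nonneg _

/-- The squared difference of two rank-one matrices, tested against an even power. -/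
lemma trace_sub_sq_mul_pow_le {S : Matrix ι ι ℝ} (hS : S.IsHermitian) {x y : ι → ℝ} {L : ℝ}
    (hx : x ⬝ᵥ x ≤ L) (hy : y ⬝ᵥ y ≤ L) (q : ℕ) :
    ((vecMulVec x x - vecMulVec y y) * (vecMulVec x x - vecMulVec y y) * S ^ (2 * q)).trace ≤
      2 * L * ((vecMulVec x x * S ^ (2 * q)).trace + (vecMulVec y y * S ^ (2 * q)).trace) := by
  have hST : (S ^ q)ᵀ = S ^ q := by
    have := hS.pow q
    simpa [IsHermitian, conjTranspose_eq_transpose_of_trivial] using this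
  have hsq : ∀ z : ι → ℝ, (vecMulVec z z * vecMulVec z z * S ^ (2 * q)).trace =
      (z ⬝ᵥ z) * (vecMulVec z z * S ^ (2 * q)).trace := fun z => by
    rw [vecMulVec_mul_vecMulVec, vecMulVec_smul, Matrix.smul_mul, trace_smul, smul_eq_mul]
  have hnn : 0 ≤ ((vecMulVec x x + vecMulVec y y) * (vecMulVec x x + vecMulVec y y) *
      S ^ (2 * q)).trace := by
    set P := (vecMulVec x x + vecMulVec y y) * S ^ q with hP
    have hT : (vecMulVec x x + vecMulVec y y)ᵀ = vecMulVec x x + vecMulVec y y := by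
      simp [transpose_vecMulVec]
    have : ((vecMulVec x x + vecMulVec y y) * (vecMulVec x x + vecMulVec y y) *
        S ^ (2 * q)).trace = (Pᵀ * P).trace := by
      rw [hP, transpose_mul, hST, hT, two_mul, pow_add, ← Matrix.mul_assoc, trace_mul_comm]
      simp only [Matrix.mul_assoc]
    rw [this]
    exact (posSemidef_conjTranspose_mul_self P).trace_nonneg
  have hexp : ((vecMulVec x x - vecMulVec y y) * (vecMulVec x x - vecMulVec y y) *
        S ^ (2 * q)).trace +
      ((vecMulVec x x + vecMulVec y y) * (vecMulVec x x + vecMulVec y y) * S ^ (2 * q)).trace =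
      2 * (vecMulVec x x * vecMulVec x x * S ^ (2 * q)).trace +
      2 * (vecMulVec y y * vecMulVec y y * S ^ (2 * q)).trace := by
    simp only [Matrix.sub_mul, Matrix.mul_sub, Matrix.add_mul, Matrix.mul_add, trace_sub, trace_add]
    ring
  rw [hsq, hsq] at hexp
  have h1 := mul_le_mul_of_nonneg_right hx (trace_vecMulVec_mul_pow_nonneg hS x q)
  have h2 := mul_le_mul_of_nonneg_right hy (trace_vecMulVec_mul_pow_nonneg hS y q)
  linarith

end TraceInequalities

/-! ### Moments of sample covariance matrices -/

section BoundedMeasurable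

variable {Ω : Type*} [MeasurableSpace Ω]

/-- Bounded measurable real functions. -/
def BddMeas (f : Ω → ℝ) : Prop := Measurable f ∧ ∃ C, ∀ ω, |f ω| ≤ C

namespace BddMeas

lemma const (c : ℝ) : BddMeas (fun _ : Ω => c) := ⟨measurable_const, |c|, fun _ => le_rfl⟩

lemma add {f g : Ω → ℝ} (hf : BddMeas f) (hg : BddMeas g) : BddMeas (fun ω => f ω + g ω) := by
  obtain ⟨hf, C, hC⟩ := hf
  obtain ⟨hg, C', hC'⟩ := hg
  exact ⟨hf.add hg, C + C', fun ω => (abs_add_le _ _).trans (add_le_add (hC ω) (hC' ω))⟩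

lemma mul {f g : Ω → ℝ} (hf : BddMeas f) (hg : BddMeas g) : BddMeas (fun ω => f ω * g ω) := by
  obtain ⟨hf, C, hC⟩ := hf
  obtain ⟨hg, C', hC'⟩ := hg
  refine ⟨hf.mul hg, C * C', fun ω => ?_⟩
  rw [abs_mul]
  exact mul_le_mul (hC ω) (hC' ω) (abs_nonneg _) ((abs_nonneg _).trans (hC ω))

lemma sub {f g : Ω → ℝ} (hf : BddMeas f) (hg : BddMeas g) : BddMeas (fun ω => f ω - g ω) := by
  simpa [sub_eq_add_neg] using hf.add ((const (-1)).mul hg)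

lemma sum {κ : Type*} (s : Finset κ) {f : κ → Ω → ℝ} (hf : ∀ k ∈ s, BddMeas (f k)) :
    BddMeas (fun ω => ∑ k ∈ s, f k ω) := by
  classical
  induction s using Finset.induction_on with
  | empty => simpa using const 0
  | insert k s hk ih =>
    simp only [Finset.sum_insert hk]
    exact (hf k (Finset.mem_insert_self _ _)).add
      (ih fun j hj => hf j (Finset.mem_insert_of_mem hj))

lemma comp {Ω' : Type*} [MeasurableSpace Ω'] {f : Ω → ℝ} (hf : BddMeas f) {g : Ω' → Ω}
    (hg : Measurable g) : BddMeas (fun ω => f (g ω)) :=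
  ⟨hf.1.comp hg, hf.2.imp fun _ h ω => h (g ω)⟩

lemma integrable {f : Ω → ℝ} (hf : BddMeas f) (μ : Measure Ω) [IsFiniteMeasure μ] :
    Integrable f μ := by
  obtain ⟨hf, C, hC⟩ := hf
  exact Integrable.of_bound hf.aestronglyMeasurable C (ae_of_all _ hC)

end BddMeas

variable {ι : Type*}

/-- Matrix-valued functions with bounded measurable entries. -/
def MatBddMeas (M : Ω → Matrix ι ι ℝ) : Prop := ∀ a b, BddMeas (fun ω => M ω a b)

namespace MatBddMeas

variable {M M' : Ω → Matrix ι ι ℝ}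

lemma const (A : Matrix ι ι ℝ) : MatBddMeas (fun _ : Ω => A) := fun _ _ => BddMeas.const _

lemma sub (h : MatBddMeas M) (h' : MatBddMeas M') : MatBddMeas (fun ω => M ω - M' ω) :=
  fun a b => (h a b).sub (h' a b)

lemma sum {κ : Type*} (s : Finset κ) {M : κ → Ω → Matrix ι ι ℝ} (h : ∀ k ∈ s, MatBddMeas (M k)) :
    MatBddMeas (fun ω => ∑ k ∈ s, M k ω) := fun a b => by
  simp only [Matrix.sum_apply]
  exact BddMeas.sum s fun k hk => h k hk a b

lemma comp {Ω' : Type*} [MeasurableSpace Ω'] (h : MatBddMeas M) {g : Ω' → Ω} (hg : Measurable g) :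
    MatBddMeas (fun ω => M (g ω)) := fun a b => (h a b).comp hg

variable [Fintype ι]

lemma mul (h : MatBddMeas M) (h' : MatBddMeas M') : MatBddMeas (fun ω => M ω * M' ω) :=
  fun a b => by
    simp only [Matrix.mul_apply]
    exact BddMeas.sum _ fun c _ => (h a c).mul (h' c b)

lemma pow [DecidableEq ι] (h : MatBddMeas M) (k : ℕ) : MatBddMeas (fun ω => M ω ^ k) := by
  induction k with
  | zero => simpa using const 1
  | succ k ih => simpa only [pow_succ] using ih.mul h

lemma trace (h : MatBddMeas M) : BddMeas (fun ω => (M ω).trace) :=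
  BddMeas.sum _ fun a _ => h a a

end MatBddMeas

end BoundedMeasurable

section Swap

variable {Ω₀ : Type*} [MeasurableSpace Ω₀] {n : ℕ}

/-- Exchange the `j`-th coordinates of two samples. -/
def swapCoord (j : Fin n) (ω : (Fin n → Ω₀) × (Fin n → Ω₀)) : (Fin n → Ω₀) × (Fin n → Ω₀) :=
  (Function.update ω.1 j (ω.2 j), Function.update ω.2 j (ω.1 j))

lemma measurePreserving_swapCoord (μ : Measure Ω₀) [IsProbabilityMeasure μ] (j : Fin n) :
    MeasurePreserving (swapCoord j)
      ((Measure.pi fun _ : Fin n => μ).prod (Measure.pi fun _ : Fin n => μ))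
      ((Measure.pi fun _ : Fin n => μ).prod (Measure.pi fun _ : Fin n => μ)) := by
  have h1 := measurePreserving_arrowProdEquivProdArrow Ω₀ Ω₀ (Fin n) (fun _ => μ) (fun _ => μ)
  have h2 : MeasurePreserving
      (fun (a : Fin n → Ω₀ × Ω₀) i => (if i = j then Prod.swap else id) (a i))
      (Measure.pi fun _ => μ.prod μ) (Measure.pi fun _ => μ.prod μ) := by
    refine measurePreserving_pi (fun _ : Fin n => μ.prod μ) (fun _ => μ.prod μ)
      (f := fun i => if i = j then Prod.swap else id) fun i => ?_
    by_cases h : i = j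
    · simpa [h] using Measure.measurePreserving_swap
    · simpa [h] using MeasurePreserving.id _
  have h3 := h1.comp (h2.comp h1.symm)
  convert h3 using 1
  funext ω
  refine Prod.ext ?_ ?_ <;> funext i <;> by_cases h : i = j <;>
    simp [swapCoord, MeasurableEquiv.arrowProdEquivProdArrow,
      Equiv.arrowProdEquivProdArrow, h]

end Swap

section Moments

open Matrix

variable {ι Ω₀ : Type*} {n : ℕ}

lemma bddMeas_of_dotProduct_le [Fintype ι] [MeasurableSpace Ω₀] {v : Ω₀ → ι → ℝ}
    (hv : Measurable v) {L : ℝ} (hL : ∀ x, v x ⬝ᵥ v x ≤ L) (a : ι) : BddMeas (fun x => v x a) := by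
  refine ⟨(measurable_pi_apply a).comp hv, √L, fun x => Real.abs_le_sqrt ?_⟩
  refine le_trans ?_ (hL x)
  rw [sq]
  exact Finset.single_le_sum (f := fun a => v x a * v x a) (fun i _ => mul_self_nonneg _)
    (Finset.mem_univ a)

lemma matBddMeas_vecMulVec [Fintype ι] [MeasurableSpace Ω₀] {v : Ω₀ → ι → ℝ}
    (hv : Measurable v) {L : ℝ} (hL : ∀ x, v x ⬝ᵥ v x ≤ L) :
    MatBddMeas (fun x => vecMulVec (v x) (v x)) := fun a b =>
  (bddMeas_of_dotProduct_le hv hL a).mul (bddMeas_of_dotProduct_le hv hL b)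

variable [DecidableEq ι]

/-- The centered sample covariance matrix `∑ⱼ v(ωⱼ) v(ωⱼ)ᵀ - n`. -/
def centeredGram (v : Ω₀ → ι → ℝ) (ω : Fin n → Ω₀) : Matrix ι ι ℝ :=
  ∑ j, vecMulVec (v (ω j)) (v (ω j)) - (n : ℝ) • (1 : Matrix ι ι ℝ)

lemma isHermitian_centeredGram (v : Ω₀ → ι → ℝ) (ω : Fin n → Ω₀) :
    (centeredGram v ω).IsHermitian := by
  rw [IsHermitian, conjTranspose_eq_transpose_of_trivial, centeredGram]
  simp [transpose_sum, transpose_vecMulVec]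

lemma centeredGram_sub_swapCoord (v : Ω₀ → ι → ℝ) (ω : (Fin n → Ω₀) × (Fin n → Ω₀)) (j : Fin n) :
    centeredGram v ω.1 - centeredGram v (swapCoord j ω).1 =
      vecMulVec (v (ω.1 j)) (v (ω.1 j)) - vecMulVec (v (ω.2 j)) (v (ω.2 j)) := by
  simp only [centeredGram, swapCoord, sub_sub_sub_cancel_right]
  rw [← Finset.sum_sub_distrib, Finset.sum_eq_single j]
  · simp
  · intro i _ hi; simp [Function.update_of_ne hi]
  · simp

variable [Fintype ι]

lemma dotProduct_centeredGram_mulVec (v : Ω₀ → ι → ℝ) (ω : Fin n → Ω₀) (b : ι → ℝ) :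
    b ⬝ᵥ centeredGram v ω *ᵥ b = ∑ j, (v (ω j) ⬝ᵥ b) ^ 2 - n * (b ⬝ᵥ b) := by
  rw [centeredGram, sub_mulVec, dotProduct_sub, smul_mulVec, one_mulVec, dotProduct_smul,
    smul_eq_mul, sum_mulVec, dotProduct_sum]
  congr 1
  refine Finset.sum_congr rfl fun j _ => ?_
  rw [vecMulVec_mulVec, dotProduct_smul, dotProduct_comm b]
  simp [sq]

variable [MeasurableSpace Ω₀]

lemma matBddMeas_centeredGram {v : Ω₀ → ι → ℝ} (hv : Measurable v) {L : ℝ}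
    (hL : ∀ x, v x ⬝ᵥ v x ≤ L) :
    MatBddMeas (fun ω : Fin n → Ω₀ => centeredGram v ω) :=
  (MatBddMeas.sum _ fun j _ => (matBddMeas_vecMulVec hv hL).comp (measurable_pi_apply j)).sub
    (MatBddMeas.const _)

variable {μ : Measure Ω₀} [IsProbabilityMeasure μ] {v : Ω₀ → ι → ℝ} {L : ℝ}

lemma integral_trace_indep (hv : Measurable v) (hL : ∀ x, v x ⬝ᵥ v x ≤ L)
    (hI : ∀ a b, ∫ x, v x a * v x b ∂μ = (1 : Matrix ι ι ℝ) a b)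
    {M : (Fin n → Ω₀) → Matrix ι ι ℝ} (hM : MatBddMeas M) (j : Fin n) :
    ∫ ω, (vecMulVec (v (ω.2 j)) (v (ω.2 j)) * M ω.1).trace
      ∂((Measure.pi fun _ : Fin n => μ).prod (Measure.pi fun _ : Fin n => μ)) =
    ∫ ω, (M ω).trace ∂(Measure.pi fun _ : Fin n => μ) := by
  have hb := matBddMeas_vecMulVec hv hL
  have hterm : ∀ a b, ∫ ω : (Fin n → Ω₀) × (Fin n → Ω₀),
      vecMulVec (v (ω.2 j)) (v (ω.2 j)) a b * M ω.1 b a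
      ∂((Measure.pi fun _ : Fin n => μ).prod (Measure.pi fun _ : Fin n => μ)) =
      (1 : Matrix ι ι ℝ) a b * ∫ ω, M ω b a ∂(Measure.pi fun _ : Fin n => μ) := by
    intro a b
    have h1 : ∫ ω : Fin n → Ω₀, vecMulVec (v (ω j)) (v (ω j)) a b
        ∂(Measure.pi fun _ : Fin n => μ) = (1 : Matrix ι ι ℝ) a b := by
      have hm := (measurePreserving_eval (fun _ : Fin n => μ) j).map_eq
      have hi := integral_map (μ := Measure.pi fun _ : Fin n => μ)
        (φ := Function.eval j) (measurable_pi_apply j).aemeasurable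
        (f := fun x => vecMulVec (v x) (v x) a b) (hb a b).1.aestronglyMeasurable
      rw [hm] at hi
      exact hi.symm.trans (hI a b)
    rw [← h1, mul_comm, ← integral_prod_mul]
    exact integral_congr_ae (ae_of_all _ fun ω => mul_comm _ _)
  simp only [trace, diag_apply, mul_apply]
  rw [integral_finsetSum _ fun a _ => ?_, integral_finsetSum _ fun a _ => ?_]
  · refine Finset.sum_congr rfl fun a _ => ?_
    rw [integral_finsetSum _ fun b _ => ?_]
    · simp only [hterm]
      simp [one_apply]
    · exact (((hb a b).comp (by fun_prop)).mul ((hM b a).comp measurable_fst)).integrable _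
  · exact (hM a a).integrable _
  · exact (BddMeas.sum _ fun b _ => ((hb a b).comp (by fun_prop)).mul
      ((hM b a).comp measurable_fst)).integrable _

/-- The exchangeable-pairs estimate for one coordinate. -/
lemma integral_trace_sub_mul_pow_le (hv : Measurable v) (hL : ∀ x, v x ⬝ᵥ v x ≤ L)
    (hI : ∀ a b, ∫ x, v x a * v x b ∂μ = (1 : Matrix ι ι ℝ) a b) (j : Fin n) (q : ℕ) :
    ∫ ω, ((vecMulVec (v (ω j)) (v (ω j)) - 1) * centeredGram v ω ^ (2 * q + 1)).trace
      ∂(Measure.pi fun _ : Fin n => μ) ≤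
    (2 * q + 1) * L * (∫ ω, (vecMulVec (v (ω j)) (v (ω j)) * centeredGram v ω ^ (2 * q)).trace
        ∂(Measure.pi fun _ : Fin n => μ) +
      ∫ ω, (centeredGram v ω ^ (2 * q)).trace ∂(Measure.pi fun _ : Fin n => μ)) := by
  set P := Measure.pi fun _ : Fin n => μ with hP
  have hA := matBddMeas_vecMulVec hv hL
  have hS := matBddMeas_centeredGram (n := n) hv hL
  have hA1 : MatBddMeas (fun ω : (Fin n → Ω₀) × (Fin n → Ω₀) =>
    vecMulVec (v (ω.1 j)) (v (ω.1 j))) := hA.comp (by fun_prop)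
  have hA2 : MatBddMeas (fun ω : (Fin n → Ω₀) × (Fin n → Ω₀) =>
    vecMulVec (v (ω.2 j)) (v (ω.2 j))) := hA.comp (by fun_prop)
  have hS1 : ∀ k, MatBddMeas (fun ω : (Fin n → Ω₀) × (Fin n → Ω₀) => centeredGram v ω.1 ^ k) :=
    fun k => (hS.pow k).comp measurable_fst
  have hsw := measurePreserving_swapCoord μ j
  rw [← hP] at hsw
  have hSs : ∀ k, MatBddMeas (fun ω : (Fin n → Ω₀) × (Fin n → Ω₀) =>
    centeredGram v (swapCoord j ω).1 ^ k) := fun k => (hS1 k).comp hsw.measurable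
  have hfst : ∀ {f : (Fin n → Ω₀) → ℝ}, BddMeas f → ∫ ω, f ω ∂P = ∫ ω, f ω.1 ∂(P.prod P) :=
    fun {f} hf => by
      conv_lhs => rw [← (measurePreserving_fst (μ := P) (ν := P)).map_eq]
      exact integral_map measurable_fst.aemeasurable hf.1.aestronglyMeasurable
  have hswi : ∀ {f : (Fin n → Ω₀) × (Fin n → Ω₀) → ℝ}, BddMeas f →
      ∫ ω, f (swapCoord j ω) ∂(P.prod P) = ∫ ω, f ω ∂(P.prod P) := fun {f} hf => by
    conv_rhs => rw [← hsw.map_eq]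
    exact (integral_map hsw.measurable.aemeasurable hf.1.aestronglyMeasurable).symm
  have hsw1 : ∀ ω : (Fin n → Ω₀) × (Fin n → Ω₀), (swapCoord j ω).1 j = ω.2 j := fun ω => by
    simp [swapCoord]
  have hsw2 : ∀ ω : (Fin n → Ω₀) × (Fin n → Ω₀), (swapCoord j ω).2 j = ω.1 j := fun ω => by
    simp [swapCoord]
  set A : (Fin n → Ω₀) × (Fin n → Ω₀) → Matrix ι ι ℝ := fun ω => vecMulVec (v (ω.1 j)) (v (ω.1 j))
    with hAdef
  set B : (Fin n → Ω₀) × (Fin n → Ω₀) → Matrix ι ι ℝ := fun ω => vecMulVec (v (ω.2 j)) (v (ω.2 j))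
    with hBdef
  have hsymm : ∫ ω, ((vecMulVec (v (ω j)) (v (ω j)) - 1) * centeredGram v ω ^ (2 * q + 1)).trace ∂P
      = ∫ ω, ((A ω - B ω) * centeredGram v ω.1 ^ (2 * q + 1)).trace ∂(P.prod P) := by
    simp only [Matrix.sub_mul, trace_sub, Matrix.one_mul]
    rw [integral_sub, integral_sub, integral_trace_indep hv hL hI (hS.pow _) j, hfst]
    · exact (((hA.comp (measurable_pi_apply j)).mul (hS.pow _))).trace
    · exact (hA1.mul (hS1 _)).trace.integrable _
    · exact (hA2.mul (hS1 _)).trace.integrable _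
    · exact (((hA.comp (measurable_pi_apply j)).mul (hS.pow _))).trace.integrable _
    · exact (hS.pow _).trace.integrable _
  have hswap : ∫ ω, ((A ω - B ω) * centeredGram v ω.1 ^ (2 * q + 1)).trace ∂(P.prod P) =
      -∫ ω, ((A ω - B ω) * centeredGram v (swapCoord j ω).1 ^ (2 * q + 1)).trace ∂(P.prod P) := by
    rw [← hswi ((hA1.sub hA2).mul (hS1 _)).trace, ← integral_neg]
    refine integral_congr_ae (ae_of_all _ fun ω => ?_)
    simp only [hAdef, hBdef, hsw1, hsw2]
    rw [← neg_sub, Matrix.neg_mul, trace_neg]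
  have hdiff : 2 * ∫ ω, ((A ω - B ω) * centeredGram v ω.1 ^ (2 * q + 1)).trace ∂(P.prod P) ≤
      (2 * q + 1 : ℝ) / 2 * (2 * ∫ ω, ((A ω - B ω) * (A ω - B ω) *
        centeredGram v ω.1 ^ (2 * q)).trace ∂(P.prod P)) := by
    calc 2 * ∫ ω, ((A ω - B ω) * centeredGram v ω.1 ^ (2 * q + 1)).trace ∂(P.prod P)
        = ∫ ω, ((A ω - B ω) * centeredGram v ω.1 ^ (2 * q + 1)).trace ∂(P.prod P)
          - ∫ ω, ((A ω - B ω) * centeredGram v (swapCoord j ω).1 ^ (2 * q + 1)).trace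
            ∂(P.prod P) := by linarith
      _ = ∫ ω, ((A ω - B ω) * (centeredGram v ω.1 ^ (2 * q + 1) -
            centeredGram v (swapCoord j ω).1 ^ (2 * q + 1))).trace ∂(P.prod P) := by
          rw [← integral_sub (((hA1.sub hA2).mul (hS1 _)).trace.integrable _)
            (((hA1.sub hA2).mul (hSs _)).trace.integrable _)]
          simp only [Matrix.mul_sub, trace_sub]
      _ ≤ ∫ ω, (2 * q + 1 : ℝ) / 2 * (((A ω - B ω) * (A ω - B ω) *
            centeredGram v ω.1 ^ (2 * q)).trace + ((A ω - B ω) * (A ω - B ω) *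
            centeredGram v (swapCoord j ω).1 ^ (2 * q)).trace) ∂(P.prod P) := by
          refine integral_mono ?_ ?_ fun ω => ?_
          · exact ((hA1.sub hA2).mul ((hS1 _).sub (hSs _))).trace.integrable _
          · exact ((((((hA1.sub hA2).mul (hA1.sub hA2)).mul (hS1 _)).trace.add
              (((hA1.sub hA2).mul (hA1.sub hA2)).mul (hSs _)).trace).integrable _).const_mul _)
          · have := trace_sub_mul_pow_sub_pow_le (isHermitian_centeredGram v ω.1)
              (isHermitian_centeredGram v (swapCoord j ω).1) q
            rwa [centeredGram_sub_swapCoord] at this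
      _ = _ := by
          have hF := hswi (((hA1.sub hA2).mul (hA1.sub hA2)).mul (hS1 (2 * q))).trace
          have hF' : ∫ ω, ((A ω - B ω) * (A ω - B ω) *
              centeredGram v (swapCoord j ω).1 ^ (2 * q)).trace ∂(P.prod P) =
              ∫ ω, ((A ω - B ω) * (A ω - B ω) * centeredGram v ω.1 ^ (2 * q)).trace
                ∂(P.prod P) := by
            rw [← hF]
            refine integral_congr_ae (ae_of_all _ fun ω => ?_)
            simp only [hAdef, hBdef, hsw1, hsw2]
            rw [← neg_sub (vecMulVec (v (ω.1 j)) _), neg_mul_neg]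
          rw [integral_const_mul, integral_add]
          · rw [hF']
            ring
          · exact (((hA1.sub hA2).mul (hA1.sub hA2)).mul (hS1 _)).trace.integrable _
          · exact (((hA1.sub hA2).mul (hA1.sub hA2)).mul (hSs _)).trace.integrable _
  have hsq : ∫ ω, ((A ω - B ω) * (A ω - B ω) * centeredGram v ω.1 ^ (2 * q)).trace ∂(P.prod P) ≤
      2 * L * (∫ ω, (vecMulVec (v (ω j)) (v (ω j)) * centeredGram v ω ^ (2 * q)).trace ∂P +
        ∫ ω, (centeredGram v ω ^ (2 * q)).trace ∂P) := by
    rw [← integral_trace_indep hv hL hI (hS.pow _) j,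
      hfst ((hA.comp (measurable_pi_apply j)).mul (hS.pow _)).trace, ← integral_add,
      ← integral_const_mul]
    · refine integral_mono ?_ ?_ fun ω => trace_sub_sq_mul_pow_le (isHermitian_centeredGram v ω.1)
        (hL _) (hL _) q
      · exact (((hA1.sub hA2).mul (hA1.sub hA2)).mul (hS1 _)).trace.integrable _
      · exact (((hA1.mul (hS1 _)).trace.add (hA2.mul (hS1 _)).trace).integrable _).const_mul _
    · exact (hA1.mul (hS1 _)).trace.integrable _
    · exact (hA2.mul (hS1 _)).trace.integrable _
  rw [hsymm]
  have hq : (0 : ℝ) ≤ (2 * q + 1 : ℝ) / 2 := by positivity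
  nlinarith [mul_le_mul_of_nonneg_left hsq hq]

/-- Recursion for the even trace moments. -/
lemma integral_trace_pow_succ_le (hv : Measurable v) (hL : ∀ x, v x ⬝ᵥ v x ≤ L) (hLn : L ≤ n)
    (hL0 : 0 ≤ L) (hI : ∀ a b, ∫ x, v x a * v x b ∂μ = (1 : Matrix ι ι ℝ) a b) (q : ℕ) :
    ∫ ω, (centeredGram v ω ^ (2 * (q + 1))).trace ∂(Measure.pi fun _ : Fin n => μ) ≤
      (5 * (2 * q + 1) ^ 2 * (L * n)) *
        ∫ ω, (centeredGram v ω ^ (2 * q)).trace ∂(Measure.pi fun _ : Fin n => μ) := by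
  set P := Measure.pi fun _ : Fin n => μ with hP
  have hA := matBddMeas_vecMulVec hv hL
  have hS := matBddMeas_centeredGram (n := n) hv hL
  set c : ℝ := (2 * q + 1) * L with hc
  have h1 : ∫ ω, (centeredGram v ω ^ (2 * (q + 1))).trace ∂P ≤
      c * (∫ ω, (centeredGram v ω ^ (2 * q + 1)).trace ∂P +
        2 * n * ∫ ω, (centeredGram v ω ^ (2 * q)).trace ∂P) := by
    have e1 : ∫ ω, (centeredGram v ω ^ (2 * (q + 1))).trace ∂P =
        ∑ j, ∫ ω, ((vecMulVec (v (ω j)) (v (ω j)) - 1) * centeredGram v ω ^ (2 * q + 1)).trace ∂P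
        := by
      rw [← integral_finsetSum]
      · refine integral_congr_ae (ae_of_all _ fun ω => ?_)
        simp only
        rw [← trace_sum, ← Finset.sum_mul, Finset.sum_sub_distrib, Finset.sum_const,
          Finset.card_univ, Fintype.card_fin, ← Nat.cast_smul_eq_nsmul ℝ, ← centeredGram,
          ← pow_succ']
        rfl
      · intro j _
        exact (((hA.comp (measurable_pi_apply j)).sub (MatBddMeas.const 1)).mul
          (hS.pow _)).trace.integrable _
    have e2 : ∑ j, ∫ ω, (vecMulVec (v (ω j)) (v (ω j)) * centeredGram v ω ^ (2 * q)).trace ∂P =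
        ∫ ω, (centeredGram v ω ^ (2 * q + 1)).trace ∂P +
          n * ∫ ω, (centeredGram v ω ^ (2 * q)).trace ∂P := by
      rw [← integral_finsetSum, ← integral_const_mul, ← integral_add]
      · refine integral_congr_ae (ae_of_all _ fun ω => ?_)
        simp only
        rw [← trace_sum, ← Finset.sum_mul, pow_succ']
        conv_rhs => rw [centeredGram]
        rw [Matrix.sub_mul, trace_sub, Matrix.smul_mul, trace_smul, Matrix.one_mul, smul_eq_mul,
          ← centeredGram]
        ring
      · exact (hS.pow _).trace.integrable _
      · exact ((hS.pow _).trace.integrable _).const_mul _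
      · intro j _
        exact ((hA.comp (measurable_pi_apply j)).mul (hS.pow _)).trace.integrable _
    rw [e1]
    refine (Finset.sum_le_sum fun j _ => integral_trace_sub_mul_pow_le hv hL hI j q).trans_eq ?_
    rw [← Finset.mul_sum, Finset.sum_add_distrib, e2, Finset.sum_const, Finset.card_univ,
      Fintype.card_fin, nsmul_eq_mul]
    ring
  have h2 : c * ∫ ω, (centeredGram v ω ^ (2 * q + 1)).trace ∂P ≤
      (1 / 2) * ∫ ω, (centeredGram v ω ^ (2 * (q + 1))).trace ∂P +
        (c ^ 2 / 2) * ∫ ω, (centeredGram v ω ^ (2 * q)).trace ∂P := by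
    rw [← integral_const_mul, ← integral_const_mul, ← integral_const_mul, ← integral_add]
    · exact integral_mono (((hS.pow _).trace.integrable _).const_mul _)
        ((((hS.pow _).trace.integrable _).const_mul _).add
          (((hS.pow _).trace.integrable _).const_mul _))
        fun ω => mul_trace_pow_odd_le (isHermitian_centeredGram v ω) q c
    · exact ((hS.pow _).trace.integrable _).const_mul _
    · exact ((hS.pow _).trace.integrable _).const_mul _
  have h0 : 0 ≤ ∫ ω, (centeredGram v ω ^ (2 * q)).trace ∂P :=
    integral_nonneg fun ω => trace_pow_two_mul_nonneg (isHermitian_centeredGram v ω) q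
  set E := ∫ ω, (centeredGram v ω ^ (2 * q)).trace ∂P
  have h3 : ∫ ω, (centeredGram v ω ^ (2 * (q + 1))).trace ∂P ≤ (c ^ 2 + 4 * c * n) * E := by
    nlinarith
  refine h3.trans (mul_le_mul_of_nonneg_right ?_ h0)
  have hLL : L * L ≤ L * n := mul_le_mul_of_nonneg_left hLn hL0
  have hr : (1 : ℝ) ≤ 2 * q + 1 := by
    have : (0 : ℝ) ≤ q := Nat.cast_nonneg q
    linarith
  set r : ℝ := 2 * q + 1
  have hLn0 : 0 ≤ L * n := mul_nonneg hL0 (Nat.cast_nonneg n)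
  rw [hc]
  nlinarith [mul_le_mul_of_nonneg_left hLL (sq_nonneg r),
    mul_le_mul_of_nonneg_right (show r ≤ r ^ 2 by nlinarith) hLn0]

lemma integral_trace_pow_le (hv : Measurable v) (hL : ∀ x, v x ⬝ᵥ v x ≤ L) (hLn : L ≤ n)
    (hL0 : 0 ≤ L) (hI : ∀ a b, ∫ x, v x a * v x b ∂μ = (1 : Matrix ι ι ℝ) a b) (q : ℕ) :
    ∫ ω, (centeredGram v ω ^ (2 * q)).trace ∂(Measure.pi fun _ : Fin n => μ) ≤
      (5 * (2 * q + 1) ^ 2 * (L * n)) ^ q * Fintype.card ι := by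
  suffices h : ∀ k ≤ q, ∫ ω, (centeredGram v ω ^ (2 * k)).trace ∂(Measure.pi fun _ : Fin n => μ) ≤
      (5 * (2 * q + 1) ^ 2 * (L * n)) ^ k * Fintype.card ι from h q le_rfl
  intro k
  have hLn0 : 0 ≤ L * n := mul_nonneg hL0 (Nat.cast_nonneg n)
  induction k with
  | zero => intro _; simp
  | succ k ih =>
    intro hk
    have hkq : (k : ℝ) ≤ q := by exact_mod_cast (by omega : k ≤ q)
    refine (integral_trace_pow_succ_le hv hL hLn hL0 hI k).trans ?_
    rw [pow_succ' _ k, mul_assoc _ (_ ^ k) _]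
    refine mul_le_mul ?_ (ih (by omega)) (integral_nonneg fun ω =>
      trace_pow_two_mul_nonneg (isHermitian_centeredGram v ω) k) (by positivity)
    gcongr

/-- Polynomial concentration of the sample covariance of isotropic bounded vectors. -/
lemma measure_exists_abs_centeredGram_le (hv : Measurable v) (hL : ∀ x, v x ⬝ᵥ v x ≤ L)
    (hLn : L ≤ n) (hL0 : 0 ≤ L) (hn : 0 < n)
    (hI : ∀ a b, ∫ x, v x a * v x b ∂μ = (1 : Matrix ι ι ℝ) a b) (q : ℕ) :
    (Measure.pi fun _ : Fin n => μ) {ω : Fin n → Ω₀ | ∃ b : ι → ℝ, b ≠ 0 ∧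
        (n / 2 : ℝ) * (b ⬝ᵥ b) ≤ |∑ j, (v (ω j) ⬝ᵥ b) ^ 2 - n * (b ⬝ᵥ b)|} ≤
      ENNReal.ofReal ((20 * (2 * q + 1) ^ 2 * (L / n)) ^ q * Fintype.card ι) := by
  set P := Measure.pi fun _ : Fin n => μ with hP
  have hS := matBddMeas_centeredGram (n := n) hv hL
  have hn' : (0 : ℝ) < n := by exact_mod_cast hn
  have hsub : {ω : Fin n → Ω₀ | ∃ b : ι → ℝ, b ≠ 0 ∧
        (n / 2 : ℝ) * (b ⬝ᵥ b) ≤ |∑ j, (v (ω j) ⬝ᵥ b) ^ 2 - n * (b ⬝ᵥ b)|} ⊆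
      {ω : Fin n → Ω₀ | (n / 2 : ℝ) ^ (2 * q) ≤ (centeredGram v ω ^ (2 * q)).trace} := by
    rintro ω ⟨b, hb, h⟩
    rw [← dotProduct_centeredGram_mulVec] at h
    exact pow_le_trace_pow (isHermitian_centeredGram v ω) q (by positivity) hb h
  refine (measure_mono hsub).trans ?_
  have hmk := mul_meas_ge_le_integral_of_nonneg (μ := P)
    (f := fun ω => (centeredGram v ω ^ (2 * q)).trace)
    (ae_of_all _ fun ω => trace_pow_two_mul_nonneg (isHermitian_centeredGram v ω) q)
    ((hS.pow _).trace.integrable _) ((n / 2 : ℝ) ^ (2 * q))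
  have hb := hmk.trans (integral_trace_pow_le hv hL hLn hL0 hI q)
  rw [← ENNReal.ofReal_toReal (measure_ne_top P _)]
  refine ENNReal.ofReal_le_ofReal ?_
  have hpos : (0 : ℝ) < (n / 2 : ℝ) ^ (2 * q) := by positivity
  rw [← measureReal_def]
  rw [mul_comm, ← le_div_iff₀ hpos] at hb
  refine hb.trans_eq ?_
  rw [div_eq_iff hpos.ne', pow_mul, mul_right_comm _ (Fintype.card ι : ℝ), ← mul_pow]
  congr 2
  field_simp
  ring

end Moments

section LowerTail

open Matrix

variable {ι : Type*} [Fintype ι] [DecidableEq ι] {Ω₀ : Type*} [MeasurableSpace Ω₀] {n : ℕ}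

/-- Lower tail of the sample covariance of bounded vectors with well-conditioned covariance. -/
lemma measure_exists_sum_sq_le (μ : Measure Ω₀) [IsProbabilityMeasure μ] {v : Ω₀ → ι → ℝ}
    {L lam : ℝ}
    (hv : Measurable v) (hL : ∀ x, v x ⬝ᵥ v x ≤ L) (hL0 : 0 ≤ L) (hlam : 0 < lam)
    (hcov : ∀ b, lam * (b ⬝ᵥ b) ≤ ∫ x, (v x ⬝ᵥ b) ^ 2 ∂μ) (hn : 0 < n) (hLn : L / lam ≤ n)
    (q : ℕ) :
    (Measure.pi fun _ : Fin n => μ) {ω : Fin n → Ω₀ | ∃ b : ι → ℝ, b ≠ 0 ∧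
        ∑ j, (v (ω j) ⬝ᵥ b) ^ 2 ≤ (n / 2 : ℝ) * (lam * (b ⬝ᵥ b))} ≤
      ENNReal.ofReal ((20 * (2 * q + 1) ^ 2 * (L / lam / n)) ^ q * Fintype.card ι) := by
  have hn' : (0 : ℝ) < n := by exact_mod_cast hn
  have hvb := fun a => bddMeas_of_dotProduct_le hv hL a
  have hint : ∀ a b, Integrable (fun x => v x a * v x b) μ := fun a b =>
    ((hvb a).mul (hvb b)).integrable μ
  set S : Matrix ι ι ℝ := Matrix.of fun a b => ∫ x, v x a * v x b ∂μ with hSdef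
  have hS : S.IsHermitian := by
    rw [IsHermitian, conjTranspose_eq_transpose_of_trivial]
    ext a b
    simp [hSdef, mul_comm]
  have hbil : ∀ b c : ι → ℝ, ∫ x, (v x ⬝ᵥ b) * (v x ⬝ᵥ c) ∂μ = b ⬝ᵥ S *ᵥ c := by
    intro b c
    have : ∀ x, (v x ⬝ᵥ b) * (v x ⬝ᵥ c) = ∑ i, ∑ j, (b i * c j) * (v x i * v x j) := fun x => by
      simp only [dotProduct, Finset.sum_mul_sum]
      exact Finset.sum_congr rfl fun i _ => Finset.sum_congr rfl fun j _ => by ring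
    simp only [this]
    rw [integral_finsetSum _ fun i _ => integrable_finsetSum _ fun j _ => (hint i j).const_mul _]
    simp only [dotProduct, mulVec, Finset.mul_sum]
    refine Finset.sum_congr rfl fun i _ => ?_
    rw [integral_finsetSum _ fun j _ => (hint i j).const_mul _]
    refine Finset.sum_congr rfl fun j _ => ?_
    rw [integral_const_mul, hSdef, of_apply]
    ring
  obtain ⟨U, α, hU1, hU2, hUα⟩ := exists_orthogonal_diagonalization hS
  have hUSU : Uᵀ * S * U = diagonal α := by
    rw [hUα]
    calc Uᵀ * (U * diagonal α * Uᵀ) * U = (Uᵀ * U) * diagonal α * (Uᵀ * U) := by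
          simp only [Matrix.mul_assoc]
      _ = diagonal α := by rw [hU1, Matrix.one_mul, Matrix.mul_one]
  have hUS : ∀ y z : ι → ℝ, (U *ᵥ y) ⬝ᵥ S *ᵥ (U *ᵥ z) = y ⬝ᵥ diagonal α *ᵥ z := fun y z => by
    rw [← hUSU, ← mulVec_mulVec, ← mulVec_mulVec, dotProduct_mulVec y, vecMul_transpose]
  have hUU : ∀ y z : ι → ℝ, (U *ᵥ y) ⬝ᵥ (U *ᵥ z) = y ⬝ᵥ z := fun y z => by
    rw [dotProduct_mulVec, ← mulVec_transpose, mulVec_mulVec, hU1, one_mulVec]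
  have hUUt : ∀ y z : ι → ℝ, (Uᵀ *ᵥ y) ⬝ᵥ (Uᵀ *ᵥ z) = y ⬝ᵥ z := fun y z => by
    rw [dotProduct_mulVec, ← mulVec_transpose, mulVec_mulVec, transpose_transpose, hU2, one_mulVec]
  have hα : ∀ a, lam ≤ α a := fun a => by
    have h := hcov (U *ᵥ Pi.single a 1)
    simp only [sq, hbil, hUS, hUU] at h
    simpa using h
  have hα0 : ∀ a, 0 < α a := fun a => hlam.trans_le (hα a)
  set v' : Ω₀ → ι → ℝ := fun x a => (√(α a))⁻¹ * (v x ⬝ᵥ U *ᵥ Pi.single a 1) with hv'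
  have hv'U : ∀ x a, v' x a = (√(α a))⁻¹ * (Uᵀ *ᵥ v x) a := fun x a => by
    rw [hv']
    simp only
    rw [dotProduct_mulVec, ← mulVec_transpose]
    simp
  have hv'm : Measurable v' := by
    refine measurable_pi_lambda _ fun a => Measurable.const_mul ?_ _
    exact Finset.measurable_sum _ fun i _ => ((measurable_pi_apply i).comp hv).mul_const _
  have hI' : ∀ a b, ∫ x, v' x a * v' x b ∂μ = (1 : Matrix ι ι ℝ) a b := fun a b => by
    have : ∀ x, v' x a * v' x b = ((√(α a))⁻¹ * (√(α b))⁻¹) *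
        ((v x ⬝ᵥ U *ᵥ Pi.single a 1) * (v x ⬝ᵥ U *ᵥ Pi.single b 1)) := fun x => by
      simp only [hv']; ring
    simp only [this]
    rw [integral_const_mul, hbil, hUS]
    by_cases hab : a = b
    · subst hab
      simp only [single_dotProduct, mulVec_diagonal, one_apply_eq, one_mul,
        Pi.single_eq_same, mul_one]
      rw [← mul_inv, Real.mul_self_sqrt (hα0 a).le, inv_mul_cancel₀ (hα0 a).ne']
    · simp [hab]
  have hL' : ∀ x, v' x ⬝ᵥ v' x ≤ L / lam := fun x => by
    rw [le_div_iff₀ hlam]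
    refine le_trans ?_ (hL x)
    rw [← hUUt (v x), dotProduct, dotProduct, Finset.sum_mul]
    refine Finset.sum_le_sum fun a _ => ?_
    rw [hv'U]
    have h1 : (√(α a))⁻¹ * (√(α a))⁻¹ * lam ≤ 1 := by
      rw [← mul_inv, Real.mul_self_sqrt (hα0 a).le, inv_mul_le_iff₀ (hα0 a)]
      simpa using hα a
    nlinarith [mul_self_nonneg ((Uᵀ *ᵥ v x) a)]
  refine (measure_mono ?_).trans (measure_exists_abs_centeredGram_le (μ := μ) hv'm hL' hLn
    (by positivity) hn hI' q)
  rintro ω ⟨b, hb, h⟩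
  set b' : ι → ℝ := fun a => √(α a) * (Uᵀ *ᵥ b) a with hb'
  have hbb : lam * (b ⬝ᵥ b) ≤ b' ⬝ᵥ b' := by
    rw [← hUUt b, dotProduct, dotProduct, Finset.mul_sum]
    refine Finset.sum_le_sum fun a _ => ?_
    have : b' a * b' a = α a * ((Uᵀ *ᵥ b) a * (Uᵀ *ᵥ b) a) := by
      rw [hb']
      simp only
      rw [mul_mul_mul_comm, Real.mul_self_sqrt (hα0 a).le]
    rw [this]
    exact mul_le_mul_of_nonneg_right (hα a) (mul_self_nonneg _)
  have hbpos : 0 < b ⬝ᵥ b := by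
    refine lt_of_le_of_ne (Finset.sum_nonneg fun i _ => mul_self_nonneg _) ?_
    exact fun h0 => hb (dotProduct_self_eq_zero.1 h0.symm)
  have hvb' : ∀ x, v' x ⬝ᵥ b' = v x ⬝ᵥ b := fun x => by
    rw [← hUUt (v x) b]
    refine Finset.sum_congr rfl fun a _ => ?_
    rw [hv'U, hb']
    have := (Real.sqrt_pos.2 (hα0 a)).ne'
    field_simp
  have hb'pos : 0 < b' ⬝ᵥ b' := (mul_pos hlam hbpos).trans_le hbb
  refine ⟨b', ?_, ?_⟩
  · rintro h0
    rw [h0] at hb'pos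
    simp at hb'pos
  · simp only [hvb']
    rw [abs_sub_comm]
    refine le_trans ?_ (le_abs_self _)
    nlinarith

end LowerTail

/-! ### Rotation-invariant measures on the unit sphere -/

section Sphere

open scoped InnerProductSpace Pointwise

/-- The unit sphere in `ℝ^d`. -/
abbrev Sph (d : ℕ) : Type := Metric.sphere (0 : EuclideanSpace ℝ (Fin d)) 1

variable {d : ℕ}

/-- Action of a linear isometry on the sphere. -/
def rot (R : EuclideanSpace ℝ (Fin d) ≃ₗᵢ[ℝ] EuclideanSpace ℝ (Fin d)) (u : Sph d) : Sph d :=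
  ⟨R u, by have := u.2; rw [mem_sphere_zero_iff_norm] at *; rw [R.norm_map, this]⟩

lemma coe_rot (R : EuclideanSpace ℝ (Fin d) ≃ₗᵢ[ℝ] EuclideanSpace ℝ (Fin d)) (u : Sph d) :
    (rot R u : EuclideanSpace ℝ (Fin d)) = R u := rfl

lemma continuous_rot (R : EuclideanSpace ℝ (Fin d) ≃ₗᵢ[ℝ] EuclideanSpace ℝ (Fin d)) :
    Continuous (rot R) :=
  (R.continuous.comp continuous_subtype_val).subtype_mk _

lemma norm_coe_sph (u : Sph d) : ‖(u : EuclideanSpace ℝ (Fin d))‖ = 1 :=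
  mem_sphere_zero_iff_norm.1 u.2

/-- Two pairs of points on the sphere at the same distance are related by an isometry. -/
lemma exists_rot_pair {u v u' v' : Sph d}
    (h : ⟪(u : EuclideanSpace ℝ (Fin d)), v⟫_ℝ = ⟪(u' : EuclideanSpace ℝ (Fin d)), v'⟫_ℝ) :
    ∃ R, rot R u = u' ∧ rot R v = v' := by
  set R₁ := Submodule.reflection (ℝ ∙ ((u : EuclideanSpace ℝ (Fin d)) - u'))ᗮ with hR₁
  have h1 : R₁ u = u' := Submodule.reflection_sub (by rw [norm_coe_sph, norm_coe_sph])
  set R₂ := Submodule.reflection (ℝ ∙ (R₁ (v : EuclideanSpace ℝ (Fin d)) - v'))ᗮ with hR₂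
  have h2 : R₂ (R₁ v) = v' :=
    Submodule.reflection_sub (by rw [R₁.norm_map, norm_coe_sph, norm_coe_sph])
  have h3 : R₂ u' = u' := by
    refine Submodule.reflection_mem_subspace_eq_self ?_
    rw [Submodule.mem_orthogonal_singleton_iff_inner_right, inner_sub_left, sub_eq_zero,
      real_inner_comm, real_inner_comm (u' : EuclideanSpace ℝ (Fin d)), ← h, ← h1, R₁.inner_map_map]
  refine ⟨R₁.trans R₂, Subtype.ext ?_, Subtype.ext ?_⟩
  · simp [coe_rot, h1, h3]
  · simp [coe_rot, h2]

lemma exists_rot (u v : Sph d) : ∃ R, rot R u = v := by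
  obtain ⟨R, h, _⟩ := exists_rot_pair (u := u) (v := u) (u' := v) (v' := v)
    (by simp)
  exact ⟨R, h⟩

/-- A measure on the sphere invariant under all linear isometries. -/
def RotInv (τ : Measure (Sph d)) : Prop := ∀ R, MeasurePreserving (rot R) τ τ

lemma sphereUniform_eq_zero_or (hd : 1 ≤ d) :
    sphereUniform d 1 = 0 ∨ ∃ τ : Measure (Sph d), IsProbabilityMeasure τ ∧ RotInv τ ∧
      ∀ r : ℝ, 0 < r → sphereUniform d r =
        τ.map (fun u : Sph d => r • (u : EuclideanSpace ℝ (Fin d))) := by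
  set H : Measure (EuclideanSpace ℝ (Fin d)) := Measure.hausdorffMeasure ((d : ℝ) - 1) with hH
  have hd' : (0 : ℝ) ≤ d - 1 := by
    have : (1 : ℝ) ≤ d := by exact_mod_cast hd
    linarith
  set c := H (Metric.sphere 0 1) with hc
  by_cases hc0 : c = 0
  · left
    rw [sphereUniform, ← hH, Measure.restrict_eq_zero.2 hc0, smul_zero]
  by_cases hct : c = ⊤
  · left
    rw [sphereUniform, ← hH, ← hc, hct, ENNReal.inv_top, zero_smul]
  right
  have hms : MeasurableSet (Metric.sphere (0 : EuclideanSpace ℝ (Fin d)) 1) :=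
    Metric.isClosed_sphere.measurableSet
  have hemb : MeasurableEmbedding (Subtype.val : Sph d → EuclideanSpace ℝ (Fin d)) :=
    MeasurableEmbedding.subtype_coe hms
  set τ : Measure (Sph d) := c⁻¹ • H.comap Subtype.val with hτ
  refine ⟨τ, ⟨?_⟩, fun R => ⟨(continuous_rot R).measurable, ?_⟩, fun r hr => ?_⟩
  · rw [hτ, Measure.smul_apply, hemb.comap_apply, Set.image_univ, Subtype.range_coe, smul_eq_mul,
      ENNReal.inv_mul_cancel hc0 hct]
  · ext s hs
    rw [Measure.map_apply (continuous_rot R).measurable hs, hτ, Measure.smul_apply,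
      Measure.smul_apply, hemb.comap_apply, hemb.comap_apply]
    congr 1
    rw [hH, ← R.toIsometryEquiv.hausdorffMeasure_image]
    congr 1
    ext x
    simp only [Set.mem_image, Set.mem_preimage]
    constructor
    · rintro ⟨_, ⟨u, hu, rfl⟩, rfl⟩
      exact ⟨_, hu, rfl⟩
    · rintro ⟨u, hu, rfl⟩
      have : rot R (rot R.symm u) = u := Subtype.ext (by simp [coe_rot])
      exact ⟨_, ⟨rot R.symm u, by rwa [this], rfl⟩, by simp [coe_rot]⟩
  · set k : ENNReal := ((‖r‖₊ ^ ((d : ℝ) - 1) : NNReal) : ENNReal) with hk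
    have hk0 : k ≠ 0 := by
      rw [hk, ENNReal.coe_ne_zero]
      exact (NNReal.rpow_pos (nnnorm_pos.2 hr.ne')).ne'
    have hsm : ∀ A : Set (EuclideanSpace ℝ (Fin d)), H (r • A) = k * H A := fun A => by
      rw [hH, Measure.hausdorffMeasure_smul₀ hd' hr.ne', ENNReal.smul_def, smul_eq_mul]
    have hmeas : Measurable (fun u : Sph d => r • (u : EuclideanSpace ℝ (Fin d))) := by fun_prop
    have hsph : Metric.sphere (0 : EuclideanSpace ℝ (Fin d)) r = r • Metric.sphere 0 1 := by
      rw [smul_sphere' hr.ne', smul_zero, mul_one, Real.norm_of_nonneg hr.le]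
    ext A hA
    rw [Measure.map_apply hmeas hA, sphereUniform, ← hH, hτ, Measure.smul_apply, Measure.smul_apply,
      Measure.restrict_apply hA, hemb.comap_apply, smul_eq_mul, smul_eq_mul, hsph]
    have hB : A ∩ r • Metric.sphere 0 1 = r • (Subtype.val ''
        ((fun u : Sph d => r • (u : EuclideanSpace ℝ (Fin d))) ⁻¹' A)) := by
      ext x
      constructor
      · rintro ⟨hx, y, hy, rfl⟩
        exact ⟨y, ⟨⟨y, hy⟩, hx, rfl⟩, rfl⟩
      · rintro ⟨_, ⟨u, hu, rfl⟩, rfl⟩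
        exact ⟨hu, u, u.2, rfl⟩
    rw [hB, hsm, hsm, ENNReal.mul_inv (Or.inl hk0) (Or.inl ENNReal.coe_ne_top), mul_mul_mul_comm,
      ENNReal.inv_mul_cancel hk0 ENNReal.coe_ne_top, one_mul]

end Sphere

/-! ### One-dimensional marginals of rotation-invariant measures -/

section Marginal

open scoped InnerProductSpace

variable {d : ℕ}

lemma lintegral_inner_eq_of_rotInv {τ : Measure (Sph d)} (hτ : RotInv τ) {f : ℝ → ENNReal}
    (hf : Measurable f) (u v : Sph d) :
    ∫⁻ θ, f ⟪(u : EuclideanSpace ℝ (Fin d)), θ⟫_ℝ ∂τ =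
      ∫⁻ θ, f ⟪(v : EuclideanSpace ℝ (Fin d)), θ⟫_ℝ ∂τ := by
  obtain ⟨R, hR⟩ := exists_rot u v
  have := (hτ R).lintegral_comp (f := fun θ => f ⟪(v : EuclideanSpace ℝ (Fin d)), θ⟫_ℝ)
    (by fun_prop)
  rw [← this, ← hR]
  simp only [coe_rot, R.inner_map_map]

lemma volume_ball_mul_lintegral_inner {τ : Measure (Sph d)} [IsProbabilityMeasure τ] (hτ : RotInv τ)
    {f : ℝ → ENNReal} (hf : Measurable f) (u : Sph d) (i : Fin d) :
    volume (Metric.ball (0 : EuclideanSpace ℝ (Fin d)) 1) *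
        ∫⁻ θ, f ⟪(u : EuclideanSpace ℝ (Fin d)), θ⟫_ℝ ∂τ =
      ∫⁻ y in Metric.ball (0 : EuclideanSpace ℝ (Fin d)) 1, f (y i / ‖y‖) := by
  set B := Metric.ball (0 : EuclideanSpace ℝ (Fin d)) 1 with hB
  have hnt : Nontrivial (EuclideanSpace ℝ (Fin d)) := by
    have : Nonempty (Fin d) := ⟨i⟩
    infer_instance
  have hne : ∀ᵐ y ∂(volume.restrict B), y ≠ (0 : EuclideanSpace ℝ (Fin d)) :=
    ae_restrict_of_ae (by simp [ae_iff])
  have h1 : volume B * ∫⁻ θ, f ⟪(u : EuclideanSpace ℝ (Fin d)), θ⟫_ℝ ∂τ =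
      ∫⁻ y in B, ∫⁻ θ : Sph d, f (⟪y, θ⟫_ℝ / ‖y‖) ∂τ := by
    rw [mul_comm, ← setLIntegral_const]
    refine lintegral_congr_ae ?_
    filter_upwards [hne] with y hy
    have hn : ‖‖y‖⁻¹ • y‖ = 1 := by
      rw [norm_smul, norm_inv, norm_norm, inv_mul_cancel₀ (norm_ne_zero_iff.2 hy)]
    rw [lintegral_inner_eq_of_rotInv hτ hf u ⟨‖y‖⁻¹ • y, mem_sphere_zero_iff_norm.2 hn⟩]
    refine lintegral_congr fun θ => ?_
    simp only
    rw [real_inner_smul_left, div_eq_inv_mul]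
  rw [h1, lintegral_lintegral_swap (by
    refine Measurable.aemeasurable ?_
    simp only [Function.uncurry_def]
    fun_prop)]
  have h2 : ∀ θ : Sph d, ∫⁻ y in B, f (⟪y, θ⟫_ℝ / ‖y‖) = ∫⁻ y in B, f (y i / ‖y‖) := by
    intro θ
    obtain ⟨R, hR⟩ := exists_rot θ ⟨EuclideanSpace.single i 1, by simp⟩
    have hmp := R.measurePreserving
    have hpre : R ⁻¹' B = B := by
      rw [hB]; ext y; simp
    have hmp' : MeasurePreserving R (volume.restrict B) (volume.restrict B) := by
      have := hmp.restrict_preimage (s := B) Metric.isOpen_ball.measurableSet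
      rwa [hpre] at this
    rw [← hmp'.lintegral_comp (f := fun y => f (y i / ‖y‖)) (by fun_prop)]
    refine lintegral_congr fun y => ?_
    have : R θ = EuclideanSpace.single i 1 := congrArg Subtype.val hR
    have h3 : (R y) i = ⟪y, (θ : EuclideanSpace ℝ (Fin d))⟫_ℝ := by
      rw [← R.inner_map_map, this, EuclideanSpace.inner_single_right]
      simp
    rw [h3, R.norm_map]
  simp only [h2, lintegral_const, measure_univ, mul_one]

/-- Scaling a Lebesgue integral. -/
lemma lintegral_comp_smul_addHaar {E : Type*} [NormedAddCommGroup E] [NormedSpace ℝ E]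
    [MeasurableSpace E] [BorelSpace E] [FiniteDimensional ℝ E] (μ : Measure E) [μ.IsAddHaarMeasure]
    (f : E → ENNReal) {r : ℝ} (hr : 0 < r) :
    ∫⁻ x, f (r • x) ∂μ = ENNReal.ofReal ((r ^ Module.finrank ℝ E)⁻¹) * ∫⁻ x, f x ∂μ := by
  have he : MeasurableEmbedding (fun x : E => r • x) :=
    (Homeomorph.smulOfNeZero r hr.ne').measurableEmbedding
  rw [← he.lintegral_map, Measure.map_addHaar_smul μ hr.ne', lintegral_smul_measure,
    abs_of_pos (by positivity), smul_eq_mul]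

lemma lintegral_ball_coord_div_norm {k : ℕ} (hk : 0 < k) {f : ℝ → ENNReal} (hf : Measurable f) :
    ∫⁻ y in Metric.ball (0 : EuclideanSpace ℝ (Fin (k + 1))) 1, f (y 0 / ‖y‖) =
      (∫⁻ z : Fin k → ℝ, {z : Fin k → ℝ | √(∑ i, z i ^ 2) < 1}.indicator
        (fun z => ENNReal.ofReal (√(∑ i, z i ^ 2))) z) *
      ∫⁻ a : ℝ, ENNReal.ofReal ((√(1 + a ^ 2) ^ (k + 1))⁻¹) * f (a / √(1 + a ^ 2)) := by
  set G : ℝ × (Fin k → ℝ) → ENNReal := fun q =>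
    {q : ℝ × (Fin k → ℝ) | √(q.1 ^ 2 + ∑ i, q.2 i ^ 2) < 1}.indicator
      (fun q => f (q.1 / √(q.1 ^ 2 + ∑ i, q.2 i ^ 2))) q with hG
  have hGm : Measurable G := by
    refine Measurable.indicator (by fun_prop) (measurableSet_lt (by fun_prop) measurable_const)
  set s : (Fin k → ℝ) → ℝ := fun z => √(∑ i, z i ^ 2) with hs
  have hsm : Measurable s := by fun_prop
  have e1 : ∫⁻ y in Metric.ball (0 : EuclideanSpace ℝ (Fin (k + 1))) 1, f (y 0 / ‖y‖) =
      ∫⁻ q, G q := by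
    rw [← lintegral_indicator Metric.isOpen_ball.measurableSet,
      ← (volume_preserving_piFinSuccAbove (fun _ : Fin (k + 1) => ℝ) 0).lintegral_comp hGm,
      ← (PiLp.volume_preserving_ofLp (Fin (k + 1))).lintegral_comp
        (f := fun y => G (MeasurableEquiv.piFinSuccAbove (fun _ : Fin (k + 1) => ℝ) 0 y))
        (hGm.comp (MeasurableEquiv.measurable _))]
    refine lintegral_congr fun y => ?_
    have hn : ‖y‖ = √(y 0 ^ 2 + ∑ i : Fin k, y i.succ ^ 2) := by
      rw [EuclideanSpace.norm_eq, Fin.sum_univ_succ]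
      simp
    simp only [hG, Set.indicator, mem_ball_zero_iff, hn, Set.mem_ofPred_eq]
    rfl
  have e2 : ∀ᵐ z : Fin k → ℝ, 0 < s z := by
    have : Nonempty (Fin k) := ⟨⟨0, hk⟩⟩
    have : ∀ᵐ z : Fin k → ℝ, z ≠ 0 := by simp [ae_iff]
    filter_upwards [this] with z hz
    obtain ⟨i, hi⟩ := Function.ne_iff.1 hz
    exact Real.sqrt_pos.2 (Finset.sum_pos' (fun i _ => sq_nonneg _) ⟨i, Finset.mem_univ _, by
      have : z i ≠ 0 := hi
      positivity⟩)
  set g : (Fin k → ℝ) → ENNReal := fun z => {z : Fin k → ℝ | s z < 1}.indicator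
        (fun z => ENNReal.ofReal (s z)) z with hg
  have hgm : Measurable g := by
    refine Measurable.indicator (by fun_prop) (measurableSet_lt (by fun_prop) measurable_const)
  have hsa : ∀ (a : ℝ) (z : Fin k → ℝ), s (√(1 + a ^ 2) • z) = √(1 + a ^ 2) * s z := fun a z => by
    simp only [hs, Pi.smul_apply, smul_eq_mul, mul_pow, ← Finset.mul_sum]
    rw [Real.sqrt_mul (by positivity), Real.sqrt_sq (Real.sqrt_nonneg _)]
  have e3 : ∀ᵐ z : Fin k → ℝ, ∫⁻ a, G (a, z) = ∫⁻ a : ℝ,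
      ENNReal.ofReal ((√(1 + a ^ 2))⁻¹) * (g (√(1 + a ^ 2) • z) * f (a / √(1 + a ^ 2))) := by
    filter_upwards [e2] with z hz
    have hsc := lintegral_comp_smul_addHaar (volume : Measure ℝ) (fun a => G (a, z)) hz
    rw [Module.finrank_self, pow_one] at hsc
    have : ∫⁻ a, G (a, z) = ENNReal.ofReal (s z) * ∫⁻ a, G (s z • a, z) := by
      rw [hsc, ← mul_assoc, ← ENNReal.ofReal_mul hz.le, mul_inv_cancel₀ hz.ne', ENNReal.ofReal_one,
        one_mul]
    rw [this, ← lintegral_const_mul _ (by fun_prop)]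
    refine lintegral_congr fun a => ?_
    have hA : (0 : ℝ) < √(1 + a ^ 2) := Real.sqrt_pos.2 (by positivity)
    have hr : √((s z • a) ^ 2 + ∑ i, z i ^ 2) = √(1 + a ^ 2) * s z := by
      have : ∑ i, z i ^ 2 = s z ^ 2 := by
        rw [hs]; simp only; rw [Real.sq_sqrt (Finset.sum_nonneg fun i _ => sq_nonneg _)]
      rw [this, smul_eq_mul, show (s z * a) ^ 2 + s z ^ 2 = (1 + a ^ 2) * s z ^ 2 by ring,
        Real.sqrt_mul (by positivity), Real.sqrt_sq hz.le]
    simp only [hG, hg, Set.indicator, Set.mem_ofPred_eq, hr, hsa]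
    split_ifs
    · rw [← mul_assoc, ← ENNReal.ofReal_mul (by positivity), inv_mul_cancel_left₀ hA.ne']
      congr 2
      rw [smul_eq_mul]
      field_simp
    · simp
  rw [e1, Measure.volume_eq_prod, lintegral_prod_symm _ hGm.aemeasurable, lintegral_congr_ae e3,
    lintegral_lintegral_swap (by
      refine Measurable.aemeasurable ?_
      simp only [Function.uncurry_def]
      fun_prop), ← lintegral_const_mul _ (by fun_prop)]
  refine lintegral_congr fun a => ?_
  have hA : (0 : ℝ) < √(1 + a ^ 2) := Real.sqrt_pos.2 (by positivity)
  rw [lintegral_const_mul _ (by fun_prop), lintegral_mul_const _ (by fun_prop),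
    lintegral_comp_smul_addHaar volume g hA, Module.finrank_fin_fun, ← mul_assoc, ← mul_assoc,
    ← ENNReal.ofReal_mul (by positivity), ← mul_inv, ← pow_succ', mul_comm (∫⁻ z, g z),
    mul_right_comm]

end Marginal

section MarginalDensity

open scoped InnerProductSpace

/-- Unnormalized density of `√d` times a coordinate of a uniform point on the sphere. -/
def margDens (d : ℕ) (t : ℝ) : ℝ := √(1 - t ^ 2 / d) ^ (d - 3)

lemma margDens_nonneg (d : ℕ) (t : ℝ) : 0 ≤ margDens d t := pow_nonneg (Real.sqrt_nonneg _) _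

lemma continuous_margDens (d : ℕ) : Continuous (margDens d) := by
  unfold margDens; fun_prop

/-- Law of `√d` times a coordinate of a uniform point on the sphere. -/
def margLaw (d : ℕ) : Measure ℝ :=
  (∫⁻ t, ENNReal.ofReal (margDens d t))⁻¹ •
    volume.withDensity fun t => ENNReal.ofReal (margDens d t)

lemma lintegral_subst_div_sqrt {d : ℕ} (hd : 4 ≤ d) (f : ℝ → ENNReal) :
    ∫⁻ a : ℝ, ENNReal.ofReal ((√(1 + a ^ 2) ^ d)⁻¹) * f (√d * (a / √(1 + a ^ 2))) =
      ENNReal.ofReal (√d)⁻¹ * ∫⁻ t, ENNReal.ofReal (margDens d t) * f t := by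
  have hd0 : (0 : ℝ) < d := by exact_mod_cast (by omega : 0 < d)
  set r := √(d : ℝ) with hr
  have hr0 : 0 < r := Real.sqrt_pos.2 hd0
  have hrd : r ^ 2 = d := Real.sq_sqrt hd0.le
  set S := Set.Ioo (-r) r with hS
  set g : ℝ → ℝ := fun t => t / √(d - t ^ 2) with hg
  have hpos : ∀ t ∈ S, 0 < (d : ℝ) - t ^ 2 := fun t ht => by
    rw [← hrd, sub_pos, sq_lt_sq, abs_of_pos hr0]
    exact abs_lt.2 ht
  have hone : ∀ t ∈ S, 1 + g t ^ 2 = d / (d - t ^ 2) := fun t ht => by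
    have := hpos t ht
    rw [hg]
    simp only
    rw [div_pow, Real.sq_sqrt this.le]
    field_simp
    ring
  have hsq : ∀ t ∈ S, √(1 + g t ^ 2) = r / √(d - t ^ 2) := fun t ht => by
    rw [hone t ht, Real.sqrt_div hd0.le]
  have hinv : ∀ t ∈ S, r * (g t / √(1 + g t ^ 2)) = t := fun t ht => by
    have := Real.sqrt_pos.2 (hpos t ht)
    rw [hsq t ht, hg]
    field_simp
  have himg : g '' S = Set.univ := by
    refine Set.eq_univ_of_forall fun a => ?_
    have h1 : 0 < √(1 + a ^ 2) := Real.sqrt_pos.2 (by positivity)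
    have h2 : √(1 + a ^ 2) ^ 2 = 1 + a ^ 2 := Real.sq_sqrt (by positivity)
    refine ⟨r * (a / √(1 + a ^ 2)), ?_, ?_⟩
    · rw [hS, Set.mem_Ioo, ← abs_lt, abs_mul, abs_of_pos hr0, mul_lt_iff_lt_one_right hr0, abs_div,
        abs_of_pos h1, div_lt_one h1]
      refine Real.lt_sqrt_of_sq_lt ?_
      rw [sq_abs]
      linarith
    · have : (d : ℝ) - (r * (a / √(1 + a ^ 2))) ^ 2 = (r / √(1 + a ^ 2)) ^ 2 := by
        rw [mul_pow, div_pow, div_pow, h2, hrd]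
        field_simp
        ring
      rw [hg]
      simp only
      rw [this, Real.sqrt_sq (by positivity)]
      field_simp
  have hinj : Set.InjOn g S := fun t ht t' ht' h => by
    rw [← hinv t ht, ← hinv t' ht', h]
  have hderiv : ∀ t ∈ S, HasDerivWithinAt g (d / √(d - t ^ 2) ^ 3) S t := fun t ht => by
    have h0 := hpos t ht
    have h1 := Real.sqrt_pos.2 h0
    have h2 : √(d - t ^ 2) ^ 2 = d - t ^ 2 := Real.sq_sqrt h0.le
    have hD : HasDerivAt (fun t : ℝ => (d : ℝ) - t ^ 2) (-(2 * t)) t := by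
      simpa using (hasDerivAt_pow 2 t).const_sub (d : ℝ)
    have := ((hasDerivAt_id t).div (hD.sqrt h0.ne') h1.ne').hasDerivWithinAt (s := S)
    refine this.congr_deriv ?_
    simp only [id]
    rw [div_eq_div_iff (by positivity) (by positivity)]
    field_simp
    rw [h2]
    ring
  rw [← setLIntegral_univ, ← himg, lintegral_image_eq_lintegral_abs_deriv_mul measurableSet_Ioo
    hderiv hinj, ← lintegral_const_mul' _ _ ENNReal.ofReal_ne_top,
    ← lintegral_indicator measurableSet_Ioo]
  refine lintegral_congr fun t => ?_
  by_cases ht : t ∈ S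
  · rw [Set.indicator_of_mem ht, hinv t ht, ← mul_assoc, ← mul_assoc,
      ← ENNReal.ofReal_mul (by positivity), ← ENNReal.ofReal_mul (by positivity)]
    congr 2
    have h0 := hpos t ht
    have h1 := Real.sqrt_pos.2 h0
    have hw : √(1 - t ^ 2 / d) = √(d - t ^ 2) / r := by
      rw [hr, ← Real.sqrt_div h0.le]
      congr 1
      field_simp
    obtain ⟨k, rfl⟩ : ∃ k, d = k + 3 := ⟨d - 3, by omega⟩
    rw [hsq t ht, abs_of_pos (by positivity), margDens, hw, Nat.add_sub_cancel, div_pow, div_pow]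
    generalize √(((k + 3 : ℕ) : ℝ) - t ^ 2) = w at h1
    rw [← hrd]
    field_simp
    ring
  · rw [Set.indicator_of_notMem ht]
    have : margDens d t = 0 := by
      rw [margDens, Real.sqrt_eq_zero_of_nonpos, zero_pow (by omega)]
      rw [hS, Set.mem_Ioo, ← abs_lt, not_lt] at ht
      rw [sub_nonpos, one_le_div hd0, ← hrd, ← sq_abs t]
      gcongr
    simp [this]

lemma margDens_le_exp {d : ℕ} (hd : 4 ≤ d) (t : ℝ) :
    margDens d t ≤ Real.exp (-(1 / 8) * t ^ 2) := by
  have hd4 : (4 : ℝ) ≤ d := by exact_mod_cast hd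
  have h1 : √(1 - t ^ 2 / d) ≤ Real.exp (-(t ^ 2 / (2 * d))) := by
    refine Real.sqrt_le_iff.2 ⟨(Real.exp_pos _).le, ?_⟩
    rw [← Real.exp_nat_mul]
    refine (Real.one_sub_le_exp_neg _).trans_eq ?_
    congr 1
    push_cast
    field_simp
  refine (pow_le_pow_left₀ (Real.sqrt_nonneg _) h1 _).trans ?_
  rw [← Real.exp_nat_mul, Real.exp_le_exp, Nat.cast_sub (by omega)]
  push_cast
  have : (d - 3 : ℝ) * -(t ^ 2 / (2 * d)) = -(t ^ 2 * ((d - 3) / (2 * d))) := by ring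
  rw [this]
  have : (1 / 8 : ℝ) ≤ (d - 3) / (2 * d) := by
    rw [div_le_div_iff₀ (by norm_num) (by positivity)]
    linarith
  nlinarith [sq_nonneg t]

lemma tendsto_margDens (t : ℝ) :
    Tendsto (fun d => margDens d t) atTop (nhds (Real.exp (-(1 / 2) * t ^ 2))) := by
  have h0 : Tendsto (fun d : ℕ => 1 - t ^ 2 / d) atTop (nhds 1) := by
    simpa using (tendsto_const_div_atTop_nhds_zero_nat (t ^ 2)).const_sub 1
  have h1 : Tendsto (fun d : ℕ => √((1 - t ^ 2 / d) ^ d) / √(1 - t ^ 2 / d) ^ 3) atTop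
      (nhds (√(Real.exp (-t ^ 2)) / √1 ^ 3)) := by
    refine Tendsto.div ?_ ((h0.sqrt).pow 3) (by simp)
    refine Tendsto.sqrt ?_
    have := Real.tendsto_one_add_div_pow_exp (-t ^ 2)
    refine this.congr fun d => ?_
    congr 1
    ring
  have h2 : √(Real.exp (-t ^ 2)) / √1 ^ 3 = Real.exp (-(1 / 2) * t ^ 2) := by
    rw [Real.sqrt_one, one_pow, div_one, ← Real.exp_half]
    congr 1
    ring
  rw [h2] at h1
  refine h1.congr' ?_
  filter_upwards [h0.eventually (lt_mem_nhds one_pos), eventually_ge_atTop 3] with d hd hd3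
  have hs := Real.sqrt_pos.2 hd
  rw [margDens, div_eq_iff (by positivity), ← pow_add, Nat.sub_add_cancel hd3]
  refine (Real.sqrt_eq_iff_mul_self_eq (by positivity) (by positivity)).2 ?_
  rw [← sq, ← pow_mul, mul_comm, pow_mul, Real.sq_sqrt hd.le]

lemma integrable_margDens {d : ℕ} (hd : 4 ≤ d) : Integrable (margDens d) :=
  (integrable_exp_neg_mul_sq (by norm_num : (0 : ℝ) < 1 / 8)).mono'
    (continuous_margDens d).aestronglyMeasurable
    (ae_of_all _ fun t => by
      rw [Real.norm_of_nonneg (margDens_nonneg d t)]; exact margDens_le_exp hd t)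

lemma integral_margDens_pos {d : ℕ} (hd : 4 ≤ d) : 0 < ∫ t, margDens d t := by
  rw [integral_pos_iff_support_of_nonneg (margDens_nonneg d) (integrable_margDens hd)]
  exact (continuous_margDens d).isOpen_support.measure_pos volume ⟨0, by simp [margDens]⟩

lemma lintegral_margDens {d : ℕ} (hd : 4 ≤ d) :
    ∫⁻ t, ENNReal.ofReal (margDens d t) = ENNReal.ofReal (∫ t, margDens d t) :=
  (ofReal_integral_eq_lintegral_ofReal (integrable_margDens hd)
    (ae_of_all _ (margDens_nonneg d))).symm

lemma lintegral_margLaw (d : ℕ) {f : ℝ → ENNReal} (hf : Measurable f) :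
    ∫⁻ t, f t ∂(margLaw d) = (∫⁻ t, ENNReal.ofReal (margDens d t))⁻¹ *
      ∫⁻ t, ENNReal.ofReal (margDens d t) * f t := by
  rw [margLaw, lintegral_smul_measure, smul_eq_mul, lintegral_withDensity_eq_lintegral_mul _
    (continuous_margDens d).measurable.ennreal_ofReal hf]
  rfl

lemma map_inner_eq_margLaw {d : ℕ} (hd : 4 ≤ d) {τ : Measure (Sph d)} [IsProbabilityMeasure τ]
    (hτ : RotInv τ) (u : Sph d) :
    τ.map (fun θ : Sph d => √d * ⟪(u : EuclideanSpace ℝ (Fin d)), θ⟫_ℝ) = margLaw d := by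
  obtain ⟨k, rfl⟩ : ∃ k, d = k + 1 := ⟨d - 1, by omega⟩
  have hmeas : Measurable fun θ : Sph (k + 1) =>
    √((k + 1 : ℕ) : ℝ) * ⟪(u : EuclideanSpace ℝ (Fin (k + 1))), θ⟫_ℝ := by fun_prop
  obtain ⟨c, hc⟩ : ∃ c : ENNReal, ∀ f : ℝ → ENNReal, Measurable f →
      volume (Metric.ball (0 : EuclideanSpace ℝ (Fin (k + 1))) 1) *
        ∫⁻ t, f t ∂(τ.map fun θ : Sph (k + 1) =>
          √((k + 1 : ℕ) : ℝ) * ⟪(u : EuclideanSpace ℝ (Fin (k + 1))), θ⟫_ℝ)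
        = c * ∫⁻ t, ENNReal.ofReal (margDens (k + 1) t) * f t := by
    refine ⟨(∫⁻ z : Fin k → ℝ, {z : Fin k → ℝ | √(∑ i, z i ^ 2) < 1}.indicator
      (fun z => ENNReal.ofReal (√(∑ i, z i ^ 2))) z) * ENNReal.ofReal (√((k + 1 : ℕ) : ℝ))⁻¹,
      fun f hf => ?_⟩
    rw [lintegral_map hf hmeas, volume_ball_mul_lintegral_inner hτ
      (f := fun t => f (√((k + 1 : ℕ) : ℝ) * t)) (by fun_prop) u 0,
      lintegral_ball_coord_div_norm (by omega) (f := fun t => f (√((k + 1 : ℕ) : ℝ) * t))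
        (by fun_prop), lintegral_subst_div_sqrt hd, ← mul_assoc]
  set V := volume (Metric.ball (0 : EuclideanSpace ℝ (Fin (k + 1))) 1) with hV
  have hV0 : V ≠ 0 := (Metric.isOpen_ball.measure_pos volume ⟨0, by simp⟩).ne'
  have hVt : V ≠ ⊤ := measure_ball_lt_top.ne
  have hprob : IsProbabilityMeasure (τ.map fun θ : Sph (k + 1) => √((k + 1 : ℕ) : ℝ) *
    ⟪(u : EuclideanSpace ℝ (Fin (k + 1))), θ⟫_ℝ) :=
    Measure.isProbabilityMeasure_map hmeas.aemeasurable
  have h1 := hc 1 measurable_one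
  simp only [Pi.one_apply, lintegral_one, measure_univ, mul_one] at h1
  have hI0 : ∫⁻ t, ENNReal.ofReal (margDens (k + 1) t) ≠ 0 := by
    rw [lintegral_margDens hd]
    exact (ENNReal.ofReal_pos.2 (integral_margDens_pos hd)).ne'
  have hIt : ∫⁻ t, ENNReal.ofReal (margDens (k + 1) t) ≠ ⊤ := by
    rw [lintegral_margDens hd]
    exact ENNReal.ofReal_ne_top
  ext s hs
  rw [← lintegral_indicator_one hs, ← lintegral_indicator_one hs,
    lintegral_margLaw _ (measurable_one.indicator hs)]
  have h2 := hc (s.indicator 1) (measurable_one.indicator hs)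
  rw [h1] at h2
  have hc0 : c ≠ 0 := by rintro rfl; simp [hV0] at h1
  have hct : c ≠ ⊤ := by
    rintro rfl
    rw [ENNReal.top_mul hI0] at h1
    exact hVt h1
  rw [mul_assoc, ENNReal.mul_right_inj hc0 hct] at h2
  rw [← h2, ← mul_assoc, ENNReal.inv_mul_cancel hI0 hIt, one_mul]

end MarginalDensity

section PolyGrowth

/-- Measurable functions of at most polynomial growth. -/
def PolyGrowth (f : ℝ → ℝ) : Prop :=
  Measurable f ∧ ∃ (C : ℝ) (k : ℕ), ∀ t, |f t| ≤ C * (1 + |t|) ^ k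

namespace PolyGrowth

variable {f g : ℝ → ℝ}

lemma const (c : ℝ) : PolyGrowth fun _ => c :=
  ⟨measurable_const, |c|, 0, fun t => by simp⟩

lemma id : PolyGrowth fun t => t :=
  ⟨measurable_id, 1, 1, fun t => by simp⟩

lemma mul (hf : PolyGrowth f) (hg : PolyGrowth g) : PolyGrowth fun t => f t * g t := by
  obtain ⟨hf, C, k, hC⟩ := hf
  obtain ⟨hg, C', k', hC'⟩ := hg
  refine ⟨hf.mul hg, C * C', k + k', fun t => ?_⟩
  rw [abs_mul, pow_add, mul_mul_mul_comm]
  exact mul_le_mul (hC t) (hC' t) (abs_nonneg _) ((abs_nonneg _).trans (hC t))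

lemma add (hf : PolyGrowth f) (hg : PolyGrowth g) : PolyGrowth fun t => f t + g t := by
  obtain ⟨hf, C, k, hC⟩ := hf
  obtain ⟨hg, C', k', hC'⟩ := hg
  have hC0 : 0 ≤ C := by simpa using (abs_nonneg _).trans (hC 0)
  have hC0' : 0 ≤ C' := by simpa using (abs_nonneg _).trans (hC' 0)
  refine ⟨hf.add hg, C + C', k + k', fun t => (abs_add_le _ _).trans ?_⟩
  have h1 : 1 ≤ 1 + |t| := by linarith [abs_nonneg t]
  rw [add_mul]
  refine add_le_add ((hC t).trans ?_) ((hC' t).trans ?_)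
  · exact mul_le_mul_of_nonneg_left (pow_le_pow_right₀ h1 (by omega)) hC0
  · exact mul_le_mul_of_nonneg_left (pow_le_pow_right₀ h1 (by omega)) hC0'

lemma pow (hf : PolyGrowth f) (k : ℕ) : PolyGrowth fun t => f t ^ k := by
  induction k with
  | zero => simpa using const 1
  | succ k ih => simpa only [pow_succ] using ih.mul hf

lemma sum {κ : Type*} (s : Finset κ) {f : κ → ℝ → ℝ} (hf : ∀ k ∈ s, PolyGrowth (f k)) :
    PolyGrowth fun t => ∑ k ∈ s, f k t := by
  classical
  induction s using Finset.induction_on with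
  | empty => simpa using const 0
  | insert k s hk ih =>
    simp only [Finset.sum_insert hk]
    exact (hf k (Finset.mem_insert_self _ _)).add
      (ih fun j hj => hf j (Finset.mem_insert_of_mem hj))

lemma eval (p : Polynomial ℝ) : PolyGrowth fun t => p.eval t := by
  simp only [Polynomial.eval_eq_sum_range]
  exact sum _ fun k _ => (const _).mul (id.pow k)

/-- A dominating function for densities with Gaussian tails. -/
lemma exists_integrable_bound (hf : PolyGrowth f) : ∃ b : ℝ → ℝ, Integrable b ∧
    ∀ t, Real.exp (-(1 / 8) * t ^ 2) * |f t| ≤ b t := by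
  obtain ⟨hf, C, k, hC⟩ := hf
  have hC0 : 0 ≤ C := by simpa using (abs_nonneg _).trans (hC 0)
  refine ⟨fun t => (C * k.factorial * Real.exp 5) * Real.exp (-(1 / 16) * t ^ 2),
    (integrable_exp_neg_mul_sq (by norm_num)).const_mul _, fun t => ?_⟩
  have h0 : 0 ≤ 1 + |t| := by positivity
  have h1 : (1 + |t|) ^ k ≤ k.factorial * Real.exp (1 + |t|) := by
    have := Real.pow_div_factorial_le_exp (1 + |t|) h0 k
    rwa [div_le_iff₀ (by positivity), mul_comm] at this
  have h2 : Real.exp (-(1 / 8) * t ^ 2) * Real.exp (1 + |t|) ≤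
      Real.exp 5 * Real.exp (-(1 / 16) * t ^ 2) := by
    rw [← Real.exp_add, ← Real.exp_add, Real.exp_le_exp, ← sq_abs t]
    nlinarith [sq_nonneg (|t| / 4 - 2)]
  calc Real.exp (-(1 / 8) * t ^ 2) * |f t|
      ≤ Real.exp (-(1 / 8) * t ^ 2) * (C * (k.factorial * Real.exp (1 + |t|))) :=
        mul_le_mul_of_nonneg_left ((hC t).trans (mul_le_mul_of_nonneg_left h1 hC0))
          (Real.exp_pos _).le
    _ = C * k.factorial * (Real.exp (-(1 / 8) * t ^ 2) * Real.exp (1 + |t|)) := by ring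
    _ ≤ C * k.factorial * (Real.exp 5 * Real.exp (-(1 / 16) * t ^ 2)) :=
        mul_le_mul_of_nonneg_left h2 (by positivity)
    _ = _ := by ring

lemma integrable_margDens_mul (hf : PolyGrowth f) {d : ℕ} (hd : 4 ≤ d) :
    Integrable fun t => margDens d t * f t := by
  obtain ⟨b, hb, hle⟩ := hf.exists_integrable_bound
  refine hb.mono' ((continuous_margDens d).aestronglyMeasurable.mul hf.1.aestronglyMeasurable)
    (ae_of_all _ fun t => ?_)
  rw [norm_mul, Real.norm_eq_abs, Real.norm_eq_abs, abs_of_nonneg (margDens_nonneg d t)]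
  exact (mul_le_mul_of_nonneg_right (margDens_le_exp hd t) (abs_nonneg _)).trans (hle t)

lemma tendsto_integral_margDens_mul (hf : PolyGrowth f) :
    Tendsto (fun d => ∫ t, margDens d t * f t) atTop
      (nhds (∫ t, Real.exp (-(1 / 2) * t ^ 2) * f t)) := by
  obtain ⟨b, hb, hle⟩ := hf.exists_integrable_bound
  refine tendsto_integral_filter_of_dominated_convergence b (Eventually.of_forall fun d =>
    (continuous_margDens d).aestronglyMeasurable.mul hf.1.aestronglyMeasurable) ?_ hb
    (ae_of_all _ fun t => (tendsto_margDens t).mul_const _)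
  filter_upwards [eventually_ge_atTop 4] with d hd
  refine ae_of_all _ fun t => ?_
  rw [norm_mul, Real.norm_eq_abs, Real.norm_eq_abs, abs_of_nonneg (margDens_nonneg d t)]
  exact (mul_le_mul_of_nonneg_right (margDens_le_exp hd t) (abs_nonneg _)).trans (hle t)

end PolyGrowth

lemma integral_margLaw {d : ℕ} (hd : 4 ≤ d) (f : ℝ → ℝ) :
    ∫ t, f t ∂(margLaw d) = (∫ t, margDens d t)⁻¹ * ∫ t, margDens d t * f t := by
  rw [margLaw, integral_smul_measure, integral_withDensity_eq_integral_toReal_smul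
    (continuous_margDens d).measurable.ennreal_ofReal (ae_of_all _ fun _ => ENNReal.ofReal_lt_top),
    lintegral_margDens hd, ENNReal.toReal_inv,
    ENNReal.toReal_ofReal (integral_margDens_pos hd).le, smul_eq_mul]
  congr 1
  refine integral_congr_ae (ae_of_all _ fun t => ?_)
  simp only [ENNReal.toReal_ofReal (margDens_nonneg d t), smul_eq_mul]

lemma margLaw_absolutelyContinuous (d : ℕ) : margLaw d ≪ volume :=
  (withDensity_absolutelyContinuous _ _).smul_left _

lemma PolyGrowth.integrable_margLaw {f : ℝ → ℝ} (hf : PolyGrowth f) {d : ℕ} (hd : 4 ≤ d) :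
    Integrable f (margLaw d) := by
  rw [margLaw]
  refine Integrable.smul_measure ?_ ?_
  · rw [integrable_withDensity_iff_integrable_smul'
      (continuous_margDens d).measurable.ennreal_ofReal
      (ae_of_all _ fun _ => ENNReal.ofReal_lt_top)]
    refine (hf.integrable_margDens_mul hd).congr (ae_of_all _ fun t => ?_)
    simp only [ENNReal.toReal_ofReal (margDens_nonneg d t), smul_eq_mul]
  · rw [lintegral_margDens hd]
    exact ENNReal.inv_ne_top.2 (ENNReal.ofReal_pos.2 (integral_margDens_pos hd)).ne'

lemma integral_stdGaussian (f : ℝ → ℝ) :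
    ∫ t, f t ∂stdGaussian = (√(2 * Real.pi))⁻¹ * ∫ t, Real.exp (-(1 / 2) * t ^ 2) * f t := by
  rw [stdGaussian, ProbabilityTheory.integral_gaussianReal_eq_integral_smul one_ne_zero,
    ← integral_const_mul]
  refine integral_congr_ae (ae_of_all _ fun t => ?_)
  simp only [ProbabilityTheory.gaussianPDFReal, NNReal.coe_one, mul_one, sub_zero, smul_eq_mul,
    mul_assoc]
  congr 3
  ring

instance : IsProbabilityMeasure stdGaussian := by unfold stdGaussian; infer_instance

lemma tendsto_integral_margLaw {f : ℝ → ℝ} (hf : PolyGrowth f) :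
    Tendsto (fun d => ∫ t, f t ∂(margLaw d)) atTop (nhds (∫ t, f t ∂stdGaussian)) := by
  have h1 := (PolyGrowth.const 1).tendsto_integral_margDens_mul
  simp only [mul_one] at h1
  have hv : ∫ t : ℝ, Real.exp (-(1 / 2) * t ^ 2) = √(2 * Real.pi) := by
    rw [integral_gaussian]; congr 1; ring
  rw [hv] at h1
  rw [integral_stdGaussian]
  refine ((h1.inv₀ (by positivity)).mul hf.tendsto_integral_margDens_mul).congr' ?_
  filter_upwards [eventually_ge_atTop 4] with d hd
  rw [integral_margLaw hd]

lemma PolyGrowth.integrable_stdGaussian {f : ℝ → ℝ} (hf : PolyGrowth f) :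
    Integrable f stdGaussian := by
  obtain ⟨b, hb, hle⟩ := hf.exists_integrable_bound
  rw [stdGaussian, ProbabilityTheory.gaussianReal_of_var_ne_zero _ one_ne_zero,
    integrable_withDensity_iff_integrable_smul' (ProbabilityTheory.measurable_gaussianPDF _ _)
      (ae_of_all _ fun _ => ENNReal.ofReal_lt_top)]
  refine (hb.const_mul (√(2 * Real.pi))⁻¹).mono' ?_ (ae_of_all _ fun t => ?_)
  · exact
      ((ProbabilityTheory.measurable_gaussianPDF _ _).ennreal_toReal.smul hf.1).aestronglyMeasurable
  · rw [ProbabilityTheory.toReal_gaussianPDF, smul_eq_mul, norm_mul, Real.norm_eq_abs,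
      Real.norm_eq_abs, abs_of_nonneg (ProbabilityTheory.gaussianPDFReal_nonneg _ _ _),
      ProbabilityTheory.gaussianPDFReal, NNReal.coe_one, mul_one, mul_assoc]
    refine mul_le_mul_of_nonneg_left (le_trans ?_ (hle t)) (by positivity)
    refine mul_le_mul_of_nonneg_right (Real.exp_le_exp.2 ?_) (abs_nonneg _)
    nlinarith [sq_nonneg t]

end PolyGrowth

section SpherePolynomials

open scoped InnerProductSpace Pointwise
open Module

variable {d : ℕ}

/-- The linear functional `⟨a, ·⟩` as a function on the sphere. -/
def linFun (a : EuclideanSpace ℝ (Fin d)) : C(Sph d, ℝ) :=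
  ⟨fun u => ⟪a, (u : EuclideanSpace ℝ (Fin d))⟫_ℝ, by fun_prop⟩

lemma linFun_apply (a : EuclideanSpace ℝ (Fin d)) (u : Sph d) :
    linFun a u = ⟪a, (u : EuclideanSpace ℝ (Fin d))⟫_ℝ := rfl

/-- Spanning set of the affine functions on the sphere. -/
def affGen (d : ℕ) : Finset C(Sph d, ℝ) := by
  classical exact insert 1 (Finset.univ.image fun i => linFun (EuclideanSpace.single i (1 : ℝ)))

lemma card_affGen_le (d : ℕ) : (affGen d).card ≤ d + 1 := by
  classical
  unfold affGen
  refine (Finset.card_insert_le _ _).trans (Nat.succ_le_succ ?_)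
  simpa using Finset.card_image_le (s := Finset.univ)
    (f := fun i => linFun (d := d) (EuclideanSpace.single i (1 : ℝ)))

/-- The affine functions on the sphere. -/
def affSpace (d : ℕ) : Submodule ℝ C(Sph d, ℝ) := Submodule.span ℝ (affGen d)

lemma one_mem_affSpace : (1 : C(Sph d, ℝ)) ∈ affSpace d :=
  Submodule.subset_span (by simp [affGen])

lemma linFun_mem_affSpace (a : EuclideanSpace ℝ (Fin d)) : linFun a ∈ affSpace d := by
  have h : linFun a = ∑ i, a i • linFun (EuclideanSpace.single i (1 : ℝ)) := by
    ext u
    simp [linFun_apply, ContinuousMap.sum_apply, PiLp.inner_apply, mul_comm]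
  rw [h]
  exact Submodule.sum_mem _ fun i _ => Submodule.smul_mem _ _
    (Submodule.subset_span (by simp [affGen]))

/-- Polynomial functions of degree less than `k` on the sphere. -/
def polyLT (d : ℕ) : ℕ → Submodule ℝ C(Sph d, ℝ)
  | 0 => ⊥
  | k + 1 => affSpace d ^ k

lemma polyLT_le_succ (k : ℕ) : polyLT d k ≤ polyLT d (k + 1) := by
  cases k with
  | zero => exact bot_le
  | succ k =>
    intro f hf
    change f ∈ affSpace d ^ (k + 1)
    rw [pow_succ', ← one_mul f]
    exact Submodule.mul_mem_mul one_mem_affSpace hf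

lemma polyLT_mono : Monotone (polyLT d) := monotone_nat_of_le_succ polyLT_le_succ

instance finiteDimensional_polyLT (k : ℕ) : FiniteDimensional ℝ (polyLT d k) := by
  cases k with
  | zero => exact inferInstanceAs (FiniteDimensional ℝ (⊥ : Submodule ℝ C(Sph d, ℝ)))
  | succ k =>
    exact Module.Finite.of_fg (Submodule.FG.pow (Submodule.fg_span (Finset.finite_toSet _)) k)

lemma finrank_polyLT_le (k : ℕ) : finrank ℝ (polyLT d (k + 1)) ≤ (d + 1) ^ k := by
  classical
  have h : polyLT d (k + 1) = Submodule.span ℝ ((affGen d ^ k : Finset C(Sph d, ℝ)) : Set _) := by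
    rw [Finset.coe_pow, ← Submodule.span_pow]; rfl
  rw [h]
  refine (finrank_span_finset_le_card _).trans (Finset.card_pow_le.trans ?_)
  exact Nat.pow_le_pow_left (card_affGen_le d) k

/-- Composition with a rotation. -/
def rotComp (R : EuclideanSpace ℝ (Fin d) ≃ₗᵢ[ℝ] EuclideanSpace ℝ (Fin d)) :
    C(Sph d, ℝ) →ₐ[ℝ] C(Sph d, ℝ) :=
  ContinuousMap.compRightAlgHom ℝ ℝ ⟨rot R, continuous_rot R⟩

lemma rotComp_apply (R : EuclideanSpace ℝ (Fin d) ≃ₗᵢ[ℝ] EuclideanSpace ℝ (Fin d))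
    (f : C(Sph d, ℝ)) (u : Sph d) : rotComp R f u = f (rot R u) := rfl

lemma rotComp_linFun (R : EuclideanSpace ℝ (Fin d) ≃ₗᵢ[ℝ] EuclideanSpace ℝ (Fin d))
    (a : EuclideanSpace ℝ (Fin d)) : rotComp R (linFun a) = linFun (R.symm a) := by
  ext u
  rw [rotComp_apply, linFun_apply, linFun_apply, coe_rot, ← R.inner_map_map (R.symm a),
    R.apply_symm_apply]

lemma rotComp_mem_polyLT (R : EuclideanSpace ℝ (Fin d) ≃ₗᵢ[ℝ] EuclideanSpace ℝ (Fin d)) {k : ℕ}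
    {f : C(Sph d, ℝ)} (hf : f ∈ polyLT d k) : rotComp R f ∈ polyLT d k := by
  cases k with
  | zero =>
    rw [(Submodule.mem_bot ℝ).1 hf, map_zero]; exact Submodule.zero_mem _
  | succ k =>
    have h1 : (affSpace d).map (rotComp R).toLinearMap ≤ affSpace d := by
      rw [affSpace, Submodule.map_span, Submodule.span_le]
      rintro _ ⟨g, hg, rfl⟩
      simp only [affGen, Finset.coe_insert, Finset.coe_image, Finset.coe_univ, Set.image_univ,
        Set.mem_insert_iff, Set.mem_range] at hg
      obtain rfl | ⟨i, rfl⟩ := hg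
      · rw [AlgHom.toLinearMap_apply, map_one]; exact one_mem_affSpace
      · rw [AlgHom.toLinearMap_apply, rotComp_linFun]; exact linFun_mem_affSpace _
    have h2 : rotComp R f ∈ (affSpace d ^ k).map (rotComp R).toLinearMap :=
      Submodule.mem_map_of_mem (f := (rotComp R).toLinearMap) hf
    rw [Submodule.map_pow] at h2
    exact pow_le_pow_left' h1 k h2

/-- The zonal function `u ↦ q(⟨a, u⟩)`. -/
def zonal (q : Polynomial ℝ) (a : EuclideanSpace ℝ (Fin d)) : C(Sph d, ℝ) :=
  Polynomial.aeval (linFun a) q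

lemma zonal_apply (q : Polynomial ℝ) (a : EuclideanSpace ℝ (Fin d)) (u : Sph d) :
    zonal q a u = q.eval ⟪a, (u : EuclideanSpace ℝ (Fin d))⟫_ℝ := by
  have h := Polynomial.aeval_algHom_apply (ContinuousMap.evalAlgHom ℝ ℝ u) (linFun a) q
  simp only [ContinuousMap.evalAlgHom_apply] at h
  rw [zonal, ← h, linFun_apply, Polynomial.coe_aeval_eq_eval]

lemma linFun_pow_mem_polyLT (a : EuclideanSpace ℝ (Fin d)) {j k : ℕ} (h : j < k) :
    linFun a ^ j ∈ polyLT d k :=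
  polyLT_mono (Nat.succ_le_of_lt h) (Submodule.pow_mem_pow _ (linFun_mem_affSpace a) j)

lemma zonal_mem_polyLT {q : Polynomial ℝ} {k : ℕ} (hq : q ∈ Polynomial.degreeLT ℝ k)
    (a : EuclideanSpace ℝ (Fin d)) : zonal q a ∈ polyLT d k := by
  rw [zonal, Polynomial.aeval_eq_sum_range]
  refine Submodule.sum_mem _ fun j hj => ?_
  by_cases h : j < k
  · exact Submodule.smul_mem _ _ (linFun_pow_mem_polyLT a h)
  · have : q.coeff j = 0 := Polynomial.coeff_eq_zero_of_degree_lt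
      ((Polynomial.mem_degreeLT.1 hq).trans_le (by exact_mod_cast not_lt.1 h))
    rw [this, zero_smul]; exact Submodule.zero_mem _

/-- A polynomial function of degree `≤ k` restricted to a great circle. -/
lemma exists_eval_on_circle (e₁ e₂ : EuclideanSpace ℝ (Fin d)) {k : ℕ} {f : C(Sph d, ℝ)}
    (hf : f ∈ polyLT d (k + 1)) :
    ∃ A ∈ Polynomial.degreeLT ℝ (k + 1), ∃ B ∈ Polynomial.degreeLT ℝ k, ∀ (u : Sph d) (c s : ℝ),
      (u : EuclideanSpace ℝ (Fin d)) = c • e₁ + s • e₂ → s ^ 2 = 1 - c ^ 2 →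
      f u = A.eval c + s * B.eval c := by
  have hC : ∀ (m : ℕ) (r : ℝ), Polynomial.C r ∈ Polynomial.degreeLT ℝ (m + 1) := fun m r =>
    Polynomial.mem_degreeLT.2 (Polynomial.degree_C_le.trans_lt (by exact_mod_cast Nat.succ_pos m))
  have hmul : ∀ {m m' : ℕ} {P Q : Polynomial ℝ}, P ∈ Polynomial.degreeLT ℝ (m + 1) →
      Q ∈ Polynomial.degreeLT ℝ m' → P * Q ∈ Polynomial.degreeLT ℝ (m + m') := by
    intro m m' P Q hP hQ
    rw [Polynomial.mem_degreeLT] at *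
    rcases eq_or_ne P 0 with rfl | hP0
    · simp
    rcases eq_or_ne Q 0 with rfl | hQ0
    · simp
    have hPQ := mul_ne_zero hP0 hQ0
    rw [← Polynomial.natDegree_lt_iff_degree_lt ‹_›] at *
    rw [Polynomial.natDegree_mul hP0 hQ0]
    omega
  refine Submodule.pow_induction_on_left' (M := affSpace d) (C := fun k f _ =>
    ∃ A ∈ Polynomial.degreeLT ℝ (k + 1), ∃ B ∈ Polynomial.degreeLT ℝ k, ∀ (u : Sph d) (c s : ℝ),
      (u : EuclideanSpace ℝ (Fin d)) = c • e₁ + s • e₂ → s ^ 2 = 1 - c ^ 2 →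
      f u = A.eval c + s * B.eval c) ?_ ?_ ?_ hf
  · exact fun r => ⟨Polynomial.C r, hC 0 r, 0, Submodule.zero_mem _, fun u c s _ _ => by simp⟩
  · rintro x y i hx hy ⟨A, hA, B, hB, h⟩ ⟨A', hA', B', hB', h'⟩
    refine ⟨A + A', add_mem hA hA', B + B', add_mem hB hB', fun u c s hu hs => ?_⟩
    rw [ContinuousMap.add_apply, h u c s hu hs, h' u c s hu hs, Polynomial.eval_add,
      Polynomial.eval_add]
    ring
  · intro g hg i x hx hA
    obtain ⟨A, hA, B, hB, h⟩ := hA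
    obtain ⟨α, β, γ, hg'⟩ : ∃ α β γ : ℝ, ∀ (u : Sph d) (c s : ℝ),
        (u : EuclideanSpace ℝ (Fin d)) = c • e₁ + s • e₂ → g u = α + c * β + s * γ := by
      refine Submodule.span_induction (p := fun g _ => ∃ α β γ : ℝ, ∀ (u : Sph d) (c s : ℝ),
        (u : EuclideanSpace ℝ (Fin d)) = c • e₁ + s • e₂ → g u = α + c * β + s * γ) ?_ ?_ ?_ ?_ hg
      · intro g hg
        simp only [affGen, Finset.coe_insert, Finset.coe_image, Finset.coe_univ, Set.image_univ,
          Set.mem_insert_iff, Set.mem_range] at hg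
        obtain rfl | ⟨i, rfl⟩ := hg
        · exact ⟨1, 0, 0, fun u c s _ => by simp⟩
        · refine ⟨0, ⟪EuclideanSpace.single i (1 : ℝ), e₁⟫_ℝ,
            ⟪EuclideanSpace.single i (1 : ℝ), e₂⟫_ℝ,
            fun u c s hu => ?_⟩
          rw [linFun_apply, hu, inner_add_right, inner_smul_right, inner_smul_right, zero_add]
      · exact ⟨0, 0, 0, fun u c s _ => by simp⟩
      · rintro x y - - ⟨α, β, γ, h⟩ ⟨α', β', γ', h'⟩
        refine ⟨α + α', β + β', γ + γ', fun u c s hu => ?_⟩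
        rw [ContinuousMap.add_apply, h u c s hu, h' u c s hu]; ring
      · rintro r x - ⟨α, β, γ, h⟩
        refine ⟨r * α, r * β, r * γ, fun u c s hu => ?_⟩
        rw [ContinuousMap.smul_apply, h u c s hu, smul_eq_mul]; ring
    have hlin : (Polynomial.C α + Polynomial.X * Polynomial.C β) ∈
        Polynomial.degreeLT ℝ (1 + 1) := by
      rw [Polynomial.mem_degreeLT, add_comm, mul_comm]
      exact Polynomial.degree_linear_le.trans_lt (by norm_num)
    have hquad : (1 - Polynomial.X ^ 2 : Polynomial ℝ) * Polynomial.C γ ∈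
        Polynomial.degreeLT ℝ (2 + 1) := by
      rw [Polynomial.mem_degreeLT]
      refine lt_of_le_of_lt (b := 2) ?_ (by norm_num)
      compute_degree
    refine ⟨(Polynomial.C α + Polynomial.X * Polynomial.C β) * A +
        ((1 - Polynomial.X ^ 2) * Polynomial.C γ) * B, add_mem ?_ ?_,
      (Polynomial.C α + Polynomial.X * Polynomial.C β) * B + Polynomial.C γ * A,
      add_mem ?_ ?_, fun u c s hu hs => ?_⟩
    · have := hmul hlin hA; rwa [show 1 + (i + 1) = i.succ + 1 by omega] at this
    · have := hmul hquad hB; rwa [show 2 + i = i.succ + 1 by omega] at this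
    · have := hmul hlin hB; rwa [show 1 + i = i.succ by omega] at this
    · have := hmul (hC 0 γ) hA; rwa [show 0 + (i + 1) = i.succ by omega] at this
    · rw [ContinuousMap.mul_apply, hg' u c s hu, h u c s hu hs]
      simp only [Polynomial.eval_add, Polynomial.eval_mul, Polynomial.eval_sub, Polynomial.eval_pow,
        Polynomial.eval_C, Polynomial.eval_X, Polynomial.eval_one]
      rw [← hs]; ring

/-- A rotation-invariant kernel which is polynomial in its second variable is zonal. -/
lemma exists_zonal_of_invariant (hd : 2 ≤ d) {k : ℕ} {F : Sph d → C(Sph d, ℝ)}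
    (hF : ∀ v, F v ∈ polyLT d (k + 1))
    (hinv : ∀ R u v, F (rot R u) (rot R v) = F u v) :
    ∃ A ∈ Polynomial.degreeLT ℝ (k + 1), ∀ v, F v = zonal A v := by
  set e₁ : EuclideanSpace ℝ (Fin d) := EuclideanSpace.single ⟨0, by omega⟩ 1 with he₁
  set e₂ : EuclideanSpace ℝ (Fin d) := EuclideanSpace.single ⟨1, by omega⟩ 1 with he₂
  have h11 : ⟪e₁, e₁⟫_ℝ = 1 := by simp [he₁]
  have h22 : ⟪e₂, e₂⟫_ℝ = 1 := by simp [he₂]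
  have h12 : ⟪e₁, e₂⟫_ℝ = 0 := by
    rw [he₁, EuclideanSpace.inner_single_left]; simp [he₂]
  have hmem : ∀ c s : ℝ, s ^ 2 = 1 - c ^ 2 → c • e₁ + s • e₂ ∈
      Metric.sphere (0 : EuclideanSpace ℝ (Fin d)) 1 := by
    intro c s hs
    rw [mem_sphere_zero_iff_norm, ← sq_eq_sq₀ (norm_nonneg _) zero_le_one,
      ← real_inner_self_eq_norm_sq]
    simp only [inner_add_left, inner_add_right, inner_smul_left, inner_smul_right, h11, h22, h12,
      real_inner_comm e₁ e₂, RCLike.conj_to_real]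
    linarith
  let v₀ : Sph d := ⟨e₁, by simp [he₁]⟩
  obtain ⟨A, hA, B, -, h⟩ := exists_eval_on_circle e₁ e₂ (hF v₀)
  refine ⟨A, hA, fun v => ContinuousMap.ext fun u => ?_⟩
  rw [zonal_apply]
  set c : ℝ := ⟪(v : EuclideanSpace ℝ (Fin d)), (u : EuclideanSpace ℝ (Fin d))⟫_ℝ with hc
  have hc1 : c ^ 2 ≤ 1 := by
    have := abs_real_inner_le_norm (v : EuclideanSpace ℝ (Fin d)) u
    rw [norm_coe_sph, norm_coe_sph, mul_one] at this
    exact (sq_le_one_iff_abs_le_one c).2 this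
  have key : ∀ s : ℝ, s ^ 2 = 1 - c ^ 2 → F v u = A.eval c + s * B.eval c := by
    intro s hs
    obtain ⟨R, h1, h2⟩ := exists_rot_pair (u := v) (v := u) (u' := v₀) (v' := ⟨_, hmem c s hs⟩) (by
      rw [← hc]
      simp only [v₀, inner_add_right, inner_smul_right, h11, h12]
      ring)
    rw [← hinv R, h1, h2]
    exact h _ c s rfl hs
  have hs0 : √(1 - c ^ 2) ^ 2 = 1 - c ^ 2 := Real.sq_sqrt (by linarith)
  have e1 := key _ hs0
  have e2 := key (-√(1 - c ^ 2)) (by rw [neg_sq, hs0])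
  linarith

end SpherePolynomials

section Dimension

open scoped InnerProductSpace
open Module

lemma sphDim_succ_le (D k : ℕ) :
    sphDim (D + 1) (k + 1) ≤ D.multichoose (k + 1) + D.multichoose k := by
  rcases k with _ | k
  · simp [sphDim]
  · rw [sphDim, if_neg (by omega), if_neg (by omega)]
    apply Nat.div_le_of_le_mul
    rcases D with _ | D
    · simp [show 0 + 1 + (k + 1 + 1) - 3 = k by omega]
    rw [Nat.multichoose_eq, Nat.multichoose_eq]
    have h := Nat.add_one_mul_choose_eq (D + 1 + k) (k + 1)
    rw [show D + 1 + 1 + (k + 1 + 1) - 3 = D + 1 + k by omega,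
      show D + 1 + (k + 1 + 1) - 1 = D + 1 + k + 1 by omega,
      show D + 1 + (k + 1) - 1 = D + 1 + k by omega, show k + 1 + 1 - 1 = k + 1 by omega,
      show D + 1 + 1 + 2 * (k + 1 + 1) - 2 = (D + 1 + k + 1) + (k + 1 + 1) by omega]
    nlinarith

lemma sphDimLT_succ_le (D m : ℕ) : sphDimLT (D + 1) (m + 1) ≤
    ∑ j ∈ Finset.range (m + 1), D.multichoose j + ∑ j ∈ Finset.range m, D.multichoose j := by
  induction m with
  | zero => simp [sphDimLT, sphDim]
  | succ m ih =>
    have h := sphDim_succ_le D m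
    rw [sphDimLT] at ih ⊢
    rw [Finset.sum_range_succ (fun k => sphDim (D + 1) k) (m + 1)]
    rw [Finset.sum_range_succ (fun j => D.multichoose j) (m + 1),
      Finset.sum_range_succ (fun j => D.multichoose j) m]
    rw [Finset.sum_range_succ (fun j => D.multichoose j) m] at ih
    omega

/-- Exponents of total degree less than `k`. -/
def expLT (D k : ℕ) : Finset (Fin D →₀ ℕ) :=
  (Finset.range k).biUnion fun j => Finset.univ.finsuppAntidiag j

lemma mem_expLT {D k : ℕ} {n : Fin D →₀ ℕ} : n ∈ expLT D k ↔ ∑ i, n i < k := by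
  simp [expLT]

lemma card_expLT (D k : ℕ) : (expLT D k).card = ∑ j ∈ Finset.range k, D.multichoose j := by
  rw [expLT, Finset.card_biUnion]
  · simp [Finset.card_finsuppAntidiag_nat_eq_multichoose]
  · intro i _ j _ hij
    rw [Function.onFun, Finset.disjoint_left]
    intro n hn hn'
    rw [Finset.mem_finsuppAntidiag] at hn hn'
    exact hij (hn.1.symm.trans hn'.1)

lemma finrank_restrictSupport_expLT (D k : ℕ) :
    finrank ℝ (MvPolynomial.restrictSupport ℝ (expLT D k : Set (Fin D →₀ ℕ))) =
      ∑ j ∈ Finset.range k, D.multichoose j := by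
  rw [finrank_eq_card_basis (MvPolynomial.basisRestrictSupport ℝ _), ← card_expLT]
  simp

/-- Evaluation of polynomials in all coordinates but the first. -/
def evalTail (D : ℕ) : MvPolynomial (Fin D) ℝ →ₐ[ℝ] C(Sph (D + 1), ℝ) :=
  MvPolynomial.aeval fun i => linFun (EuclideanSpace.single i.succ (1 : ℝ))

lemma evalTail_apply {D : ℕ} (A : MvPolynomial (Fin D) ℝ) (u : Sph (D + 1)) :
    evalTail D A u =
      MvPolynomial.eval (fun i => (u : EuclideanSpace ℝ (Fin (D + 1))) i.succ) A := by
  have h := MvPolynomial.comp_aeval_apply (R := ℝ)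
    (fun i : Fin D => linFun (EuclideanSpace.single i.succ (1 : ℝ)))
    (ContinuousMap.evalAlgHom ℝ ℝ u) A
  simp only [ContinuousMap.evalAlgHom_apply] at h
  rw [evalTail, h, MvPolynomial.aeval_eq_eval]
  simp [linFun_apply, EuclideanSpace.inner_single_left]

lemma prod_mem_prod_submodule {ι A : Type*} [CommRing A] [Algebra ℝ A] (s : Finset ι)
    {M : ι → Submodule ℝ A} {x : ι → A} (h : ∀ i ∈ s, x i ∈ M i) :
    ∏ i ∈ s, x i ∈ ∏ i ∈ s, M i := by
  classical
  induction s using Finset.induction_on with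
  | empty => simpa using Submodule.one_le.1 (le_refl (1 : Submodule ℝ A))
  | insert i s hi ih =>
    rw [Finset.prod_insert hi, Finset.prod_insert hi]
    exact Submodule.mul_mem_mul (h i (by simp)) (ih fun j hj => h j (by simp [hj]))

lemma evalTail_mem {D k : ℕ} {A : MvPolynomial (Fin D) ℝ}
    (hA : A ∈ MvPolynomial.restrictSupport ℝ (expLT D k : Set (Fin D →₀ ℕ))) :
    evalTail D A ∈ polyLT (D + 1) k := by
  rw [MvPolynomial.restrictSupport_eq_span] at hA
  refine Submodule.span_induction (p := fun A _ => evalTail D A ∈ polyLT (D + 1) k) ?_ ?_ ?_ ?_ hA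
  · rintro _ ⟨n, hn, rfl⟩
    have hn' : ∑ i, n i < k := mem_expLT.1 hn
    refine polyLT_mono (Nat.succ_le_of_lt hn') ?_
    change _ ∈ affSpace (D + 1) ^ (∑ i, n i)
    rw [evalTail, MvPolynomial.aeval_monomial, map_one, one_mul,
      Finsupp.prod_fintype _ _ (by simp), ← Finset.prod_pow_eq_pow_sum]
    exact prod_mem_prod_submodule _ (M := fun i => affSpace (D + 1) ^ n i) fun i _ =>
      Submodule.pow_mem_pow _ (linFun_mem_affSpace _) _
  · rw [map_zero]; exact Submodule.zero_mem _
  · intro x y _ _ hx hy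
    rw [map_add]; exact Submodule.add_mem _ hx hy
  · intro r x _ hx
    rw [map_smul]; exact Submodule.smul_mem _ _ hx

lemma eq_zero_of_evalTail_add {D : ℕ} {A B : MvPolynomial (Fin D) ℝ}
    (h : evalTail D A + linFun (EuclideanSpace.single 0 (1 : ℝ)) * evalTail D B = 0) :
    A = 0 ∧ B = 0 := by
  set δ : ℝ := 1 / (D + 1) with hδ
  have hD : (0 : ℝ) ≤ D := Nat.cast_nonneg D
  have hδ0 : 0 < δ := by positivity
  have key : ∀ y ∈ Set.pi Set.univ fun _ : Fin D => Set.Ioo 0 δ,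
      MvPolynomial.eval y A = 0 ∧ MvPolynomial.eval y B = 0 := by
    intro y hy
    have hsum : ∑ i, y i ^ 2 < 1 := by
      have h1 : ∀ i, y i ^ 2 ≤ δ ^ 2 := fun i => by
        have := hy i trivial
        exact pow_le_pow_left₀ this.1.le this.2.le 2
      calc ∑ i, y i ^ 2 ≤ ∑ _i : Fin D, δ ^ 2 := Finset.sum_le_sum fun i _ => h1 i
        _ = D * δ ^ 2 := by simp
        _ < 1 := by
          rw [hδ, div_pow, one_pow, mul_one_div, div_lt_one (by positivity)]; nlinarith
    set s : ℝ := √(1 - ∑ i, y i ^ 2) with hs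
    have hs0 : 0 < s := Real.sqrt_pos.2 (by linarith)
    have hs2 : s ^ 2 = 1 - ∑ i, y i ^ 2 := Real.sq_sqrt (by linarith)
    have hpt : ∀ t : ℝ, t ^ 2 = s ^ 2 → MvPolynomial.eval y A + t * MvPolynomial.eval y B = 0 := by
      intro t ht
      have hmem : WithLp.toLp 2 (Fin.cons t y : Fin (D + 1) → ℝ) ∈
          Metric.sphere (0 : EuclideanSpace ℝ (Fin (D + 1))) 1 := by
        rw [mem_sphere_zero_iff_norm, EuclideanSpace.norm_eq, Real.sqrt_eq_one, Fin.sum_univ_succ]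
        simp [ht, hs2]
      have := congrArg (fun f : C(Sph (D + 1), ℝ) => f ⟨_, hmem⟩) h
      simpa [evalTail_apply, linFun_apply, EuclideanSpace.inner_single_left] using this
    have e1 := hpt s rfl
    have e2 := hpt (-s) (neg_sq s)
    have e3 : s * MvPolynomial.eval y B = 0 := by linarith
    exact ⟨by linarith, (mul_eq_zero.1 e3).resolve_left hs0.ne'⟩
  have hinf : ∀ _ : Fin D, (Set.Ioo 0 δ).Infinite := fun _ => Set.Ioo_infinite hδ0
  exact ⟨MvPolynomial.funext_set _ hinf fun y hy => by simp [(key y hy).1],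
    MvPolynomial.funext_set _ hinf fun y hy => by simp [(key y hy).2]⟩

lemma sphDimLT_le_finrank {d : ℕ} (hd : 1 ≤ d) (l : ℕ) : sphDimLT d l ≤ finrank ℝ (polyLT d l) := by
  obtain ⟨D, rfl⟩ : ∃ D, d = D + 1 := ⟨d - 1, by omega⟩
  rcases l with _ | m
  · simp [sphDimLT]
  refine (sphDimLT_succ_le D m).trans ?_
  rw [← finrank_restrictSupport_expLT D (m + 1), ← finrank_restrictSupport_expLT D m]
  set V₁ := MvPolynomial.restrictSupport ℝ (expLT D (m + 1) : Set (Fin D →₀ ℕ))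
  set V₂ := MvPolynomial.restrictSupport ℝ (expLT D m : Set (Fin D →₀ ℕ))
  have h₁ : FiniteDimensional ℝ V₁ :=
    Module.Finite.of_basis (MvPolynomial.basisRestrictSupport ℝ _)
  have h₂ : FiniteDimensional ℝ V₂ :=
    Module.Finite.of_basis (MvPolynomial.basisRestrictSupport ℝ _)
  rw [← finrank_prod]
  let Ψ : V₁ × V₂ →ₗ[ℝ] C(Sph (D + 1), ℝ) :=
    ((evalTail D).toLinearMap ∘ₗ V₁.subtype).coprod
      (LinearMap.mulLeft ℝ (linFun (EuclideanSpace.single 0 (1 : ℝ))) ∘ₗ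
        (evalTail D).toLinearMap ∘ₗ V₂.subtype)
  have hΨ : ∀ x, Ψ x = evalTail D x.1 + linFun (EuclideanSpace.single 0 (1 : ℝ)) * evalTail D x.2 :=
    fun x => by simp [Ψ]
  have hmem : ∀ x, Ψ x ∈ polyLT (D + 1) (m + 1) := by
    intro x
    rw [hΨ]
    refine Submodule.add_mem _ (evalTail_mem x.1.2) ?_
    have h := evalTail_mem x.2.2
    rcases m with _ | m
    · rw [(Submodule.mem_bot ℝ).1 h, mul_zero]; exact Submodule.zero_mem _
    · change _ ∈ affSpace (D + 1) ^ (m + 1)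
      rw [pow_succ']
      exact Submodule.mul_mem_mul (linFun_mem_affSpace _) h
  refine LinearMap.finrank_le_finrank_of_injective (f := Ψ.codRestrict _ hmem) ?_
  rw [← LinearMap.ker_eq_bot, LinearMap.ker_codRestrict, LinearMap.ker_eq_bot']
  intro x hx
  rw [hΨ] at hx
  obtain ⟨h1, h2⟩ := eq_zero_of_evalTail_add hx
  exact Prod.ext (Subtype.ext h1) (Subtype.ext h2)

end Dimension

section Harmonics

open scoped InnerProductSpace
open Module

variable {d : ℕ} {τ : Measure (Sph d)}

lemma RotInv.integral_rot (hτ : RotInv τ)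
    (R : EuclideanSpace ℝ (Fin d) ≃ₗᵢ[ℝ] EuclideanSpace ℝ (Fin d)) {F : Sph d → ℝ}
    (hF : AEStronglyMeasurable F τ) : ∫ x, F (rot R x) ∂τ = ∫ x, F x ∂τ := by
  have h := hτ R
  have := integral_map (μ := τ) h.measurable.aemeasurable (f := F) (by rwa [h.map_eq])
  rw [h.map_eq] at this
  exact this.symm

lemma rot_symm_rot (R : EuclideanSpace ℝ (Fin d) ≃ₗᵢ[ℝ] EuclideanSpace ℝ (Fin d)) (u : Sph d) :
    rot R.symm (rot R u) = u := Subtype.ext (R.symm_apply_apply _)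

lemma RotInv.isOpenPosMeasure [IsProbabilityMeasure τ] (hτ : RotInv τ) : τ.IsOpenPosMeasure := by
  refine ⟨fun U hU hne h0 => ?_⟩
  obtain ⟨x₀, hx₀⟩ := hne
  have : τ Set.univ = 0 := by
    refine measure_null_of_locally_null _ fun v _ => ?_
    obtain ⟨R, hR⟩ := exists_rot v x₀
    refine ⟨rot R ⁻¹' U, mem_nhdsWithin_of_mem_nhds
      ((hU.preimage (continuous_rot R)).mem_nhds (by rwa [Set.mem_preimage, hR])), ?_⟩
    rw [(hτ R).measure_preimage hU.measurableSet.nullMeasurableSet, h0]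
  simp at this

variable [IsProbabilityMeasure τ]

lemma integrable_continuousMap (f : C(Sph d, ℝ)) : Integrable (fun x => f x) τ :=
  f.continuous.integrable_of_hasCompactSupport (HasCompactSupport.of_compactSpace _)

lemma integrable_mul_continuousMap (f g : C(Sph d, ℝ)) : Integrable (fun x => f x * g x) τ :=
  integrable_continuousMap (f * g)

variable (τ) in
/-- Continuous functions as elements of `L²`. -/
def l2Map : C(Sph d, ℝ) →ₗ[ℝ] Lp ℝ 2 τ := (ContinuousMap.toLp 2 τ ℝ).toLinearMap

lemma inner_l2Map (f g : C(Sph d, ℝ)) : ⟪l2Map τ f, l2Map τ g⟫_ℝ = ∫ x, f x * g x ∂τ := by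
  refine (ContinuousMap.inner_toLp τ f g).trans (integral_congr_ae (ae_of_all _ fun x => ?_))
  simp [mul_comm]

lemma l2Map_injective (hτ : RotInv τ) : Function.Injective (l2Map τ) :=
  have := hτ.isOpenPosMeasure
  ContinuousMap.toLp_injective τ

lemma finrank_map_l2Map (hτ : RotInv τ) (H : Submodule ℝ C(Sph d, ℝ)) :
    finrank ℝ (H.map (l2Map τ)) = finrank ℝ H :=
  (LinearEquiv.finrank_eq (Submodule.equivMapOfInjective _ (l2Map_injective hτ) H)).symm

/-- A finite-dimensional space of continuous functions has a basis orthonormal in `L²`. -/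
lemma exists_orthonormal (hτ : RotInv τ) (H : Submodule ℝ C(Sph d, ℝ)) [FiniteDimensional ℝ H] :
    ∃ φ : Fin (finrank ℝ H) → C(Sph d, ℝ), (∀ a, φ a ∈ H) ∧
      (∀ a b, ∫ x, φ a x * φ b x ∂τ = if a = b then 1 else 0) ∧
      ∀ f ∈ H, f = ∑ a, (∫ x, φ a x * f x ∂τ) • φ a := by
  let b := (stdOrthonormalBasis ℝ (H.map (l2Map τ))).reindex (finCongr (finrank_map_l2Map hτ H))
  have hb : ∀ a, ∃ f ∈ H, l2Map τ f = b a := fun a => (b a).2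
  choose φ hφ hφb using hb
  refine ⟨φ, hφ, fun a c => ?_, fun f hf => l2Map_injective hτ ?_⟩
  · rw [← inner_l2Map, hφb, hφb, ← Submodule.coe_inner]
    exact orthonormal_iff_ite.1 b.orthonormal a c
  · have h := b.sum_repr ⟨l2Map τ f, Submodule.mem_map_of_mem hf⟩
    have h' := congrArg (Subtype.val) h
    rw [map_sum]
    simp only [map_smul, hφb, ← inner_l2Map]
    refine h'.symm.trans ?_
    rw [AddSubmonoidClass.coe_finsetSum]
    simp [b.repr_apply_apply]

variable (τ) in
/-- Polynomials of degree at most `k` orthogonal to those of smaller degree. -/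
def harm (k : ℕ) : Submodule ℝ C(Sph d, ℝ) :=
  polyLT d (k + 1) ⊓ (((polyLT d k).map (l2Map τ))ᗮ).comap (l2Map τ)

lemma mem_harm {k : ℕ} {f : C(Sph d, ℝ)} :
    f ∈ harm τ k ↔ f ∈ polyLT d (k + 1) ∧ ∀ g ∈ polyLT d k, ∫ x, g x * f x ∂τ = 0 := by
  simp [harm, Submodule.mem_orthogonal, inner_l2Map]

instance finiteDimensional_harm (k : ℕ) : FiniteDimensional ℝ (harm τ k) :=
  Submodule.finiteDimensional_of_le (inf_le_left : _ ≤ polyLT d (k + 1))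

lemma finrank_harm_add (hτ : RotInv τ) (k : ℕ) :
    finrank ℝ (polyLT d k) + finrank ℝ (harm τ k) = finrank ℝ (polyLT d (k + 1)) := by
  have h : (harm τ k).map (l2Map τ) =
      ((polyLT d k).map (l2Map τ))ᗮ ⊓ (polyLT d (k + 1)).map (l2Map τ) := by
    ext y
    simp only [harm, Submodule.mem_map, Submodule.mem_inf, Submodule.mem_comap]
    exact ⟨fun ⟨x, ⟨hx, hx'⟩, hxy⟩ => ⟨hxy ▸ hx', x, hx, hxy⟩,
      fun ⟨hy, x, hx, hxy⟩ => ⟨x, ⟨hx, hxy ▸ hy⟩, hxy⟩⟩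
  rw [← finrank_map_l2Map hτ, ← finrank_map_l2Map hτ (harm τ k),
    ← finrank_map_l2Map hτ (polyLT d (k + 1)), h]
  exact Submodule.finrank_add_inf_finrank_orthogonal (Submodule.map_mono (polyLT_le_succ k))

lemma sum_finrank_harm (hτ : RotInv τ) (l : ℕ) :
    ∑ k ∈ Finset.range l, finrank ℝ (harm τ k) = finrank ℝ (polyLT d l) := by
  induction l with
  | zero => rw [Finset.sum_range_zero]; exact (finrank_bot ℝ C(Sph d, ℝ)).symm
  | succ l ih => rw [Finset.sum_range_succ, ih, finrank_harm_add hτ]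

lemma rotComp_mem_harm (hτ : RotInv τ)
    (R : EuclideanSpace ℝ (Fin d) ≃ₗᵢ[ℝ] EuclideanSpace ℝ (Fin d)) {k : ℕ} {f : C(Sph d, ℝ)}
    (hf : f ∈ harm τ k) : rotComp R f ∈ harm τ k := by
  rw [mem_harm] at hf ⊢
  refine ⟨rotComp_mem_polyLT R hf.1, fun g hg => ?_⟩
  rw [← hf.2 _ (rotComp_mem_polyLT R.symm hg),
    ← hτ.integral_rot R (F := fun x => rotComp R.symm g x * f x)
      (integrable_mul_continuousMap _ _).aestronglyMeasurable]
  simp only [rotComp_apply, rot_symm_rot]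

lemma eq_zero_of_mem_harm (hτ : RotInv τ) {k : ℕ} {f : C(Sph d, ℝ)} (hf : f ∈ harm τ k)
    (hf0 : f ∈ polyLT d k) : f = 0 := by
  refine l2Map_injective hτ ?_
  rw [map_zero, ← inner_self_eq_zero (𝕜 := ℝ), inner_l2Map]
  exact (mem_harm.1 hf).2 f hf0

/-- The kernel of a rotation-invariant orthonormal system of harmonics is zonal. -/
lemma exists_zonal_kernel (hτ : RotInv τ) (hd : 2 ≤ d) {k : ℕ} {ι : Type*} [Fintype ι]
    {φ : ι → C(Sph d, ℝ)} (hφ : ∀ a, φ a ∈ harm τ k)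
    (hexp : ∀ f ∈ harm τ k, f = ∑ a, (∫ x, φ a x * f x ∂τ) • φ a) :
    ∃ A ∈ Polynomial.degreeLT ℝ (k + 1), ∀ v, ∑ a, φ a v • φ a = zonal A v := by
  set Z : Sph d → C(Sph d, ℝ) := fun v => ∑ a, φ a v • φ a with hZ
  have hZmem : ∀ v, Z v ∈ harm τ k := fun v =>
    Submodule.sum_mem _ fun a _ => Submodule.smul_mem _ _ (hφ a)
  have hrep : ∀ v, ∀ f ∈ harm τ k, ∫ x, f x * Z v x ∂τ = f v := by
    intro v f hf
    have h1 : ∀ x, f x * Z v x = ∑ a, φ a v * (φ a x * f x) := fun x => by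
      simp only [hZ, ContinuousMap.sum_apply, ContinuousMap.smul_apply, smul_eq_mul, Finset.mul_sum]
      exact Finset.sum_congr rfl fun a _ => by ring
    simp only [h1]
    rw [integral_finsetSum _ fun a _ => (integrable_mul_continuousMap _ _).const_mul _]
    conv_rhs => rw [hexp f hf]
    simp only [integral_const_mul, ContinuousMap.sum_apply, ContinuousMap.smul_apply, smul_eq_mul]
    exact Finset.sum_congr rfl fun a _ => mul_comm _ _
  refine exists_zonal_of_invariant hd (fun v => (mem_harm.1 (hZmem v)).1) fun R u v => ?_
  have h2 : rotComp R (Z (rot R u)) = Z u := by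
    rw [hexp _ (rotComp_mem_harm hτ R (hZmem _)), hexp _ (hZmem u)]
    refine Finset.sum_congr rfl fun a _ => ?_
    congr 1
    rw [hrep u _ (hφ a)]
    have h3 := hrep (rot R u) _ (rotComp_mem_harm hτ R.symm (hφ a))
    rw [rotComp_apply, rot_symm_rot, ← hτ.integral_rot R
      (integrable_mul_continuousMap _ _).aestronglyMeasurable] at h3
    simpa only [rotComp_apply, rot_symm_rot] using h3
  rw [← rotComp_apply, h2]

end Harmonics

section FunkHecke

open scoped InnerProductSpace
open Module

variable {d : ℕ} {τ : Measure (Sph d)}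

lemma integral_margLaw_eq [IsProbabilityMeasure τ] (hτ : RotInv τ) (hd : 4 ≤ d) {f : ℝ → ℝ}
    (hf : Measurable f) (u : Sph d) :
    ∫ t, f t ∂(margLaw d) =
      ∫ x : Sph d, f (√d * ⟪(u : EuclideanSpace ℝ (Fin d)),
        (x : EuclideanSpace ℝ (Fin d))⟫_ℝ) ∂τ := by
  rw [← map_inner_eq_margLaw hd hτ u, integral_map (by fun_prop) hf.aestronglyMeasurable]

lemma measurable_comp_inner {s : ℝ → ℝ} (hs : Measurable s) (w : EuclideanSpace ℝ (Fin d)) :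
    Measurable fun x : Sph d => s (√d * ⟪w, (x : EuclideanSpace ℝ (Fin d))⟫_ℝ) :=
  hs.comp (by fun_prop)

lemma integrable_comp_inner_mul [IsFiniteMeasure τ] {s : ℝ → ℝ} (hs : PolyGrowth s)
    (w : EuclideanSpace ℝ (Fin d)) (g : C(Sph d, ℝ)) :
    Integrable (fun x : Sph d => s (√d * ⟪w, (x : EuclideanSpace ℝ (Fin d))⟫_ℝ) * g x) τ := by
  have hg : Integrable (fun x => g x) τ :=
    g.continuous.integrable_of_hasCompactSupport (HasCompactSupport.of_compactSpace _)
  obtain ⟨hm, C, k, hC⟩ := hs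
  have hC0 : 0 ≤ C := by simpa using (abs_nonneg _).trans (hC 0)
  refine hg.bdd_mul (measurable_comp_inner hm w).aestronglyMeasurable
    (c := C * (1 + √d * ‖w‖) ^ k) (ae_of_all _ fun x => ?_)
  rw [Real.norm_eq_abs]
  refine (hC _).trans (mul_le_mul_of_nonneg_left (pow_le_pow_left₀ (by positivity) ?_ k) hC0)
  rw [abs_mul, abs_of_nonneg (Real.sqrt_nonneg _)]
  have := abs_real_inner_le_norm w (x : EuclideanSpace ℝ (Fin d))
  rw [norm_coe_sph, mul_one] at this
  gcongr

/-- A zonal kernel of degree `k` with values in the harmonics of degree `k` is proportional to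
the reproducing kernel. -/
lemma exists_smul_zonal_eq [IsProbabilityMeasure τ] (hτ : RotInv τ) {k : ℕ}
    {A B : Polynomial ℝ} (hA : A ∈ Polynomial.degreeLT ℝ (k + 1))
    (hB : B ∈ Polynomial.degreeLT ℝ (k + 1))
    (hA' : ∀ v : Sph d, zonal A (v : EuclideanSpace ℝ (Fin d)) ∈ harm τ k)
    (hB' : ∀ v : Sph d, zonal B (v : EuclideanSpace ℝ (Fin d)) ∈ harm τ k) :
    (∀ v : Sph d, zonal (d := d) A v = 0) ∨
      ∃ lam : ℝ, ∀ v : Sph d, zonal (d := d) B v = lam • zonal (d := d) A v := by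
  have hsub : ∀ {P : Polynomial ℝ}, P ∈ Polynomial.degreeLT ℝ (k + 1) → P.coeff k = 0 →
      P ∈ Polynomial.degreeLT ℝ k := by
    intro P hP h0
    rw [Polynomial.mem_degreeLT] at *
    refine lt_of_le_of_ne (Order.le_of_lt_succ ?_) fun h => ?_
    · exact_mod_cast hP
    · exact Polynomial.coeff_ne_zero_of_eq_degree h h0
  by_cases h0 : A.coeff k = 0
  · exact Or.inl fun v => eq_zero_of_mem_harm hτ (hA' v) (zonal_mem_polyLT (hsub hA h0) _)
  · refine Or.inr ⟨B.coeff k / A.coeff k, fun v => ?_⟩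
    set lam := B.coeff k / A.coeff k
    have hz : zonal (d := d) (B - lam • A) v = zonal (d := d) B v - lam • zonal (d := d) A v := by
      rw [zonal, map_sub, map_smul]; rfl
    rw [← sub_eq_zero, ← hz]
    refine eq_zero_of_mem_harm hτ (k := k) ?_ (zonal_mem_polyLT (hsub ?_ ?_) _)
    · rw [hz]; exact Submodule.sub_mem _ (hB' v) (Submodule.smul_mem _ _ (hA' v))
    · exact Submodule.sub_mem _ hB (Submodule.smul_mem _ _ hA)
    · rw [Polynomial.coeff_sub, Polynomial.coeff_smul, smul_eq_mul, div_mul_cancel₀ _ h0, sub_self]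

lemma comp_C_mul_X_mem_degreeLT {q : Polynomial ℝ} {k : ℕ} (hq : q ∈ Polynomial.degreeLT ℝ k)
    (c : ℝ) : q.comp (Polynomial.C c * Polynomial.X) ∈ Polynomial.degreeLT ℝ k := by
  rw [Polynomial.mem_degreeLT] at hq ⊢
  rcases eq_or_ne q 0 with rfl | hq0
  · rwa [Polynomial.zero_comp]
  refine Polynomial.degree_le_natDegree.trans_lt ?_
  rw [Polynomial.degree_eq_natDegree hq0] at hq
  have hq1 : q.natDegree < k := by exact_mod_cast hq
  have h1 : (q.comp (Polynomial.C c * Polynomial.X)).natDegree ≤ q.natDegree := by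
    refine Polynomial.natDegree_comp_le.trans ?_
    have := (Polynomial.natDegree_C_mul_le c Polynomial.X).trans Polynomial.natDegree_X_le
    nlinarith
  exact_mod_cast h1.trans_lt hq1

/-- Funk–Hecke: an orthonormal basis of the harmonics of degree `k`, consisting of eigenfunctions
of the zonal integral operator, together with the eigenvalue. -/
theorem exists_harmonic_eigenbasis [IsProbabilityMeasure τ] (hτ : RotInv τ) (hd : 4 ≤ d)
    {s : ℝ → ℝ} (hs : PolyGrowth s) (k : ℕ) :
    ∃ (φ : Fin (finrank ℝ (harm τ k)) → C(Sph d, ℝ)) (Q : Polynomial ℝ) (lam : ℝ),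
      (∀ a, φ a ∈ harm τ k) ∧
      (∀ a b, ∫ x, φ a x * φ b x ∂τ = if a = b then 1 else 0) ∧
      (∀ v, ∑ a, φ a v ^ 2 = finrank ℝ (harm τ k)) ∧
      (∀ a (w : Sph d), ∫ x : Sph d,
        s (√d * ⟪(w : EuclideanSpace ℝ (Fin d)), (x : EuclideanSpace ℝ (Fin d))⟫_ℝ) * φ a x ∂τ =
          lam * φ a w) ∧
      Q ∈ Polynomial.degreeLT ℝ (k + 1) ∧
      (∀ q ∈ Polynomial.degreeLT ℝ k, ∫ t, q.eval t * Q.eval t ∂(margLaw d) = 0) ∧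
      ∫ t, Q.eval t ^ 2 ∂(margLaw d) = finrank ℝ (harm τ k) ∧
      ∫ t, s t * Q.eval t ∂(margLaw d) = lam * finrank ℝ (harm τ k) := by
  obtain ⟨φ, hφ, hort, hexp⟩ := exists_orthonormal hτ (harm τ k)
  obtain ⟨A, hA, hZ⟩ := exists_zonal_kernel hτ (by omega) hφ hexp
  have hZ' : ∀ u v : Sph d, (zonal (d := d) A u) v = ∑ a, φ a u * φ a v := fun u v => by
    rw [← hZ u]; simp [ContinuousMap.sum_apply]
  have hAmem : ∀ v : Sph d, zonal (d := d) A v ∈ harm τ k := fun v => by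
    rw [← hZ v]; exact Submodule.sum_mem _ fun a _ => Submodule.smul_mem _ _ (hφ a)
  have hdpos : (0 : ℝ) < √d := Real.sqrt_pos.2 (by exact_mod_cast (by omega : 0 < d))
  let e : Sph d := ⟨EuclideanSpace.single ⟨0, by omega⟩ 1, by simp⟩
  -- the diagonal of the kernel
  have hdiag : ∀ v : Sph d, ∑ a, φ a v ^ 2 = A.eval 1 := fun v => by
    have := hZ' v v
    rw [zonal_apply, real_inner_self_eq_norm_sq, norm_coe_sph, one_pow] at this
    rw [this]; exact Finset.sum_congr rfl fun a _ => sq _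
  have hM : A.eval 1 = finrank ℝ (harm τ k) := by
    have h1 : ∫ x, ∑ a, φ a x ^ 2 ∂τ = ∑ a, ∫ x, φ a x * φ a x ∂τ := by
      rw [← integral_finsetSum _ fun a _ => integrable_mul_continuousMap _ _]
      simp only [sq]
    simp only [hdiag, hort, if_true] at h1
    simpa using h1
  -- eigenvalues
  obtain ⟨lam, hlam⟩ : ∃ lam : ℝ, ∀ a (w : Sph d), ∫ x : Sph d,
        s (√d * ⟪(w : EuclideanSpace ℝ (Fin d)), (x : EuclideanSpace ℝ (Fin d))⟫_ℝ) * φ a x ∂τ =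
          lam * φ a w := by
    set T : Fin (finrank ℝ (harm τ k)) → Sph d → ℝ := fun a w => ∫ x : Sph d,
        s (√d * ⟪(w : EuclideanSpace ℝ (Fin d)), (x : EuclideanSpace ℝ (Fin d))⟫_ℝ) * φ a x ∂τ
    set K : Sph d → C(Sph d, ℝ) := fun w => ∑ a, T a w • φ a with hK
    have hKmem : ∀ w, K w ∈ harm τ k := fun w =>
      Submodule.sum_mem _ fun a _ => Submodule.smul_mem _ _ (hφ a)
    have hKint : ∀ w v : Sph d, K w v = ∫ x : Sph d,
        s (√d * ⟪(w : EuclideanSpace ℝ (Fin d)), (x : EuclideanSpace ℝ (Fin d))⟫_ℝ) *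
          zonal (d := d) A v x ∂τ := by
      intro w v
      have h1 : ∀ x : Sph d, s (√d * ⟪(w : EuclideanSpace ℝ (Fin d)),
          (x : EuclideanSpace ℝ (Fin d))⟫_ℝ) * zonal (d := d) A v x = ∑ a, φ a v *
          (s (√d * ⟪(w : EuclideanSpace ℝ (Fin d)),
            (x : EuclideanSpace ℝ (Fin d))⟫_ℝ) * φ a x) := by
        intro x
        rw [hZ', Finset.mul_sum]
        exact Finset.sum_congr rfl fun a _ => by ring
      simp only [h1]
      rw [integral_finsetSum _ fun a _ => (integrable_comp_inner_mul hs _ _).const_mul _]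
      simp only [hK, T, ContinuousMap.sum_apply, ContinuousMap.smul_apply, smul_eq_mul,
        integral_const_mul]
      exact Finset.sum_congr rfl fun a _ => mul_comm _ _
    obtain ⟨B, hB, hKB⟩ := exists_zonal_of_invariant (k := k) (by omega : 2 ≤ d)
      (fun v => (mem_harm.1 (hKmem v)).1) (fun R u v => by
        rw [hKint, hKint,
          ← hτ.integral_rot R (integrable_comp_inner_mul hs _ _).aestronglyMeasurable]
        simp only [zonal_apply, coe_rot, R.inner_map_map])
    rcases exists_smul_zonal_eq hτ hA hB hAmem (fun v => hKB v ▸ hKmem v) with h0 | ⟨lam, h⟩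
    · refine ⟨0, fun a _ => ?_⟩
      have h1 := hZ' e e
      have h2 := hdiag e
      rw [h0, ContinuousMap.zero_apply] at h1
      rw [hM, show ∑ a, φ a e ^ 2 = 0 by rw [h1]; exact Finset.sum_congr rfl fun a _ => sq _] at h2
      have h3 : finrank ℝ (harm τ k) = 0 := by exact_mod_cast h2.symm
      exact absurd a.2 (by omega)
    · refine ⟨lam, fun b w => ?_⟩
      have h1 : K w = lam • zonal (d := d) A w := by rw [hKB, h]
      have h2 : ∀ c : Fin (finrank ℝ (harm τ k)) → ℝ,
          ∫ x, φ b x * (∑ a, c a • φ a : C(Sph d, ℝ)) x ∂τ = c b := by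
        intro c
        have h3 : ∀ x, φ b x * (∑ a, c a • φ a : C(Sph d, ℝ)) x = ∑ a, c a * (φ b x * φ a x) := by
          intro x
          simp only [ContinuousMap.sum_apply, ContinuousMap.smul_apply, smul_eq_mul, Finset.mul_sum]
          exact Finset.sum_congr rfl fun a _ => by ring
        simp only [h3]
        rw [integral_finsetSum _ fun a _ => (integrable_mul_continuousMap _ _).const_mul _]
        simp [integral_const_mul, hort]
      have h4 := h2 fun a => T a w
      have h5 := h2 fun a => lam * φ a w
      have h6 : (∑ a, (lam * φ a w) • φ a : C(Sph d, ℝ)) = K w := by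
        rw [h1, ← hZ, Finset.smul_sum]
        exact Finset.sum_congr rfl fun a _ => mul_smul _ _ _
      rw [h6] at h5
      exact h4.symm.trans h5
  set Q : Polynomial ℝ := A.comp (Polynomial.C (√d)⁻¹ * Polynomial.X) with hQ
  have hQeval : ∀ c : ℝ, Q.eval (√d * c) = A.eval c := fun c => by
    rw [hQ, Polynomial.eval_comp, Polynomial.eval_mul, Polynomial.eval_C, Polynomial.eval_X,
      inv_mul_cancel_left₀ hdpos.ne']
  have hrep : ∀ f ∈ harm τ k, ∫ x, f x * zonal (d := d) A e x ∂τ = f e := by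
    intro f hf
    have h1 : ∀ x, f x * zonal (d := d) A e x = ∑ a, φ a e * (φ a x * f x) := fun x => by
      rw [hZ', Finset.mul_sum]
      exact Finset.sum_congr rfl fun a _ => by ring
    simp only [h1]
    rw [integral_finsetSum _ fun a _ => (integrable_mul_continuousMap _ _).const_mul _]
    conv_rhs => rw [hexp f hf]
    simp only [integral_const_mul, ContinuousMap.sum_apply, ContinuousMap.smul_apply, smul_eq_mul]
    exact Finset.sum_congr rfl fun a _ => mul_comm _ _
  refine ⟨φ, Q, lam, hφ, hort, fun v => (hdiag v).trans hM, hlam, ?_, fun q hq => ?_, ?_, ?_⟩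
  · exact comp_C_mul_X_mem_degreeLT hA _
  · rw [integral_margLaw_eq hτ hd (by fun_prop) e]
    simp only [hQeval]
    have h1 : zonal (d := d) (q.comp (Polynomial.C √d * Polynomial.X)) e ∈ polyLT d k :=
      zonal_mem_polyLT (comp_C_mul_X_mem_degreeLT hq _) _
    have h2 := (mem_harm.1 (hAmem e)).2 _ h1
    simpa [zonal_apply] using h2
  · rw [integral_margLaw_eq hτ hd (by fun_prop) e]
    simp only [hQeval]
    have h1 := hrep _ (hAmem e)
    rw [zonal_apply A _ e, real_inner_self_eq_norm_sq, norm_coe_sph, one_pow, hM] at h1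
    rw [← h1]
    simp only [zonal_apply, sq]
  · rw [integral_margLaw_eq hτ hd (f := fun t => s t * Q.eval t)
      (hs.1.mul (by fun_prop)) e]
    simp only [hQeval]
    have h1 : ∀ x : Sph d, s (√d * ⟪(e : EuclideanSpace ℝ (Fin d)),
        (x : EuclideanSpace ℝ (Fin d))⟫_ℝ) * A.eval ⟪(e : EuclideanSpace ℝ (Fin d)),
        (x : EuclideanSpace ℝ (Fin d))⟫_ℝ = ∑ a, φ a e *
        (s (√d * ⟪(e : EuclideanSpace ℝ (Fin d)), (x : EuclideanSpace ℝ (Fin d))⟫_ℝ) * φ a x) := by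
      intro x
      rw [← zonal_apply, hZ', Finset.mul_sum]
      exact Finset.sum_congr rfl fun a _ => by ring
    simp only [h1]
    rw [integral_finsetSum _ fun a _ => (integrable_comp_inner_mul hs _ _).const_mul _]
    simp only [integral_const_mul, hlam]
    rw [← hM, ← hdiag e, Finset.mul_sum]
    exact Finset.sum_congr rfl fun a _ => by ring

end FunkHecke

section Hermite

open Polynomial

/-- The probabilists' Hermite polynomial with real coefficients. -/
def realHermite (n : ℕ) : ℝ[X] := (hermite n).map (Int.castRingHom ℝ)

lemma realHermite_succ (n : ℕ) :
    realHermite (n + 1) = X * realHermite n - derivative (realHermite n) := by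
  simp [realHermite, hermite_succ, Polynomial.derivative_map]

lemma realHermite_monic (n : ℕ) : (realHermite n).Monic := (hermite_monic n).map _

lemma natDegree_realHermite (n : ℕ) : (realHermite n).natDegree = n := by
  rw [realHermite, (hermite_monic n).natDegree_map, natDegree_hermite]

lemma hermiteL2_eq (k : ℕ) (s : ℝ) :
    hermiteL2 k s = (realHermite k).eval s / √(Nat.factorial k) := by
  rw [hermiteL2, realHermite, aeval_def, eval₂_eq_eval_map]; rfl

/-- Gaussian integration by parts for polynomials. -/
lemma integral_stdGaussian_stein (q : ℝ[X]) :
    ∫ t, (X * q - derivative q).eval t ∂stdGaussian = 0 := by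
  have hint : ∀ r : ℝ[X], Integrable fun t : ℝ => Real.exp (-(1 / 2) * t ^ 2) * r.eval t := by
    intro r
    obtain ⟨b, hb, hle⟩ := (PolyGrowth.eval r).exists_integrable_bound
    refine hb.mono' (by fun_prop) (ae_of_all _ fun t => ?_)
    rw [norm_mul, Real.norm_eq_abs, Real.norm_eq_abs, abs_of_pos (Real.exp_pos _)]
    refine le_trans ?_ (hle t)
    gcongr ?_ * _
    exact Real.exp_le_exp.2 (by nlinarith [sq_nonneg t])
  have hder : ∀ t : ℝ, HasDerivAt (fun t : ℝ => Real.exp (-(1 / 2) * t ^ 2) * q.eval t)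
      (-(Real.exp (-(1 / 2) * t ^ 2) * (X * q - derivative q).eval t)) t := by
    intro t
    have h1 : HasDerivAt (fun t : ℝ => -(1 / 2) * t ^ 2) (-t) t := by
      have := (hasDerivAt_pow 2 t).const_mul (-(1 / 2) : ℝ)
      convert! this using 1; ring
    convert! h1.exp.mul (q.hasDerivAt t) using 1
    simp only [eval_sub, eval_mul, eval_X]; ring
  have h := integral_eq_zero_of_hasDerivAt_of_integrable hder (hint _).neg (hint q)
  rw [integral_neg, neg_eq_zero] at h
  rw [integral_stdGaussian, h, mul_zero]

lemma integral_realHermite_mul (n : ℕ) (q : ℝ[X]) :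
    ∫ t, (realHermite n * q).eval t ∂stdGaussian =
      ∫ t, (derivative^[n] q).eval t ∂stdGaussian := by
  induction n generalizing q with
  | zero => simp [realHermite]
  | succ n ih =>
    rw [Function.iterate_succ_apply, ← ih]
    have h : realHermite (n + 1) * q = (X * (realHermite n * q) - derivative (realHermite n * q)) +
        realHermite n * derivative q := by
      rw [realHermite_succ, derivative_mul]; ring
    rw [h]
    simp only [eval_add]
    rw [integral_add (PolyGrowth.eval _).integrable_stdGaussian
      (PolyGrowth.eval _).integrable_stdGaussian, integral_stdGaussian_stein, zero_add]

lemma integral_hermiteL2_mul (i j : ℕ) :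
    ∫ t, hermiteL2 i t * hermiteL2 j t ∂stdGaussian = if i = j then 1 else 0 := by
  wlog h : j ≤ i generalizing i j
  · rw [show (if i = j then (1 : ℝ) else 0) = if j = i then 1 else 0 by simp only [eq_comm],
      ← this j i (by omega)]
    simp only [mul_comm]
  have h1 : ∀ t, hermiteL2 i t * hermiteL2 j t =
      (√(Nat.factorial i))⁻¹ * (√(Nat.factorial j))⁻¹ * (realHermite i * realHermite j).eval t := by
    intro t
    rw [hermiteL2_eq, hermiteL2_eq, eval_mul]; ring
  simp only [h1]
  rw [integral_const_mul, integral_realHermite_mul]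
  rcases h.lt_or_eq with h | rfl
  · rw [iterate_derivative_eq_zero (by rwa [natDegree_realHermite])]
    simp [h.ne']
  · have h2 : derivative^[j] (realHermite j) = C (Nat.factorial j : ℝ) := by
      rw [eq_C_of_natDegree_eq_zero (Nat.le_zero.1 ((natDegree_iterate_derivative _ _).trans
        (by rw [natDegree_realHermite, Nat.sub_self]))), coeff_iterate_derivative]
      have := (realHermite_monic j).coeff_natDegree
      rw [natDegree_realHermite] at this
      simp [this, Nat.descFactorial_self]
    rw [h2]
    simp only [eval_C, integral_const, probReal_univ, one_smul, if_true]
    rw [← mul_inv, Real.mul_self_sqrt (by positivity), inv_mul_cancel₀ (by positivity)]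

lemma exists_sum_hermiteL2 {k : ℕ} {Q : ℝ[X]} (hQ : Q ∈ degreeLT ℝ k) :
    ∃ c : ℕ → ℝ, ∀ t, Q.eval t = ∑ j ∈ Finset.range k, c j * hermiteL2 j t := by
  induction k generalizing Q with
  | zero =>
    rw [mem_degreeLT] at hQ
    have : Q = 0 := by
      rw [← degree_eq_bot]
      exact Nat.WithBot.lt_zero_iff.1 (by exact_mod_cast hQ)
    exact ⟨0, fun t => by simp [this]⟩
  | succ k ih =>
    obtain ⟨c, hc⟩ := ih (Q := Q - C (Q.coeff k) * realHermite k) (by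
      rw [mem_degreeLT, degree_lt_iff_coeff_zero]
      intro m hm
      rw [mem_degreeLT, degree_lt_iff_coeff_zero] at hQ
      rw [coeff_sub, coeff_C_mul]
      have h1 := (realHermite_monic k).coeff_natDegree
      rw [natDegree_realHermite] at h1
      rcases hm.eq_or_lt with rfl | hm
      · rw [h1]; ring
      · rw [hQ m hm, coeff_eq_zero_of_natDegree_lt (p := realHermite k)
          (by rwa [natDegree_realHermite])]; ring)
    refine ⟨Function.update c k (Q.coeff k * √(Nat.factorial k)), fun t => ?_⟩
    rw [Finset.sum_range_succ, Function.update_self, hermiteL2_eq]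
    have h2 : ∑ j ∈ Finset.range k, Function.update c k (Q.coeff k * √(Nat.factorial k)) j *
        hermiteL2 j t = ∑ j ∈ Finset.range k, c j * hermiteL2 j t :=
      Finset.sum_congr rfl fun j hj => by
        rw [Function.update_of_ne (Finset.mem_range.1 hj).ne]
    rw [h2, ← hc, eval_sub, eval_mul, eval_C]
    have : √(Nat.factorial k : ℝ) ≠ 0 := by positivity
    field_simp
    ring

/-- `hermiteL2 k` as a polynomial. -/
lemma exists_poly_hermiteL2 (k : ℕ) : ∃ q ∈ degreeLT ℝ (k + 1), ∀ t, q.eval t = hermiteL2 k t := by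
  refine ⟨C (√(Nat.factorial k))⁻¹ * realHermite k, ?_, fun t => ?_⟩
  · rw [mem_degreeLT]
    refine degree_le_natDegree.trans_lt ?_
    have := natDegree_C_mul_le (√(Nat.factorial k : ℝ))⁻¹ (realHermite k)
    rw [natDegree_realHermite] at this
    exact_mod_cast Nat.lt_succ_of_le this
  · rw [hermiteL2_eq, eval_mul, eval_C]; ring

lemma polyGrowth_hermiteL2 (k : ℕ) : PolyGrowth (hermiteL2 k) := by
  obtain ⟨q, -, h⟩ := exists_poly_hermiteL2 k
  simpa only [h] using PolyGrowth.eval q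

/-- The normalized top-degree orthogonal polynomial for the one-dimensional marginal of the
sphere has non-vanishing correlation with `s` when `s` has a non-zero Hermite coefficient. -/
theorem exists_eventually_sq_integral_ge {s : ℝ → ℝ} (hs : PolyGrowth s) {k : ℕ}
    (hk : hermiteCoeff s k ≠ 0) :
    ∃ c : ℝ, 0 < c ∧ ∀ᶠ d in atTop, ∀ Q ∈ degreeLT ℝ (k + 1),
      (∀ q ∈ degreeLT ℝ k, ∫ t, q.eval t * Q.eval t ∂(margLaw d) = 0) →
      c * ∫ t, Q.eval t ^ 2 ∂(margLaw d) ≤ (∫ t, s t * Q.eval t ∂(margLaw d)) ^ 2 := by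
  set μ := hermiteCoeff s with hμ
  have hμ0 : 0 < |μ k| := abs_pos.2 hk
  set B : ℝ := ∑ j ∈ Finset.range (k + 1), |μ j| + 1 with hB
  have hB1 : 1 ≤ B := le_add_of_nonneg_left (Finset.sum_nonneg fun _ _ => abs_nonneg _)
  set η : ℝ := min (1 / (2 * (k + 1))) (|μ k| / (8 * (k + 1) * B)) with hη
  have hη0 : 0 < η := lt_min (by positivity) (by positivity)
  have hη1 : η * (k + 1) ≤ 1 / 2 := by
    calc η * (k + 1) ≤ 1 / (2 * (k + 1)) * (k + 1) := by gcongr; exact min_le_left _ _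
      _ = 1 / 2 := by field_simp
  have hη2 : η * (k + 1) * B ≤ |μ k| / 8 := by
    calc η * (k + 1) * B ≤ |μ k| / (8 * (k + 1) * B) * (k + 1) * B := by
          gcongr; exact min_le_right _ _
      _ = |μ k| / 8 := by field_simp
  have hG : ∀ i ∈ Finset.range (k + 1), ∀ j ∈ Finset.range (k + 1), ∀ᶠ d in atTop,
      |∫ t, hermiteL2 i t * hermiteL2 j t ∂(margLaw d) - (if i = j then 1 else 0)| < η := by
    intro i _ j _
    have h := tendsto_integral_margLaw ((polyGrowth_hermiteL2 i).mul (polyGrowth_hermiteL2 j))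
    rw [integral_hermiteL2_mul] at h
    simpa only [Real.dist_eq] using Metric.tendsto_nhds.1 h η hη0
  have hm : ∀ j ∈ Finset.range (k + 1), ∀ᶠ d in atTop,
      |∫ t, s t * hermiteL2 j t ∂(margLaw d) - μ j| < min 1 (|μ k| / 2) := by
    intro j _
    have h : Tendsto (fun d => ∫ t, s t * hermiteL2 j t ∂(margLaw d)) atTop (nhds (μ j)) :=
      tendsto_integral_margLaw (hs.mul (polyGrowth_hermiteL2 j))
    simpa only [Real.dist_eq] using Metric.tendsto_nhds.1 h _ (lt_min one_pos (by positivity))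
  refine ⟨μ k ^ 2 / 128, by positivity, ?_⟩
  simp only [← Finset.eventually_all] at hG hm
  filter_upwards [hG, hm, eventually_ge_atTop 4] with d hG hm hd Q hQ horth
  obtain ⟨c, hc⟩ := exists_sum_hermiteL2 hQ
  set G : ℕ → ℕ → ℝ := fun i j => ∫ t, hermiteL2 i t * hermiteL2 j t ∂(margLaw d) with hGdef
  set m : ℕ → ℝ := fun j => ∫ t, s t * hermiteL2 j t ∂(margLaw d) with hmdef
  have hexp : ∀ f : ℝ → ℝ, PolyGrowth f → ∫ t, f t * Q.eval t ∂(margLaw d) =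
      ∑ j ∈ Finset.range (k + 1), c j * ∫ t, f t * hermiteL2 j t ∂(margLaw d) := by
    intro f hf
    simp only [hc, Finset.mul_sum]
    rw [integral_finsetSum _ fun j _ => ?_]
    · refine Finset.sum_congr rfl fun j _ => ?_
      rw [← integral_const_mul]
      exact integral_congr_ae (ae_of_all _ fun t => by ring)
    · exact PolyGrowth.integrable_margLaw
        (hf.mul ((PolyGrowth.const _).mul (polyGrowth_hermiteL2 j))) hd
  set S : ℝ := ∑ j ∈ Finset.range (k + 1), |c j| with hS
  have hS0 : 0 ≤ S := Finset.sum_nonneg fun _ _ => abs_nonneg _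
  have hGexp : ∀ i ∈ Finset.range (k + 1),
      |∑ j ∈ Finset.range (k + 1), c j * G i j - c i| ≤ η * S := by
    intro i hi
    have h1 : ∑ j ∈ Finset.range (k + 1), c j * G i j - c i =
        ∑ j ∈ Finset.range (k + 1), c j * (G i j - if i = j then 1 else 0) := by
      simp only [mul_sub, Finset.sum_sub_distrib, mul_ite, mul_one, mul_zero,
        Finset.sum_ite_eq, hi, if_true]
    rw [h1, hS, Finset.mul_sum]
    refine (Finset.abs_sum_le_sum_abs _ _).trans (Finset.sum_le_sum fun j hj => ?_)
    rw [abs_mul, mul_comm]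
    exact mul_le_mul_of_nonneg_right (hG i hi j hj).le (abs_nonneg _)
  have hci : ∀ i ∈ Finset.range k, |c i| ≤ η * S := by
    intro i hi
    have hik := Finset.mem_range.1 hi
    have h1 := hGexp i (Finset.mem_range.2 (by omega))
    obtain ⟨q, hq, hqe⟩ := exists_poly_hermiteL2 i
    have h2 := horth q (degreeLT_mono (by omega) hq)
    simp only [hqe] at h2
    rw [hexp _ (polyGrowth_hermiteL2 i)] at h2
    rwa [h2, zero_sub, abs_neg] at h1
  have hS2 : S ≤ 2 * |c k| := by
    have h1 : S ≤ k * (η * S) + |c k| :=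
      calc S = ∑ j ∈ Finset.range k, |c j| + |c k| := Finset.sum_range_succ _ _
        _ ≤ k * (η * S) + |c k| := by
          gcongr
          exact (Finset.sum_le_sum hci).trans (by simp)
    nlinarith [mul_le_mul_of_nonneg_right hη1 hS0]
  have hQ2 : ∫ t, Q.eval t ^ 2 ∂(margLaw d) ≤ 8 * c k ^ 2 := by
    have h1 : ∫ t, Q.eval t ^ 2 ∂(margLaw d) =
        ∑ i ∈ Finset.range (k + 1), c i * ∑ j ∈ Finset.range (k + 1), c j * G i j := by
      simp only [sq]
      rw [hexp _ (PolyGrowth.eval Q)]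
      refine Finset.sum_congr rfl fun i _ => ?_
      rw [← hexp _ (polyGrowth_hermiteL2 i)]
      simp only [mul_comm]
    have hηS : η ≤ 1 := by nlinarith
    have h2 : ∀ i ∈ Finset.range (k + 1),
        c i * ∑ j ∈ Finset.range (k + 1), c j * G i j ≤ |c i| * (2 * S) := by
      intro i hi
      refine (le_abs_self _).trans ?_
      rw [abs_mul]
      gcongr
      have h3 := hGexp i hi
      have h4 : |c i| ≤ S := Finset.single_le_sum (f := fun j => |c j|)
        (fun _ _ => abs_nonneg _) hi
      have h5 := abs_sub_abs_le_abs_sub (∑ j ∈ Finset.range (k + 1), c j * G i j) (c i)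
      nlinarith
    rw [h1]
    refine (Finset.sum_le_sum h2).trans ?_
    rw [← Finset.sum_mul]
    change S * (2 * S) ≤ _
    nlinarith [sq_abs (c k), abs_nonneg (c k)]
  have hsQ : |c k| * (|μ k| / 4) ≤ |∫ t, s t * Q.eval t ∂(margLaw d)| := by
    rw [hexp s hs, Finset.sum_range_succ]
    change _ ≤ |∑ j ∈ Finset.range k, c j * m j + c k * m k|
    have h1 : |∑ j ∈ Finset.range k, c j * m j| ≤ k * (η * S * B) := by
      refine (Finset.abs_sum_le_sum_abs _ _).trans ?_
      refine (Finset.sum_le_sum (g := fun _ => η * S * B) fun j hj => ?_).trans (by simp)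
      rw [abs_mul]
      have hj' : j ∈ Finset.range (k + 1) :=
        Finset.mem_range.2 ((Finset.mem_range.1 hj).trans (Nat.lt_succ_self k))
      have h3 : |m j| ≤ B := by
        have h4 := (hm j hj').le.trans (min_le_left _ _)
        have h5 : |μ j| ≤ ∑ j ∈ Finset.range (k + 1), |μ j| :=
          Finset.single_le_sum (f := fun j => |μ j|) (fun _ _ => abs_nonneg _) hj'
        have h6 := abs_sub_abs_le_abs_sub (m j) (μ j)
        rw [hB]; linarith
      exact mul_le_mul (hci j hj) h3 (abs_nonneg _) (by positivity)
    have h2 : |μ k| / 2 ≤ |m k| := by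
      have h4 := (hm k (by simp)).le.trans (min_le_right _ _)
      have h6 := abs_sub_abs_le_abs_sub (μ k) (m k)
      rw [abs_sub_comm] at h6
      linarith
    have h3 : |c k| * |m k| - |∑ j ∈ Finset.range k, c j * m j| ≤
        |∑ j ∈ Finset.range k, c j * m j + c k * m k| := by
      have := abs_sub_abs_le_abs_sub (c k * m k) (-∑ j ∈ Finset.range k, c j * m j)
      rw [abs_neg, abs_mul, sub_neg_eq_add, add_comm (c k * m k)] at this
      exact this
    have h4 : (k : ℝ) * (η * S * B) ≤ |μ k| / 8 * S := by
      calc (k : ℝ) * (η * S * B) ≤ (k + 1) * (η * S * B) := by gcongr; linarith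
        _ = η * (k + 1) * B * S := by ring
        _ ≤ |μ k| / 8 * S := by gcongr
    nlinarith [abs_nonneg (c k), mul_le_mul_of_nonneg_left h2 (abs_nonneg (c k)),
      mul_le_mul_of_nonneg_left hS2 hμ0.le]
  calc μ k ^ 2 / 128 * ∫ t, Q.eval t ^ 2 ∂(margLaw d) ≤ μ k ^ 2 / 128 * (8 * c k ^ 2) := by gcongr
    _ = (|c k| * (|μ k| / 4)) ^ 2 := by rw [mul_pow, div_pow, sq_abs, sq_abs]; ring
    _ ≤ |∫ t, s t * Q.eval t ∂(margLaw d)| ^ 2 := by gcongr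
    _ = _ := sq_abs _

end Hermite

section Eigenbasis

open scoped InnerProductSpace

/-- The low-degree spherical harmonics form an orthonormal eigenbasis of the kernel operator
`s (√d ⟪w, x⟫)`, with eigenvalues of order at least `d ^ (-(l - 1) / 2)`. -/
theorem exists_eventually_lowDegree_eigenbasis {s : ℝ → ℝ} (hs : PolyGrowth s) {l : ℕ}
    (hk : ∀ k < l, hermiteCoeff s k ≠ 0) :
    ∃ c : ℝ, 0 < c ∧ ∀ᶠ d in atTop, ∀ (τ : Measure (Sph d)) [IsProbabilityMeasure τ],
      RotInv τ → ∃ (φ : Fin (Module.finrank ℝ (polyLT d l)) → C(Sph d, ℝ))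
        (lam : Fin (Module.finrank ℝ (polyLT d l)) → ℝ),
        (∀ a b, ∫ x, φ a x * φ b x ∂τ = if a = b then 1 else 0) ∧
        (∀ v, ∑ a, φ a v ^ 2 = Module.finrank ℝ (polyLT d l)) ∧
        (∀ a (w : Sph d), ∫ x : Sph d,
          s (√d * ⟪(w : EuclideanSpace ℝ (Fin d)), (x : EuclideanSpace ℝ (Fin d))⟫_ℝ) * φ a x ∂τ =
            lam a * φ a w) ∧
        ∀ a, c / ((d : ℝ) + 1) ^ (l - 1) ≤ lam a ^ 2 := by
  choose! c hc0 hc using fun k (h : k < l) => exists_eventually_sq_integral_ge hs (hk k h)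
  have hall : ∀ᶠ d in atTop, ∀ k ∈ Finset.range l, ∀ Q ∈ Polynomial.degreeLT ℝ (k + 1),
      (∀ q ∈ Polynomial.degreeLT ℝ k, ∫ t, q.eval t * Q.eval t ∂(margLaw d) = 0) →
      c k * ∫ t, Q.eval t ^ 2 ∂(margLaw d) ≤ (∫ t, s t * Q.eval t ∂(margLaw d)) ^ 2 := by
    rw [Finset.eventually_all]
    exact fun k h => hc k (Finset.mem_range.1 h)
  obtain ⟨C, hC0, hC⟩ : ∃ C : ℝ, 0 < C ∧ ∀ k < l, C ≤ c k := by
    rcases Nat.eq_zero_or_pos l with rfl | hl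
    · exact ⟨1, one_pos, fun k h => absurd h (by omega)⟩
    · obtain ⟨k₀, hk₀, hmin⟩ := (Finset.range l).exists_min_image c ⟨0, Finset.mem_range.2 hl⟩
      exact ⟨c k₀, hc0 k₀ (Finset.mem_range.1 hk₀), fun k h => hmin k (Finset.mem_range.2 h)⟩
  refine ⟨C, hC0, ?_⟩
  filter_upwards [hall, eventually_ge_atTop 4] with d hd hd4 τ _ hτ
  choose φ Q lam h1 h2 h3 h4 h5 h6 h7 h8 using exists_harmonic_eigenbasis (τ := τ) hτ hd4 hs
  have hcard : Fintype.card (Σ k : Fin l, Fin (Module.finrank ℝ (harm τ k))) =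
      Module.finrank ℝ (polyLT d l) := by
    rw [Fintype.card_sigma, ← sum_finrank_harm hτ l,
      Finset.sum_range fun k => Module.finrank ℝ (harm τ k)]
    simp
  have hcross : ∀ j k, j < k → ∀ a b, ∫ x, φ j a x * φ k b x ∂τ = 0 := fun j k hjk a b =>
    (mem_harm.1 (h1 k b)).2 _ (polyLT_mono (by omega) (mem_harm.1 (h1 j a)).1)
  let e := (Fintype.equivFinOfCardEq hcard).symm
  refine ⟨fun a => φ (e a).1 (e a).2, fun a => lam (e a).1, fun a b => ?_, fun v => ?_,
    fun a w => h4 _ _ w, fun a => ?_⟩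
  · have key : ∀ u v : Σ k : Fin l, Fin (Module.finrank ℝ (harm τ k)),
        ∫ x, φ u.1 u.2 x * φ v.1 v.2 x ∂τ = if u = v then 1 else 0 := by
      rintro ⟨j, a⟩ ⟨k, b⟩
      rcases lt_trichotomy j k with h | rfl | h
      · rw [if_neg (by rintro ⟨⟩; exact lt_irrefl _ h)]
        exact hcross j k h a b
      · simp only [h2, Sigma.mk.injEq, heq_eq_eq, true_and]
      · rw [if_neg (by rintro ⟨⟩; exact lt_irrefl _ h)]
        simp only [mul_comm (φ j a _)]
        exact hcross k j h b a
    simp only [key, e.injective.eq_iff]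
  · rw [Equiv.sum_comp e fun u => φ u.1 u.2 v ^ 2, Fintype.sum_sigma, ← sum_finrank_harm hτ l,
      Finset.sum_range fun k => Module.finrank ℝ (harm τ k)]
    simp [h3]
  · have hk := (e a).1.2
    set k : ℕ := (e a).1.val
    have hM : 0 < (Module.finrank ℝ (harm τ k) : ℝ) := by
      exact_mod_cast (Nat.zero_le _).trans_lt (e a).2.2
    have hle : (Module.finrank ℝ (harm τ k) : ℝ) ≤ ((d : ℝ) + 1) ^ (l - 1) := by
      calc (Module.finrank ℝ (harm τ k) : ℝ) ≤ Module.finrank ℝ (polyLT d l) := by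
            rw [← sum_finrank_harm hτ l]
            exact_mod_cast Finset.single_le_sum (f := fun k => Module.finrank ℝ (harm τ k))
              (fun _ _ => Nat.zero_le _) (Finset.mem_range.2 hk)
        _ ≤ _ := by
          have := finrank_polyLT_le (d := d) (l - 1)
          rw [Nat.sub_add_cancel (by omega)] at this
          exact_mod_cast this
    have h9 := hd k (Finset.mem_range.2 hk) (Q k) (h5 k) (h6 k)
    rw [h7, h8, mul_pow, sq (Module.finrank ℝ (harm τ k) : ℝ), ← mul_assoc] at h9
    have h10 := le_of_mul_le_mul_right h9 hM
    rw [div_le_iff₀ (by positivity)]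
    calc C ≤ c k := hC k hk
      _ ≤ _ := h10
      _ ≤ _ := by gcongr

end Eigenbasis

section Features

open Matrix

variable {α ι : Type*} [Fintype ι] {p : ℕ}

/-- The empirical average `p⁻¹ ∑ⱼ Sⱼ(x) vⱼ`. -/
def featMean (S : Fin p → α → ℝ) (v : Fin p → ι → ℝ) (x : α) : ι → ℝ :=
  fun a => (p : ℝ)⁻¹ * ∑ j, S j x * v j a

lemma featMean_dotProduct (S : Fin p → α → ℝ) (v : Fin p → ι → ℝ) (x : α) (b : ι → ℝ) :
    featMean S v x ⬝ᵥ b = (p : ℝ)⁻¹ * ∑ j, S j x * (v j ⬝ᵥ b) := by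
  simp only [featMean, dotProduct, Finset.mul_sum, Finset.sum_mul]
  rw [Finset.sum_comm]
  exact Finset.sum_congr rfl fun j _ => Finset.sum_congr rfl fun a _ => by ring

variable {S : Fin p → α → ℝ} {v : Fin p → ι → ℝ}

lemma sq_featMean_dotProduct_le (hp : 0 < p)
    (hv : ∀ b, ∑ j, (v j ⬝ᵥ b) ^ 2 ≤ 3 / 2 * p * (b ⬝ᵥ b)) (x : α) (b : ι → ℝ) :
    (featMean S v x ⬝ᵥ b) ^ 2 ≤ 3 / 2 * ((p : ℝ)⁻¹ * ∑ j, S j x ^ 2) * (b ⬝ᵥ b) := by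
  have hp' : (0 : ℝ) < p := by exact_mod_cast hp
  have h0 : 0 ≤ ∑ j, S j x ^ 2 := Finset.sum_nonneg fun _ _ => sq_nonneg _
  rw [featMean_dotProduct, mul_pow]
  calc (p : ℝ)⁻¹ ^ 2 * (∑ j, S j x * (v j ⬝ᵥ b)) ^ 2
      ≤ (p : ℝ)⁻¹ ^ 2 * ((∑ j, S j x ^ 2) * ∑ j, (v j ⬝ᵥ b) ^ 2) := by
        gcongr; exact Finset.sum_mul_sq_le_sq_mul_sq _ _ _
    _ ≤ (p : ℝ)⁻¹ ^ 2 * ((∑ j, S j x ^ 2) * (3 / 2 * p * (b ⬝ᵥ b))) := by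
        gcongr; exact hv b
    _ = _ := by field_simp

lemma featMean_dotProduct_self_le (hp : 0 < p)
    (hv : ∀ b, ∑ j, (v j ⬝ᵥ b) ^ 2 ≤ 3 / 2 * p * (b ⬝ᵥ b)) (x : α) :
    featMean S v x ⬝ᵥ featMean S v x ≤ 3 / 2 * ((p : ℝ)⁻¹ * ∑ j, S j x ^ 2) := by
  have h := sq_featMean_dotProduct_le (S := S) hp hv x (featMean S v x)
  have h0 : 0 ≤ featMean S v x ⬝ᵥ featMean S v x := Finset.sum_nonneg fun i _ => mul_self_nonneg _
  rcases h0.eq_or_lt with h0 | h0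
  · rw [← h0]
    have : 0 ≤ ∑ j, S j x ^ 2 := Finset.sum_nonneg fun _ _ => sq_nonneg _
    positivity
  · rw [sq] at h
    exact le_of_mul_le_mul_right h h0

lemma pow_mean_sq_le (hp : 0 < p) (x : α) (q : ℕ) :
    ((p : ℝ)⁻¹ * ∑ j, S j x ^ 2) ^ (q + 1) ≤ (p : ℝ)⁻¹ * ∑ j, (S j x ^ 2) ^ (q + 1) := by
  have hp' : (0 : ℝ) < p := by exact_mod_cast hp
  have h := pow_sum_div_card_le_sum_pow (s := Finset.univ) (f := fun j : Fin p => S j x ^ 2)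
    (fun _ _ => sq_nonneg _) q
  rw [Finset.card_univ, Fintype.card_fin] at h
  rw [mul_pow, inv_pow, pow_succ (p : ℝ), mul_inv, mul_comm (_ ^ q)⁻¹, mul_assoc]
  gcongr
  rwa [inv_mul_eq_div]

variable [MeasurableSpace α] {τ : Measure α}

/-- Bessel's inequality. -/
lemma sum_sq_integral_mul_le {f : α → ℝ} {φ : ι → α → ℝ} [DecidableEq ι]
    (hff : Integrable (fun x => f x ^ 2) τ) (hfφ : ∀ a, Integrable (fun x => f x * φ a x) τ)
    (hφφ : ∀ a b, Integrable (fun x => φ a x * φ b x) τ)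
    (horth : ∀ a b, ∫ x, φ a x * φ b x ∂τ = if a = b then 1 else 0) :
    ∑ a, (∫ x, f x * φ a x ∂τ) ^ 2 ≤ ∫ x, f x ^ 2 ∂τ := by
  set c : ι → ℝ := fun a => ∫ x, f x * φ a x ∂τ with hc
  have h0 : 0 ≤ ∫ x, (f x - ∑ a, c a * φ a x) ^ 2 ∂τ := integral_nonneg fun x => sq_nonneg _
  have h1 : ∀ x, (f x - ∑ a, c a * φ a x) ^ 2 = f x ^ 2 - ∑ a, 2 * c a * (f x * φ a x) +
      ∑ a, ∑ b, c a * c b * (φ a x * φ b x) := by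
    intro x
    rw [sub_sq, sq (∑ a, c a * φ a x), Finset.sum_mul_sum, mul_comm 2 (f x), mul_assoc,
      Finset.mul_sum, Finset.mul_sum]
    congr 1
    · congr 1
      exact Finset.sum_congr rfl fun a _ => by ring
    · exact Finset.sum_congr rfl fun a _ => Finset.sum_congr rfl fun b _ => by ring
  have i1 : Integrable (fun x => ∑ a, 2 * c a * (f x * φ a x)) τ :=
    integrable_finsetSum _ fun a _ => (hfφ a).const_mul _
  have i2 : Integrable (fun x => ∑ a, ∑ b, c a * c b * (φ a x * φ b x)) τ :=
    integrable_finsetSum _ fun a _ => integrable_finsetSum _ fun b _ => (hφφ a b).const_mul _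
  have i3 : Integrable (fun x => f x ^ 2 - ∑ a, 2 * c a * (f x * φ a x)) τ := hff.sub i1
  simp only [h1] at h0
  rw [integral_add i3 i2, integral_sub hff i1,
    integral_finsetSum _ fun a _ => (hfφ a).const_mul _,
    integral_finsetSum _ fun a _ => integrable_finsetSum _ fun b _ => (hφφ a b).const_mul _] at h0
  have h2 : ∀ a, ∫ x, ∑ b, c a * c b * (φ a x * φ b x) ∂τ = c a ^ 2 := by
    intro a
    rw [integral_finsetSum _ fun b _ => (hφφ a b).const_mul _]
    simp only [integral_const_mul, horth, mul_ite, mul_one, mul_zero, Finset.sum_ite_eq,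
      Finset.mem_univ, if_true]
    ring
  simp only [h2, integral_const_mul] at h0
  have h3 : ∑ a, 2 * c a * ∫ x, f x * φ a x ∂τ = 2 * ∑ a, c a ^ 2 := by
    rw [Finset.mul_sum]
    exact Finset.sum_congr rfl fun a _ => by simp only [hc]; ring
  rw [h3] at h0
  linarith

variable [IsProbabilityMeasure τ]

variable [DecidableEq ι]

/-- Lower tail bound for the quadratic form `b ↦ ∑ᵢ (∑ⱼ Sⱼ(xᵢ) ⟨vⱼ, b⟩)²` at independent points
`xᵢ`, obtained by truncating the features where `p⁻¹ ∑ⱼ Sⱼ²` exceeds `T`. -/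
theorem measure_exists_sum_sq_features_le {n : ℕ} (hp : 0 < p) (hn : 0 < n)
    (hS : ∀ j, Measurable (S j)) {B : ℝ} (hB : ∀ j x, |S j x| ≤ B)
    (hv : ∀ b, ∑ j, (v j ⬝ᵥ b) ^ 2 ≤ 3 / 2 * p * (b ⬝ᵥ b)) {c A T : ℝ} (hc : 0 < c) (hT : 0 < T)
    (hcov : ∀ b, c * (b ⬝ᵥ b) ≤ ∫ x, (featMean S v x ⬝ᵥ b) ^ 2 ∂τ) {r : ℕ}
    (hmom : ∀ j, ∫ x, (S j x ^ 2) ^ (r + 1) ∂τ ≤ A) (hA : 3 * A ≤ c * T ^ r)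
    (hLn : 3 * T / c ≤ n) (q : ℕ) :
    (Measure.pi fun _ : Fin n => τ) {x | ∃ b : ι → ℝ, b ≠ 0 ∧
        ∑ i, (∑ j, S j (x i) * (v j ⬝ᵥ b)) ^ 2 ≤ p ^ 2 * (n * c / 4) * (b ⬝ᵥ b)} ≤
      ENNReal.ofReal ((20 * (2 * q + 1) ^ 2 * (3 * T / c / n)) ^ q * Fintype.card ι) := by
  have hp' : (0 : ℝ) < p := by exact_mod_cast hp
  set h : α → ℝ := fun x => (p : ℝ)⁻¹ * ∑ j, S j x ^ 2 with hh
  have hh0 : ∀ x, 0 ≤ h x := fun x => by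
    have : 0 ≤ ∑ j, S j x ^ 2 := Finset.sum_nonneg fun _ _ => sq_nonneg _
    positivity
  have hhm : Measurable h := by fun_prop
  have hMm : Measurable (featMean S v) := by
    refine measurable_pi_lambda _ fun a => ?_
    unfold featMean
    fun_prop
  have hset : MeasurableSet {x | h x ≤ T} := measurableSet_le hhm measurable_const
  set V : α → ι → ℝ := {x | h x ≤ T}.indicator (featMean S v) with hV
  have hVm : Measurable V := hMm.indicator hset
  have hSint : ∀ j (k : ℕ), Integrable (fun x => (S j x ^ 2) ^ k) τ := fun j k => by
    refine Integrable.of_bound (((hS j).pow_const 2).pow_const k).aestronglyMeasurable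
      ((B ^ 2) ^ k) (ae_of_all _ fun x => ?_)
    rw [Real.norm_eq_abs, abs_pow, abs_pow]
    exact pow_le_pow_left₀ (by positivity) (pow_le_pow_left₀ (abs_nonneg _) (hB j x) 2) k
  have hpow : Integrable (fun x => (p : ℝ)⁻¹ * ∑ j, (S j x ^ 2) ^ (r + 1)) τ :=
    (integrable_finsetSum _ fun j _ => hSint j _).const_mul _
  have hhint : Integrable h τ := by
    have := (integrable_finsetSum Finset.univ fun j _ => hSint j 1).const_mul (p : ℝ)⁻¹
    simpa only [pow_one] using this
  have hmean : ∫ x, (p : ℝ)⁻¹ * ∑ j, (S j x ^ 2) ^ (r + 1) ∂τ ≤ A := by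
    rw [integral_const_mul, integral_finsetSum _ fun j _ => hSint j _]
    calc (p : ℝ)⁻¹ * ∑ j, ∫ x, (S j x ^ 2) ^ (r + 1) ∂τ ≤ (p : ℝ)⁻¹ * ∑ _j : Fin p, A := by
          gcongr with j; exact hmom j
      _ = A := by simp; field_simp
  have hVL : ∀ x, V x ⬝ᵥ V x ≤ 3 / 2 * T := fun x => by
    by_cases hx : h x ≤ T
    · rw [hV, Set.indicator_of_mem (by exact hx)]
      refine (featMean_dotProduct_self_le hp hv x).trans ?_
      change 3 / 2 * h x ≤ _
      gcongr
    · rw [hV, Set.indicator_of_notMem (by exact hx), zero_dotProduct]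
      positivity
  have hVM : ∀ x b, (V x ⬝ᵥ b) ^ 2 ≤ (featMean S v x ⬝ᵥ b) ^ 2 := fun x b => by
    by_cases hx : h x ≤ T
    · rw [hV, Set.indicator_of_mem (by exact hx)]
    · rw [hV, Set.indicator_of_notMem (by exact hx), zero_dotProduct, zero_pow two_ne_zero]
      exact sq_nonneg _
  have hMle : ∀ x b, (featMean S v x ⬝ᵥ b) ^ 2 ≤ 3 / 2 * h x * (b ⬝ᵥ b) := fun x b =>
    sq_featMean_dotProduct_le hp hv x b
  have hbb : ∀ b : ι → ℝ, 0 ≤ b ⬝ᵥ b := fun b => Finset.sum_nonneg fun i _ => mul_self_nonneg _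
  have hcont : ∀ b : ι → ℝ, Continuous fun u : ι → ℝ => (u ⬝ᵥ b) ^ 2 := fun b => by
    unfold dotProduct; fun_prop
  have hMint : ∀ b, Integrable (fun x => (featMean S v x ⬝ᵥ b) ^ 2) τ := fun b => by
    refine ((hhint.const_mul (3 / 2)).mul_const (b ⬝ᵥ b)).mono'
      ((hcont b).measurable.comp hMm).aestronglyMeasurable (ae_of_all _ fun x => ?_)
    rw [Real.norm_eq_abs, abs_of_nonneg (sq_nonneg _)]
    exact hMle x b
  have hVint : ∀ b, Integrable (fun x => (V x ⬝ᵥ b) ^ 2) τ := fun b => by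
    refine (hMint b).mono' ((hcont b).measurable.comp hVm).aestronglyMeasurable
      (ae_of_all _ fun x => ?_)
    rw [Real.norm_eq_abs, abs_of_nonneg (sq_nonneg _)]
    exact hVM x b
  have hVcov : ∀ b, c / 2 * (b ⬝ᵥ b) ≤ ∫ x, (V x ⬝ᵥ b) ^ 2 ∂τ := fun b => by
    have hpt : ∀ x, (featMean S v x ⬝ᵥ b) ^ 2 ≤ (V x ⬝ᵥ b) ^ 2 +
        (3 / 2 * (b ⬝ᵥ b) / T ^ r) * ((p : ℝ)⁻¹ * ∑ j, (S j x ^ 2) ^ (r + 1)) := fun x => by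
      have hJ : h x ^ (r + 1) ≤ (p : ℝ)⁻¹ * ∑ j, (S j x ^ 2) ^ (r + 1) := pow_mean_sq_le hp x r
      have hJ0 := (pow_nonneg (hh0 x) (r + 1)).trans hJ
      have hb0 := hbb b
      by_cases hx : h x ≤ T
      · rw [hV, Set.indicator_of_mem (by exact hx)]
        exact le_add_of_nonneg_right (by positivity)
      · rw [hV, Set.indicator_of_notMem (by exact hx), zero_dotProduct,
          zero_pow two_ne_zero, zero_add]
        refine (hMle x b).trans ?_
        calc 3 / 2 * h x * (b ⬝ᵥ b) = (3 / 2 * (b ⬝ᵥ b) / T ^ r) * (h x * T ^ r) := by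
              field_simp
          _ ≤ (3 / 2 * (b ⬝ᵥ b) / T ^ r) * (h x * h x ^ r) := by
              have := hh0 x
              gcongr
              exact (not_le.1 hx).le
          _ = (3 / 2 * (b ⬝ᵥ b) / T ^ r) * h x ^ (r + 1) := by ring
          _ ≤ _ := by gcongr
    have h1 := integral_mono (hMint b) ((hVint b).add (hpow.const_mul _)) hpt
    simp only [Pi.add_apply] at h1
    rw [integral_add (hVint b) (hpow.const_mul _), integral_const_mul] at h1
    have h2 : 3 / 2 * (b ⬝ᵥ b) / T ^ r *
        ∫ x, (p : ℝ)⁻¹ * ∑ j, (S j x ^ 2) ^ (r + 1) ∂τ ≤ c / 2 * (b ⬝ᵥ b) := by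
      have hb0 := hbb b
      calc _ ≤ 3 / 2 * (b ⬝ᵥ b) / T ^ r * A := by gcongr
        _ = (b ⬝ᵥ b) / (2 * T ^ r) * (3 * A) := by field_simp
        _ ≤ (b ⬝ᵥ b) / (2 * T ^ r) * (c * T ^ r) := by gcongr
        _ = _ := by field_simp
    have h3 := hcov b
    linarith
  have hLc : 3 / 2 * T / (c / 2) = 3 * T / c := by field_simp
  have key := measure_exists_sum_sq_le τ hVm hVL (by positivity) (half_pos hc) hVcov hn
    (hLc.le.trans hLn) q
  rw [hLc] at key
  refine (measure_mono ?_).trans key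
  rintro x ⟨b, hb, hle⟩
  refine ⟨b, hb, ?_⟩
  have h1 : ∑ i, (V (x i) ⬝ᵥ b) ^ 2 ≤ ((p : ℝ)⁻¹) ^ 2 * ∑ i, (∑ j, S j (x i) * (v j ⬝ᵥ b)) ^ 2 := by
    rw [Finset.mul_sum]
    refine Finset.sum_le_sum fun i _ => ?_
    rw [← mul_pow, ← featMean_dotProduct]
    exact hVM _ _
  refine h1.trans ?_
  calc ((p : ℝ)⁻¹) ^ 2 * ∑ i, (∑ j, S j (x i) * (v j ⬝ᵥ b)) ^ 2
      ≤ ((p : ℝ)⁻¹) ^ 2 * (p ^ 2 * (n * c / 4) * (b ⬝ᵥ b)) := by gcongr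
    _ = _ := by field_simp; ring

end Features

section SphereFeatures

open scoped InnerProductSpace

open Matrix

variable {d : ℕ} {τ : Measure (Sph d)} [IsProbabilityMeasure τ] {ι : Type*} [Fintype ι]

lemma PolyGrowth.exists_bound_comp_inner {s : ℝ → ℝ} (hs : PolyGrowth s) (d : ℕ) :
    ∃ B, ∀ w x : Sph d,
      |s (√d * ⟪(w : EuclideanSpace ℝ (Fin d)), (x : EuclideanSpace ℝ (Fin d))⟫_ℝ)| ≤ B := by
  obtain ⟨-, C, k, hC⟩ := hs
  have hC0 : 0 ≤ C := by simpa using (abs_nonneg _).trans (hC 0)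
  refine ⟨C * (1 + √d) ^ k, fun w x => (hC _).trans ?_⟩
  gcongr
  rw [abs_mul, abs_of_nonneg (Real.sqrt_nonneg _)]
  have h := abs_real_inner_le_norm (w : EuclideanSpace ℝ (Fin d)) (x : EuclideanSpace ℝ (Fin d))
  rw [norm_coe_sph, norm_coe_sph, mul_one] at h
  exact mul_le_of_le_one_right (Real.sqrt_nonneg _) h

lemma dotProduct_self_nonneg' (b : ι → ℝ) : 0 ≤ b ⬝ᵥ b :=
  Finset.sum_nonneg fun _ _ => mul_self_nonneg _

variable [DecidableEq ι]

lemma integral_sq_featMean_ge {s : ℝ → ℝ} (hs : PolyGrowth s) {φ : ι → C(Sph d, ℝ)} {lam : ι → ℝ}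
    (horth : ∀ a b, ∫ x, φ a x * φ b x ∂τ = if a = b then 1 else 0)
    (heig : ∀ a (w : Sph d), ∫ x : Sph d,
      s (√d * ⟪(w : EuclideanSpace ℝ (Fin d)), (x : EuclideanSpace ℝ (Fin d))⟫_ℝ) * φ a x ∂τ =
        lam a * φ a w)
    {c : ℝ} (hc : 0 ≤ c) (hlam : ∀ a, c ≤ lam a ^ 2) {p : ℕ} (hp : 0 < p) (w : Fin p → Sph d)
    (hw : ∀ b : ι → ℝ, p / 2 * (b ⬝ᵥ b) ≤ ∑ j, ((fun a => φ a (w j)) ⬝ᵥ b) ^ 2) (b : ι → ℝ) :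
    c / 4 * (b ⬝ᵥ b) ≤ ∫ x, (featMean (fun j (x : Sph d) =>
      s (√d * ⟪(w j : EuclideanSpace ℝ (Fin d)), (x : EuclideanSpace ℝ (Fin d))⟫_ℝ))
      (fun j a => φ a (w j)) x ⬝ᵥ b) ^ 2 ∂τ := by
  have hp' : (0 : ℝ) < p := by exact_mod_cast hp
  set v : Fin p → ι → ℝ := fun j a => φ a (w j) with hv
  set S : Fin p → Sph d → ℝ := fun j x =>
    s (√d * ⟪(w j : EuclideanSpace ℝ (Fin d)), (x : EuclideanSpace ℝ (Fin d))⟫_ℝ) with hS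
  obtain ⟨B, hB⟩ := hs.exists_bound_comp_inner d
  have hSm : ∀ j, Measurable (S j) := fun j => measurable_comp_inner hs.1 _
  have hf : ∀ x, featMean S v x ⬝ᵥ b = (p : ℝ)⁻¹ * ∑ j, S j x * (v j ⬝ᵥ b) := fun x =>
    featMean_dotProduct S v x b
  simp only [hf]
  set g : ι → ℝ := fun a => ∑ j, (v j ⬝ᵥ b) * v j a with hg
  have hint : ∀ j a, Integrable (fun x => S j x * φ a x) τ := fun j a =>
    integrable_comp_inner_mul hs _ _
  have hcoef : ∀ a, ∫ x, ((p : ℝ)⁻¹ * ∑ j, S j x * (v j ⬝ᵥ b)) * φ a x ∂τ =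
      lam a * ((p : ℝ)⁻¹ * g a) := by
    intro a
    have : ∀ x, ((p : ℝ)⁻¹ * ∑ j, S j x * (v j ⬝ᵥ b)) * φ a x =
        (p : ℝ)⁻¹ * ∑ j, (v j ⬝ᵥ b) * (S j x * φ a x) := fun x => by
      rw [mul_assoc, Finset.sum_mul]
      congr 1
      exact Finset.sum_congr rfl fun j _ => by ring
    simp only [this]
    rw [integral_const_mul, integral_finsetSum _ fun j _ => (hint j a).const_mul _]
    simp only [integral_const_mul]
    rw [mul_left_comm, hg, Finset.mul_sum (a := lam a)]
    congr 1
    refine Finset.sum_congr rfl fun j _ => ?_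
    rw [hS, heig]; ring
  have hbes := sum_sq_integral_mul_le (τ := τ) (φ := fun a x => φ a x)
    (f := fun x => (p : ℝ)⁻¹ * ∑ j, S j x * (v j ⬝ᵥ b)) ?_ ?_
    (fun a b => integrable_continuousMap (φ a * φ b)) horth
  · refine le_trans ?_ hbes
    simp only [hcoef]
    have hgb : g ⬝ᵥ b = ∑ j, (v j ⬝ᵥ b) ^ 2 := by
      have h1 : ∀ a, g a * b a = ∑ j, (v j ⬝ᵥ b) * (v j a * b a) := fun a => by
        simp only [hg, Finset.sum_mul, mul_assoc]
      change ∑ a, g a * b a = _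
      simp only [h1]
      rw [Finset.sum_comm]
      refine Finset.sum_congr rfl fun j _ => ?_
      rw [← Finset.mul_sum, sq]
      rfl
    have hcs : (g ⬝ᵥ b) ^ 2 ≤ (g ⬝ᵥ g) * (b ⬝ᵥ b) := by
      have := Finset.sum_mul_sq_le_sq_mul_sq Finset.univ g b
      simpa only [dotProduct, ← sq] using this
    have hgg : (p : ℝ) ^ 2 / 4 * (b ⬝ᵥ b) ≤ g ⬝ᵥ g := by
      rcases (dotProduct_self_nonneg' b).eq_or_lt with h0 | h0
      · rw [← h0, mul_zero]; exact dotProduct_self_nonneg' g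
      · refine le_of_mul_le_mul_right ?_ h0
        refine le_trans ?_ hcs
        have := pow_le_pow_left₀ (by positivity) (hgb ▸ hw b) 2
        linarith
    calc c / 4 * (b ⬝ᵥ b) = c * ((p : ℝ)⁻¹ ^ 2 * ((p : ℝ) ^ 2 / 4 * (b ⬝ᵥ b))) := by field_simp
      _ ≤ c * ((p : ℝ)⁻¹ ^ 2 * (g ⬝ᵥ g)) := by gcongr
      _ = ∑ a, c * ((p : ℝ)⁻¹ * g a) ^ 2 := by
        simp only [dotProduct, Finset.mul_sum]
        exact Finset.sum_congr rfl fun a _ => by ring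
      _ ≤ _ := by
        refine Finset.sum_le_sum fun a _ => ?_
        rw [mul_pow (lam a)]
        exact mul_le_mul_of_nonneg_right (hlam a) (sq_nonneg _)
  · have hm : Measurable fun x => (p : ℝ)⁻¹ * ∑ j, S j x * (v j ⬝ᵥ b) := by fun_prop
    refine Integrable.of_bound (hm.pow_const 2).aestronglyMeasurable
      (((p : ℝ)⁻¹ * ∑ j, B * |v j ⬝ᵥ b|) ^ 2) (ae_of_all _ fun x => ?_)
    rw [Real.norm_eq_abs, abs_pow, abs_mul, abs_of_pos (inv_pos.2 hp')]
    gcongr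
    refine (Finset.abs_sum_le_sum_abs _ _).trans (Finset.sum_le_sum fun j _ => ?_)
    rw [abs_mul]
    gcongr
    exact hB _ _
  · intro a
    simp only [mul_assoc, Finset.sum_mul]
    refine (integrable_finsetSum _ fun j _ => ?_).const_mul _
    refine ((hint j a).const_mul (v j ⬝ᵥ b)).congr (ae_of_all _ fun x => ?_)
    simp only
    ring

/-- The restriction of the feature matrix to the low-degree harmonics is well conditioned from
below, with overwhelming probability. -/
theorem measure_exists_sum_sq_sphere_le (hτ : RotInv τ) (hd : 4 ≤ d) {s : ℝ → ℝ}
    (hs : PolyGrowth s) {φ : ι → C(Sph d, ℝ)} {lam : ι → ℝ}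
    (horth : ∀ a b, ∫ x, φ a x * φ b x ∂τ = if a = b then 1 else 0)
    (hφ : ∀ x, ∑ a, φ a x ^ 2 = Fintype.card ι)
    (heig : ∀ a (w : Sph d), ∫ x : Sph d,
      s (√d * ⟪(w : EuclideanSpace ℝ (Fin d)), (x : EuclideanSpace ℝ (Fin d))⟫_ℝ) * φ a x ∂τ =
        lam a * φ a w)
    {c : ℝ} (hc : 0 < c) (hlam : ∀ a, c ≤ lam a ^ 2) {n p : ℕ} (hn : 0 < n) (hp : 0 < p)
    {A T : ℝ} (hT : 0 < T) {r : ℕ} (hmom : ∫ t, (s t ^ 2) ^ (r + 1) ∂(margLaw d) ≤ A)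
    (hA : 12 * A ≤ c * T ^ r) (hcard : (Fintype.card ι : ℝ) ≤ p) (hTn : 12 * T / c ≤ n) (q : ℕ) :
    ((Measure.pi fun _ : Fin n => τ).prod (Measure.pi fun _ : Fin p => τ))
      {ω | ∃ b : ι → ℝ, b ≠ 0 ∧
        ∑ i, (∑ j, s (√d * ⟪(ω.2 j : EuclideanSpace ℝ (Fin d)),
            (ω.1 i : EuclideanSpace ℝ (Fin d))⟫_ℝ) * ((fun a => φ a (ω.2 j)) ⬝ᵥ b)) ^ 2 ≤
          n * p * (c / 48) * ∑ j, ((fun a => φ a (ω.2 j)) ⬝ᵥ b) ^ 2} ≤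
      ENNReal.ofReal ((20 * (2 * q + 1) ^ 2 * (Fintype.card ι / p)) ^ q * Fintype.card ι) +
      ENNReal.ofReal ((20 * (2 * q + 1) ^ 2 * (12 * T / c / n)) ^ q * Fintype.card ι) := by
  have hp' : (0 : ℝ) < p := by exact_mod_cast hp
  have hn' : (0 : ℝ) < n := by exact_mod_cast hn
  set v : Sph d → ι → ℝ := fun x a => φ a x with hv
  have hvm : Measurable v := measurable_pi_lambda _ fun a => (φ a).continuous.measurable
  set F : (Fin n → Sph d) × (Fin p → Sph d) → (ι → ℝ) → ℝ := fun ω b =>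
    ∑ i, (∑ j, s (√d * ⟪(ω.2 j : EuclideanSpace ℝ (Fin d)),
      (ω.1 i : EuclideanSpace ℝ (Fin d))⟫_ℝ) * (v (ω.2 j) ⬝ᵥ b)) ^ 2 with hF
  set bad : Set (Fin p → Sph d) := {w | ∃ b : ι → ℝ, b ≠ 0 ∧
    (p / 2 : ℝ) * (b ⬝ᵥ b) ≤ |∑ j, (v (w j) ⬝ᵥ b) ^ 2 - p * (b ⬝ᵥ b)|} with hbad
  have hbadle : (Measure.pi fun _ : Fin p => τ) bad ≤
      ENNReal.ofReal ((20 * (2 * q + 1) ^ 2 * (Fintype.card ι / p)) ^ q * Fintype.card ι) :=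
    measure_exists_abs_centeredGram_le hvm
      (fun x => by rw [← hφ x]; simp only [dotProduct, hv, ← sq]; exact le_rfl) hcard
      (by positivity) hp (fun a b => by simp only [hv, horth, Matrix.one_apply]) q
  have hgood : ∀ w ∉ bad, ∀ b : ι → ℝ, p / 2 * (b ⬝ᵥ b) ≤ ∑ j, (v (w j) ⬝ᵥ b) ^ 2 ∧
      ∑ j, (v (w j) ⬝ᵥ b) ^ 2 ≤ 3 / 2 * p * (b ⬝ᵥ b) := by
    intro w hw b
    by_cases hb : b = 0
    · simp [hb]
    · have h1 : |∑ j, (v (w j) ⬝ᵥ b) ^ 2 - p * (b ⬝ᵥ b)| < (p / 2 : ℝ) * (b ⬝ᵥ b) := by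
        by_contra h
        exact hw ⟨b, hb, not_lt.1 h⟩
      rw [abs_lt] at h1
      constructor <;> linarith [h1.1, h1.2]
  set e := TopologicalSpace.denseSeq (ι → ℝ) with he
  set bad' : Set ((Fin n → Sph d) × (Fin p → Sph d)) :=
    ⋃ m, {ω | F ω (e m) < p ^ 2 * (n * (c / 4) / 4) * (e m ⬝ᵥ e m)} with hbad'
  have hFm : ∀ b, Measurable fun ω => F ω b := fun b => by
    have h1 := hs.1
    have h2 : Measurable fun x => v x ⬝ᵥ b := by
      unfold dotProduct; fun_prop
    refine Finset.measurable_sum _ fun i _ => (Finset.measurable_sum _ fun j _ => ?_).pow_const 2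
    refine (h1.comp ?_).mul (h2.comp (by fun_prop))
    fun_prop
  have hbadm : MeasurableSet bad' :=
    MeasurableSet.iUnion fun m => measurableSet_lt (hFm _) measurable_const
  set N := toMeasurable (Measure.pi fun _ : Fin p => τ) bad with hN
  have hNm : MeasurableSet N := measurableSet_toMeasurable _ _
  have hslice : ∀ w, (Measure.pi fun _ : Fin n => τ)
      ((fun x => (x, w)) ⁻¹' (bad' ∩ Set.univ ×ˢ Nᶜ)) ≤
      ENNReal.ofReal ((20 * (2 * q + 1) ^ 2 * (12 * T / c / n)) ^ q * Fintype.card ι) := by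
    intro w
    by_cases hw : w ∈ N
    · have : (fun x : Fin n → Sph d => (x, w)) ⁻¹' (bad' ∩ Set.univ ×ˢ Nᶜ) = ∅ := by
        ext x; simp [hw]
      rw [this, measure_empty]
      exact zero_le
    · have hwb : w ∉ bad := fun h => hw (subset_toMeasurable _ _ h)
      obtain ⟨B, hB⟩ := hs.exists_bound_comp_inner d
      have hTc : 3 * T / (c / 4) = 12 * T / c := by field_simp; norm_num
      have key := measure_exists_sum_sq_features_le (τ := τ) (v := fun j => v (w j))
        (S := fun j (x : Sph d) => s (√d * ⟪(w j : EuclideanSpace ℝ (Fin d)),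
          (x : EuclideanSpace ℝ (Fin d))⟫_ℝ)) hp hn (fun j => measurable_comp_inner hs.1 _)
        (fun j x => hB _ _) (fun b => (hgood w hwb b).2) (by positivity : 0 < c / 4) hT
        (integral_sq_featMean_ge hs horth heig hc.le hlam hp w fun b => (hgood w hwb b).1)
        (r := r) (A := A) (fun j => by
          refine le_trans (le_of_eq ?_) hmom
          exact (integral_margLaw_eq hτ hd ((hs.1.pow_const 2).pow_const (r + 1)) (w j)).symm)
        (by linarith) (hTc.le.trans hTn) q
      rw [hTc] at key
      refine (measure_mono ?_).trans key
      rintro x ⟨hx, -⟩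
      obtain ⟨m, hm⟩ := Set.mem_iUnion.1 hx
      refine ⟨e m, fun h0 => ?_, le_of_lt hm⟩
      have hm' : F (x, w) (e m) < p ^ 2 * (n * (c / 4) / 4) * (e m ⬝ᵥ e m) := hm
      rw [h0, dotProduct_zero, mul_zero] at hm'
      exact absurd hm' (not_lt.2 (Finset.sum_nonneg fun _ _ => sq_nonneg _))
  have hprod : ((Measure.pi fun _ : Fin n => τ).prod (Measure.pi fun _ : Fin p => τ))
      (bad' ∩ Set.univ ×ˢ Nᶜ) ≤
      ENNReal.ofReal ((20 * (2 * q + 1) ^ 2 * (12 * T / c / n)) ^ q * Fintype.card ι) := by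
    rw [Measure.prod_apply_symm (hbadm.inter (MeasurableSet.univ.prod hNm.compl))]
    refine (lintegral_mono hslice).trans ?_
    simp
  have hNle : ((Measure.pi fun _ : Fin n => τ).prod (Measure.pi fun _ : Fin p => τ))
      (Set.univ ×ˢ N) ≤
      ENNReal.ofReal ((20 * (2 * q + 1) ^ 2 * (Fintype.card ι / p)) ^ q * Fintype.card ι) := by
    rw [Measure.prod_prod, measure_univ, one_mul, hN, measure_toMeasurable]
    exact hbadle
  refine (measure_mono ?_).trans ((measure_union_le _ _).trans (add_le_add hNle hprod))
  rintro ⟨x, w⟩ ⟨b, hb, hle⟩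
  by_cases hw : w ∈ N
  · exact Or.inl ⟨Set.mem_univ _, hw⟩
  · refine Or.inr ⟨?_, Set.mem_univ _, hw⟩
    have hwb : w ∉ bad := fun h => hw (subset_toMeasurable _ _ h)
    have hb0 : 0 < b ⬝ᵥ b := lt_of_le_of_ne (dotProduct_self_nonneg' b)
      fun h0 => hb (dotProduct_self_eq_zero.1 h0.symm)
    have hlt : F (x, w) b < p ^ 2 * (n * (c / 4) / 4) * (b ⬝ᵥ b) := by
      calc F (x, w) b ≤ n * p * (c / 48) * ∑ j, (v (w j) ⬝ᵥ b) ^ 2 := hle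
        _ ≤ n * p * (c / 48) * (3 / 2 * p * (b ⬝ᵥ b)) := by
          gcongr; exact (hgood w hwb b).2
        _ = p ^ 2 * n * c * (b ⬝ᵥ b) / 32 := by ring
        _ < p ^ 2 * n * c * (b ⬝ᵥ b) / 16 := by
          have : 0 < p ^ 2 * n * c * (b ⬝ᵥ b) := by positivity
          linarith
        _ = _ := by ring
    have hopen : IsOpen {u : ι → ℝ | F (x, w) u < p ^ 2 * (n * (c / 4) / 4) * (u ⬝ᵥ u)} := by
      refine isOpen_lt ?_ ?_
      · simp only [hF, dotProduct]; fun_prop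
      · simp only [dotProduct]; fun_prop
    obtain ⟨m, hm⟩ := (TopologicalSpace.denseRange_denseSeq (ι → ℝ)).exists_mem_open hopen ⟨b, hlt⟩
    exact Set.mem_iUnion.2 ⟨m, hm⟩

end SphereFeatures

section SingVal

open scoped InnerProductSpace

variable {n p : ℕ}

lemma le_singVal {A : Matrix (Fin n) (Fin p) ℝ} {N : ℕ} (hN : 1 ≤ N) {ι : Type*} [Fintype ι]
    (hcard : N ≤ Fintype.card ι) {f : (ι → ℝ) →ₗ[ℝ] EuclideanSpace ℝ (Fin p)}
    (hf : Function.Injective f) {t : ℝ} (ht : 0 ≤ t)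
    (h : ∀ b, t * ‖f b‖ ≤ ‖Matrix.toEuclideanLin A (f b)‖) : t ≤ singVal A N := by
  obtain ⟨g⟩ : Nonempty (Fin N ↪ ι) := Function.Embedding.nonempty_of_card_le (by simpa using hcard)
  refine le_csSup ?_ ⟨ht, LinearMap.range (f ∘ₗ Function.ExtendByZero.linearMap ℝ g), ?_, ?_⟩
  · refine ⟨‖(Matrix.toEuclideanLin A).toContinuousLinearMap‖, ?_⟩
    rintro s ⟨-, V, hV, hs⟩
    have : Nontrivial V := Module.nontrivial_of_finrank_pos (R := ℝ) (by omega)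
    obtain ⟨v, hv⟩ := exists_ne (0 : V)
    have hv' : 0 < ‖(v : EuclideanSpace ℝ (Fin p))‖ := norm_pos_iff.2 (by simpa using hv)
    refine le_of_mul_le_mul_right ((hs v v.2).trans ?_) hv'
    exact (Matrix.toEuclideanLin A).toContinuousLinearMap.le_opNorm v
  · rw [LinearMap.finrank_range_of_inj]
    · simp
    · refine hf.comp fun x y hxy => funext fun i => ?_
      have := congr_fun hxy (g i)
      change Function.extend g x 0 (g i) = Function.extend g y 0 (g i) at this
      rwa [g.injective.extend_apply, g.injective.extend_apply] at this
  · rintro _ ⟨b, rfl⟩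
    exact h _

/-- A version of `le_singVal` for a family of vectors indexed by the columns. -/
lemma le_singVal_of_sum_sq {A : Matrix (Fin n) (Fin p) ℝ} {N : ℕ} (hN : 1 ≤ N) {ι : Type*}
    [Fintype ι] (hcard : N ≤ Fintype.card ι) (v : Fin p → ι → ℝ) {t : ℝ} (ht : 0 ≤ t)
    (h : ∀ b : ι → ℝ, b ≠ 0 →
      t ^ 2 * ∑ j, (v j ⬝ᵥ b) ^ 2 < ∑ i, (∑ j, A i j * (v j ⬝ᵥ b)) ^ 2) : t ≤ singVal A N := by
  let f : (ι → ℝ) →ₗ[ℝ] EuclideanSpace ℝ (Fin p) :=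
    (WithLp.linearEquiv 2 ℝ (Fin p → ℝ)).symm.toLinearMap ∘ₗ (Matrix.of v).mulVecLin
  have hfa : ∀ b j, f b j = v j ⬝ᵥ b := fun b j => rfl
  have hnorm : ∀ b, ‖f b‖ ^ 2 = ∑ j, (v j ⬝ᵥ b) ^ 2 := fun b => by
    rw [EuclideanSpace.real_norm_sq_eq]
    simp only [hfa]
  have hnormA : ∀ b, ‖Matrix.toEuclideanLin A (f b)‖ ^ 2 = ∑ i, (∑ j, A i j * (v j ⬝ᵥ b)) ^ 2 :=
    fun b => by
      rw [EuclideanSpace.real_norm_sq_eq]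
      rfl
  refine le_singVal hN hcard (f := f) ?_ ht fun b => ?_
  · rw [← LinearMap.ker_eq_bot, LinearMap.ker_eq_bot']
    intro b hb
    by_contra hne
    have := h b hne
    rw [← hnorm, ← hnormA, hb, map_zero] at this
    simp at this
  · by_cases hb : b = 0
    · simp [hb]
    · rw [← pow_le_pow_iff_left₀ (by positivity) (norm_nonneg _) two_ne_zero, mul_pow, hnorm,
        hnormA]
      exact (h b hb).le

end SingVal

section Transfer

open scoped InnerProductSpace

variable {d : ℕ} {τ : Measure (Sph d)} [IsProbabilityMeasure τ]

lemma dotp_eq_inner (u v : EuclideanSpace ℝ (Fin d)) : dotp u v = ⟪v, u⟫_ℝ := by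
  simp [dotp, PiLp.inner_apply]

lemma XWmeas_apply (hd : 1 ≤ d)
    (hτ : ∀ r : ℝ, 0 < r →
      sphereUniform d r = τ.map fun u : Sph d => r • (u : EuclideanSpace ℝ (Fin d)))
    (n p : ℕ) (A : Set ((Fin n → EuclideanSpace ℝ (Fin d)) × (Fin p → EuclideanSpace ℝ (Fin d)))) :
    XWmeas d n p A = ((Measure.pi fun _ : Fin n => τ).prod (Measure.pi fun _ : Fin p => τ))
      {ω | ((fun i => √d • (ω.1 i : EuclideanSpace ℝ (Fin d))),
        (fun j => (ω.2 j : EuclideanSpace ℝ (Fin d)))) ∈ A} := by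
  have hd0 : 0 < √(d : ℝ) := Real.sqrt_pos.2 (by exact_mod_cast hd)
  have hmap : ∀ (m : ℕ) (r : ℝ), 0 < r → (Measure.pi fun _ : Fin m => sphereUniform d r) =
      (Measure.pi fun _ : Fin m => τ).map
        fun u i => r • (u i : EuclideanSpace ℝ (Fin d)) := by
    intro m r hr
    have hf : Measurable fun u : Sph d => r • (u : EuclideanSpace ℝ (Fin d)) := by fun_prop
    have := Measure.isProbabilityMeasure_map (μ := τ) hf.aemeasurable
    rw [hτ r hr]
    exact (Measure.pi_map_pi (μ := fun _ : Fin m => τ)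
      (f := fun _ (u : Sph d) => r • (u : EuclideanSpace ℝ (Fin d))) fun _ => hf.aemeasurable).symm
  have h1 : Xmeas d n = (Measure.pi fun _ : Fin n => τ).map
      fun u i => √d • (u i : EuclideanSpace ℝ (Fin d)) := hmap n _ hd0
  have h2 : Wmeas d p = (Measure.pi fun _ : Fin p => τ).map
      fun u j => (u j : EuclideanSpace ℝ (Fin d)) := by
    have := hmap p 1 one_pos
    simp only [one_smul] at this
    exact this
  rw [XWmeas, h1, h2, Measure.map_prod_map _ _ (by fun_prop) (by fun_prop),
    MeasurableEmbedding.map_apply]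
  · rfl
  · refine (Continuous.isClosedEmbedding (by fun_prop) ?_).measurableEmbedding
    rintro ⟨x, w⟩ ⟨x', w'⟩ h
    simp only [Prod.map_apply, Prod.mk.injEq] at h
    ext1
    · funext i
      exact Subtype.ext (smul_right_injective _ hd0.ne' (congr_fun h.1 i))
    · funext j
      exact Subtype.ext (congr_fun h.2 j)

lemma prod_inner_mem_eq_zero (hτ : RotInv τ) (hd : 4 ≤ d) {N : Set ℝ}
    (hN : MeasurableSet N) (hN0 : volume N = 0) :
    (τ.prod τ) ((fun u : Sph d × Sph d => √d * ⟪(u.2 : EuclideanSpace ℝ (Fin d)),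
      (u.1 : EuclideanSpace ℝ (Fin d))⟫_ℝ) ⁻¹' N) = 0 := by
  have hm : Measurable fun u : Sph d × Sph d => √d * ⟪(u.2 : EuclideanSpace ℝ (Fin d)),
      (u.1 : EuclideanSpace ℝ (Fin d))⟫_ℝ := by fun_prop
  refine (Measure.measure_prod_null (hm hN)).2 (ae_of_all _ fun x => ?_)
  have h1 : Measurable fun w : Sph d =>
      √d * ⟪(x : EuclideanSpace ℝ (Fin d)), (w : EuclideanSpace ℝ (Fin d))⟫_ℝ := by fun_prop
  have h2 : τ ((fun w : Sph d => √d * ⟪(x : EuclideanSpace ℝ (Fin d)),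
      (w : EuclideanSpace ℝ (Fin d))⟫_ℝ) ⁻¹' N) = 0 := by
    rw [← Measure.map_apply h1 hN, map_inner_eq_margLaw hd hτ x]
    exact margLaw_absolutelyContinuous d hN0
  simpa only [Pi.zero_apply, ← Set.preimage_comp, Function.comp_def,
    real_inner_comm (x : EuclideanSpace ℝ (Fin d))] using h2

lemma measure_exists_inner_mem_eq_zero (hτ : RotInv τ) (hd : 4 ≤ d) (n p : ℕ) {N : Set ℝ}
    (hN : MeasurableSet N) (hN0 : volume N = 0) :
    ((Measure.pi fun _ : Fin n => τ).prod (Measure.pi fun _ : Fin p => τ))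
      {ω | ∃ i j, √d * ⟪(ω.2 j : EuclideanSpace ℝ (Fin d)),
        (ω.1 i : EuclideanSpace ℝ (Fin d))⟫_ℝ ∈ N} = 0 := by
  have hm : Measurable fun u : Sph d × Sph d => √d * ⟪(u.2 : EuclideanSpace ℝ (Fin d)),
      (u.1 : EuclideanSpace ℝ (Fin d))⟫_ℝ := by fun_prop
  have key : ∀ i j, ((Measure.pi fun _ : Fin n => τ).prod (Measure.pi fun _ : Fin p => τ))
      ((Prod.map (Function.eval i) (Function.eval j)) ⁻¹'
        ((fun u : Sph d × Sph d => √d * ⟪(u.2 : EuclideanSpace ℝ (Fin d)),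
          (u.1 : EuclideanSpace ℝ (Fin d))⟫_ℝ) ⁻¹' N)) = 0 := fun i j => by
    have h := (measurePreserving_eval (fun _ : Fin n => τ) i).prod
      (measurePreserving_eval (fun _ : Fin p => τ) j)
    rw [h.measure_preimage (hm hN).nullMeasurableSet]
    exact prod_inner_mem_eq_zero hτ hd hN hN0
  refine measure_mono_null ?_ (measure_iUnion_null fun i => measure_iUnion_null fun j => key i j)
  rintro ω ⟨i, j, h⟩
  exact Set.mem_iUnion₂.2 ⟨i, j, h⟩

end Transfer

section Regularization

open scoped InnerProductSpace

/-- A function of polynomial growth with a non-zero Hermite coefficient agrees almost everywhere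
with a measurable one. -/
lemma exists_polyGrowth_eq {σ : ℝ → ℝ} {C₀ : ℝ} (hC₀ : 0 < C₀)
    (hgrow : ∀ s, |σ s| ≤ C₀ * (1 + |s|) ^ C₀) (h0 : hermiteCoeff σ 0 ≠ 0) :
    ∃ s : ℝ → ℝ, PolyGrowth s ∧ (∀ k, hermiteCoeff s k = hermiteCoeff σ k) ∧
      ∃ N, MeasurableSet N ∧ volume N = 0 ∧ ∀ t ∉ N, σ t = s t := by
  have hint : Integrable σ stdGaussian := by
    by_contra h
    refine h0 (integral_undef fun h' => h ?_)
    simpa [hermiteL2, Polynomial.hermite_zero] using h'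
  obtain ⟨g, hg, hσg⟩ := hint.aemeasurable
  set b : ℝ → ℝ := fun t => C₀ * (1 + |t|) ^ C₀ with hb
  have hbm : Measurable b := by fun_prop
  set s : ℝ → ℝ := fun t => max (-b t) (min (b t) (g t)) with hs
  have hsm : Measurable s := hbm.neg.max (hbm.min hg)
  have hb0 : ∀ t, 0 ≤ b t := fun t => by positivity
  have hsb : ∀ t, |s t| ≤ b t := fun t =>
    abs_le.2 ⟨le_max_left _ _, max_le (by linarith [hb0 t]) (min_le_left _ _)⟩
  have heq : σ =ᵐ[stdGaussian] s := by
    filter_upwards [hσg] with t ht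
    have := abs_le.1 (hgrow t)
    rw [hs]
    simp only
    rw [← ht, min_eq_right this.2, max_eq_right this.1]
  refine ⟨s, ⟨hsm, C₀, ⌈C₀⌉₊, fun t => (hsb t).trans ?_⟩, fun k => ?_, ?_⟩
  · rw [hb]
    simp only
    rw [← Real.rpow_natCast]
    gcongr
    · linarith [abs_nonneg t]
    · exact Nat.le_ceil _
  · exact integral_congr_ae (heq.symm.mono fun t ht => by simp only [ht])
  · have hvol : σ =ᵐ[volume] s :=
      (ProbabilityTheory.gaussianReal_absolutelyContinuous' 0 one_ne_zero).ae_le heq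
    refine ⟨toMeasurable volume {t | ¬ σ t = s t}, measurableSet_toMeasurable _ _, ?_,
      fun t ht => ?_⟩
    · rw [measure_toMeasurable]
      exact hvol
    · by_contra h
      exact ht (subset_toMeasurable _ _ h)

end Regularization

section FixedDimension

open scoped InnerProductSpace

variable {d : ℕ}

lemma one_le_sphDimLT (d : ℕ) {l : ℕ} (hl : 1 ≤ l) : 1 ≤ sphDimLT d l := by
  have h : sphDim d 0 ≤ sphDimLT d l := Finset.single_le_sum (f := sphDim d)
    (fun _ _ => Nat.zero_le _) (Finset.mem_range.2 hl)
  simpa [sphDim] using h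

/-- Non-asymptotic version of the lower bound on the top singular values. -/
theorem XWmeas_singVal_lt_le (hd : 4 ≤ d) {σ s : ℝ → ℝ} (hs : PolyGrowth s) {N : Set ℝ}
    (hN : MeasurableSet N) (hN0 : volume N = 0) (hσs : ∀ t ∉ N, σ t = s t) {l : ℕ} (hl : 1 ≤ l)
    {c : ℝ} (hc : 0 < c)
    (hbasis : ∀ (τ : Measure (Sph d)) [IsProbabilityMeasure τ],
      RotInv τ → ∃ (φ : Fin (Module.finrank ℝ (polyLT d l)) → C(Sph d, ℝ))
        (lam : Fin (Module.finrank ℝ (polyLT d l)) → ℝ),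
        (∀ a b, ∫ x, φ a x * φ b x ∂τ = if a = b then 1 else 0) ∧
        (∀ v, ∑ a, φ a v ^ 2 = Module.finrank ℝ (polyLT d l)) ∧
        (∀ a (w : Sph d), ∫ x : Sph d,
          s (√d * ⟪(w : EuclideanSpace ℝ (Fin d)), (x : EuclideanSpace ℝ (Fin d))⟫_ℝ) * φ a x ∂τ =
            lam a * φ a w) ∧
        ∀ a, c ≤ lam a ^ 2)
    {n p : ℕ} (hn : 0 < n) (hp : 0 < p) {A T : ℝ} (hT : 0 < T) {r : ℕ}
    (hmom : ∫ t, (s t ^ 2) ^ (r + 1) ∂(margLaw d) ≤ A) (hA : 12 * A ≤ c * T ^ r)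
    (hcard : (Module.finrank ℝ (polyLT d l) : ℝ) ≤ p) (hTn : 12 * T / c ≤ n) {t : ℝ} (ht : 0 ≤ t)
    (htc : t ^ 2 * max (n : ℝ) p ≤ n * p * (c / 48)) (q : ℕ) :
    XWmeas d n p {ω | singVal ((√(max (n : ℝ) p))⁻¹ • entrywise d n p σ ω.1 ω.2)
        (sphDimLT d l) < t} ≤
      ENNReal.ofReal ((20 * (2 * q + 1) ^ 2 * (Module.finrank ℝ (polyLT d l) / p)) ^ q *
        Module.finrank ℝ (polyLT d l)) +
      ENNReal.ofReal ((20 * (2 * q + 1) ^ 2 * (12 * T / c / n)) ^ q *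
        Module.finrank ℝ (polyLT d l)) := by
  rcases sphereUniform_eq_zero_or (d := d) (by omega) with h0 | ⟨τ, hprob, hτ, hmap⟩
  · have hW : Wmeas d p = 0 := by
      rw [← Measure.measure_univ_eq_zero, Wmeas, h0, Measure.pi_univ]
      simp [hp.ne']
    rw [XWmeas, hW, Measure.prod_zero]
    simp
  obtain ⟨φ, lam, horth, hφ, heig, hlam⟩ := hbasis τ hτ
  have key := measure_exists_sum_sq_sphere_le hτ hd hs horth (by simpa using hφ) heig hc hlam hn hp
    hT hmom hA (by simpa using hcard) hTn q
  rw [Fintype.card_fin] at key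
  rw [XWmeas_apply (by omega) hmap]
  refine le_trans (measure_mono ?_) ((measure_union_le _ _).trans
    ((add_le_add (measure_exists_inner_mem_eq_zero hτ hd n p hN hN0).le key).trans_eq
      (zero_add _)))
  intro ω hω
  by_contra hnot
  rw [Set.mem_union, not_or] at hnot
  obtain ⟨hnot1, hnot2⟩ := hnot
  refine absurd (show singVal ((√(max (n : ℝ) p))⁻¹ • entrywise d n p σ
    (fun i => √d • (ω.1 i : EuclideanSpace ℝ (Fin d)))
    (fun j => (ω.2 j : EuclideanSpace ℝ (Fin d)))) (sphDimLT d l) < t from hω) (not_lt.2 ?_)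
  refine le_singVal_of_sum_sq (one_le_sphDimLT d hl) (ι := Fin (Module.finrank ℝ (polyLT d l)))
    (by simpa using sphDimLT_le_finrank (by omega) l) (fun j a => φ a (ω.2 j)) ht fun b hb => ?_
  have hmax : 0 < max (n : ℝ) p := lt_max_of_lt_left (by exact_mod_cast hn)
  have hent : ∀ i j, ((√(max (n : ℝ) p))⁻¹ • entrywise d n p σ
      (fun i => √d • (ω.1 i : EuclideanSpace ℝ (Fin d)))
      (fun j => (ω.2 j : EuclideanSpace ℝ (Fin d)))) i j = (√(max (n : ℝ) p))⁻¹ *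
        s (√d * ⟪(ω.2 j : EuclideanSpace ℝ (Fin d)), (ω.1 i : EuclideanSpace ℝ (Fin d))⟫_ℝ) := by
    intro i j
    rw [Matrix.smul_apply, entrywise, Matrix.of_apply, dotp_eq_inner, inner_smul_right, smul_eq_mul,
      hσs _ fun h => hnot1 ⟨i, j, h⟩]
  have hF : (n * p * (c / 48) * ∑ j, ((fun a => φ a (ω.2 j)) ⬝ᵥ b) ^ 2 : ℝ) <
      ∑ i, (∑ j, s (√d * ⟪(ω.2 j : EuclideanSpace ℝ (Fin d)),
        (ω.1 i : EuclideanSpace ℝ (Fin d))⟫_ℝ) * ((fun a => φ a (ω.2 j)) ⬝ᵥ b)) ^ 2 := by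
    by_contra h
    exact hnot2 ⟨b, hb, not_lt.1 h⟩
  simp only [hent, mul_assoc (√(max (n : ℝ) p))⁻¹]
  simp only [← Finset.mul_sum, mul_pow]
  rw [inv_pow, Real.sq_sqrt hmax.le, ← div_eq_inv_mul, lt_div_iff₀ hmax]
  refine lt_of_le_of_lt ?_ hF
  rw [mul_right_comm]
  gcongr

end FixedDimension

lemma exists_eventually_pow_mul_le (B M D e : ℝ) {ε : ℝ} (hε : 0 < ε) :
    ∃ q : ℕ, ∀ᶠ d : ℕ in atTop, ∀ x F : ℝ, 0 ≤ x → 0 ≤ F → x ≤ B * (d : ℝ) ^ (-ε) →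
      F ≤ M * (d : ℝ) ^ e → (20 * (2 * q + 1) ^ 2 * x) ^ q * F ≤ (d : ℝ) ^ (-D) / 2 := by
  obtain ⟨q, hq⟩ := exists_nat_ge ((e + D + 1) / ε)
  rw [div_le_iff₀ hε] at hq
  refine ⟨q, ?_⟩
  set C : ℝ := (20 * (2 * q + 1) ^ 2 * B) ^ q * M with hC
  filter_upwards [eventually_ge_atTop 1,
    tendsto_natCast_atTop_atTop.eventually_ge_atTop (2 * C)] with d hd1 hdC x F hx hF hxB hFM
  have hd : (1 : ℝ) ≤ d := by exact_mod_cast hd1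
  have hd0 : (0 : ℝ) < d := by linarith
  calc (20 * (2 * q + 1) ^ 2 * x) ^ q * F
      ≤ (20 * (2 * q + 1) ^ 2 * (B * (d : ℝ) ^ (-ε))) ^ q * (M * (d : ℝ) ^ e) := by
        gcongr
        exact pow_nonneg (mul_nonneg (by positivity) (hx.trans hxB)) _
    _ = C * (d : ℝ) ^ (-ε * q + e) := by
      rw [hC, Real.rpow_add hd0, Real.rpow_mul hd0.le, Real.rpow_natCast, ← mul_assoc _ B,
        mul_pow _ ((d : ℝ) ^ (-ε))]
      ring
    _ ≤ d / 2 * (d : ℝ) ^ (-D - 1) := by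
      gcongr
      · linarith
      · linarith
    _ = (d : ℝ) ^ (-D) / 2 := by
      rw [Real.rpow_sub_one hd0.ne']
      field_simp

lemma eventually_mul_rpow_le {u : ℕ → ℕ} {κ θ : ℝ}
    (hu : Tendsto (fun d : ℕ => (u d : ℝ) / (d : ℝ) ^ κ) atTop (nhds θ)) {κ' a : ℝ} (hκ : κ' ≤ κ)
    (ha0 : 0 ≤ a) (ha : a < θ) : ∀ᶠ d : ℕ in atTop, a * (d : ℝ) ^ κ' ≤ u d := by
  filter_upwards [hu.eventually_const_lt ha, eventually_ge_atTop 1] with d hd hd1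
  have hd' : (1 : ℝ) ≤ d := by exact_mod_cast hd1
  calc a * (d : ℝ) ^ κ' ≤ a * (d : ℝ) ^ κ := by gcongr
    _ ≤ u d := by
      rw [lt_div_iff₀ (by positivity)] at hd
      exact hd.le

lemma add_one_pow_le {d m : ℕ} (hd : 1 ≤ d) : ((d : ℝ) + 1) ^ m ≤ 2 ^ m * (d : ℝ) ^ (m : ℝ) := by
  have hd' : (1 : ℝ) ≤ d := by exact_mod_cast hd
  rw [Real.rpow_natCast, ← mul_pow]
  gcongr
  linarith

lemma finrank_polyLT_le_rpow {d l : ℕ} (hd : 1 ≤ d) (hl : 1 ≤ l) :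
    (Module.finrank ℝ (polyLT d l) : ℝ) ≤ 2 ^ (l - 1) * (d : ℝ) ^ ((l : ℝ) - 1) := by
  obtain ⟨m, rfl⟩ := Nat.exists_eq_add_of_le' hl
  have h : (Module.finrank ℝ (polyLT d (m + 1)) : ℝ) ≤ ((d : ℝ) + 1) ^ m := by
    exact_mod_cast finrank_polyLT_le m
  simpa using h.trans (add_one_pow_le hd)

lemma tendsto_natCast_rpow_neg {ε : ℝ} (hε : 0 < ε) :
    Tendsto (fun d : ℕ => (d : ℝ) ^ (-ε)) atTop (nhds 0) :=
  (tendsto_rpow_neg_atTop hε).comp tendsto_natCast_atTop_atTop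

/-- With high probability, the `N_{<ℓ}`-th largest singular value of `Z̃ = σ(XWᵀ)/√s` is at least
`K √(r d^{−(ℓ−1)})`, where `r = min(n,p)`, `s = max(n,p)`. -/
theorem top_singular_values_lower_bound
    (κ₁ κ₂ θ₁ θ₂ : ℝ) (hκ₁ : 0 < κ₁) (hκ₂ : 0 < κ₂) (hθ₁ : 0 < θ₁) (hθ₂ : 0 < θ₂)
    (p n : ℕ → ℕ) (hp : ∀ d, 0 < p d) (hn : ∀ d, 0 < n d)
    (hpl : Tendsto (fun d : ℕ => (p d : ℝ) / (d : ℝ) ^ κ₁) atTop (nhds θ₁))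
    (hnl : Tendsto (fun d : ℕ => (n d : ℝ) / (d : ℝ) ^ κ₂) atTop (nhds θ₂))
    (σ : ℝ → ℝ) (C₀ : ℝ) (hC₀ : 0 < C₀)
    (hgrow : ∀ s, |σ s| ≤ C₀ * (1 + |s|) ^ C₀)
    (hμne : ∀ k ≤ ⌈min κ₁ κ₂⌉₊, hermiteCoeff σ k ≠ 0)
    (hμgt : 0 < muGtSq σ ⌈min κ₁ κ₂⌉₊) :
    ∃ K : ℝ, 0 < K ∧ ∀ D : ℝ, 0 < D → ∃ d₀ : ℕ, ∀ d, d₀ ≤ d →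
      XWmeas d (n d) (p d) {ω |
          singVal ((Real.sqrt (max (n d) (p d)))⁻¹ • entrywise d (n d) (p d) σ ω.1 ω.2)
              (sphDimLT d ⌈min κ₁ κ₂⌉₊) <
            K * Real.sqrt ((min (n d) (p d) : ℝ) *
              (d : ℝ) ^ (-((⌈min κ₁ κ₂⌉₊ : ℝ) - 1)))} ≤
        ENNReal.ofReal ((d : ℝ) ^ (-D)) := by
  obtain ⟨s, hs, hcoeff, N, hN, hN0, hσs⟩ := exists_polyGrowth_eq hC₀ hgrow (hμne 0 (Nat.zero_le _))
  have hκ : 0 < min κ₁ κ₂ := lt_min hκ₁ hκ₂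
  have hl : 1 ≤ ⌈min κ₁ κ₂⌉₊ := Nat.one_le_ceil_iff.2 hκ
  have hlκ : (⌈min κ₁ κ₂⌉₊ : ℝ) < min κ₁ κ₂ + 1 := Nat.ceil_lt_add_one hκ.le
  set l := ⌈min κ₁ κ₂⌉₊
  obtain ⟨c, hc, hbasis⟩ := exists_eventually_lowDegree_eigenbasis hs (l := l) fun k hk => by
    rw [hcoeff]
    exact hμne k hk.le
  obtain ⟨ε, hε, hεκ⟩ : ∃ ε : ℝ, 0 < ε ∧ (l : ℝ) - 1 + 2 * ε = min κ₁ κ₂ :=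
    ⟨(min κ₁ κ₂ - (l - 1)) / 2, by linarith, by ring⟩
  set e : ℝ := (l : ℝ) - 1 with he
  set c₁ : ℝ := c / 2 ^ (l - 1) with hc₁def
  have hc₁ : 0 < c₁ := by positivity
  obtain ⟨a, ha, ha₁, ha₂⟩ : ∃ a : ℝ, 0 < a ∧ a < θ₁ ∧ a < θ₂ :=
    ⟨min θ₁ θ₂ / 2, half_pos (lt_min hθ₁ hθ₂), by linarith [min_le_left θ₁ θ₂, lt_min hθ₁ hθ₂],
      by linarith [min_le_right θ₁ θ₂, lt_min hθ₁ hθ₂]⟩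
  have hpa := eventually_mul_rpow_le hpl (min_le_left κ₁ κ₂) ha.le ha₁
  have hna := eventually_mul_rpow_le hnl (min_le_right κ₁ κ₂) ha.le ha₂
  rw [← hεκ] at hpa hna
  set B : ℝ := max (2 ^ (l - 1) / a) (12 / (c₁ * a))
  obtain ⟨r, hr⟩ := exists_nat_ge ((e + 1) / ε)
  rw [div_le_iff₀ hε] at hr
  set A : ℝ := ∫ t, (s t ^ 2) ^ (r + 1) ∂stdGaussian
  have hmom := (tendsto_integral_margLaw ((hs.pow 2).pow (r + 1))).eventually_le_const
    (lt_add_one A)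
  have hsmall : ∀ᶠ d : ℕ in atTop, B * (d : ℝ) ^ (-ε) ≤ 1 :=
    ((tendsto_natCast_rpow_neg hε).const_mul B).eventually_le_const (by simp)
  refine ⟨√(c₁ / 48), by positivity, fun D _ => ?_⟩
  obtain ⟨q, hq⟩ := exists_eventually_pow_mul_le B (2 ^ (l - 1)) D e hε
  rw [← eventually_atTop]
  filter_upwards [hbasis, hpa, hna, hmom, hsmall, hq, eventually_ge_atTop 4,
    tendsto_natCast_atTop_atTop.eventually_ge_atTop (12 * (A + 1) / c₁)]
    with d hbasis hpa hna hmom hsmall hq hd4 hdA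
  have hd1 : 1 ≤ d := by omega
  have hd : (1 : ℝ) ≤ d := by exact_mod_cast hd1
  have hd0 : (0 : ℝ) < d := by linarith
  have hn0 : (0 : ℝ) < n d := by exact_mod_cast hn d
  have hp0 : (0 : ℝ) < p d := by exact_mod_cast hp d
  have hF := finrank_polyLT_le_rpow hd1 hl
  rw [← he] at hF
  have hc₀ : c₁ * (d : ℝ) ^ (-e) ≤ c / ((d : ℝ) + 1) ^ (l - 1) := by
    rw [hc₁def, Real.rpow_neg hd0.le, ← div_eq_mul_inv, div_div]
    have h := add_one_pow_le (m := l - 1) hd1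
    rw [Nat.cast_sub hl, Nat.cast_one] at h
    gcongr
  have hratio₁ : (Module.finrank ℝ (polyLT d l) : ℝ) / p d ≤ B * (d : ℝ) ^ (-ε) := by
    calc (Module.finrank ℝ (polyLT d l) : ℝ) / p d
        ≤ 2 ^ (l - 1) * (d : ℝ) ^ e / (a * (d : ℝ) ^ (e + 2 * ε)) := by gcongr
      _ = 2 ^ (l - 1) / a * (d : ℝ) ^ (-(2 * ε)) := by
        rw [Real.rpow_add hd0, Real.rpow_neg hd0.le]
        field_simp
      _ ≤ B * (d : ℝ) ^ (-ε) := by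
        gcongr
        · exact le_max_left _ _
        · linarith
  have hratio₂ : 12 * (d : ℝ) ^ ε / (c₁ * (d : ℝ) ^ (-e)) / n d ≤ B * (d : ℝ) ^ (-ε) := by
    calc 12 * (d : ℝ) ^ ε / (c₁ * (d : ℝ) ^ (-e)) / n d
        ≤ 12 * (d : ℝ) ^ ε / (c₁ * (d : ℝ) ^ (-e)) / (a * (d : ℝ) ^ (e + 2 * ε)) := by gcongr
      _ = 12 / (c₁ * a) * (d : ℝ) ^ (-ε) := by
        rw [two_mul, Real.rpow_add hd0, Real.rpow_add hd0, Real.rpow_neg hd0.le,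
          Real.rpow_neg hd0.le]
        field_simp
      _ ≤ B * (d : ℝ) ^ (-ε) := by
        gcongr
        exact le_max_right _ _
  have hA : 12 * (A + 1) ≤ c₁ * (d : ℝ) ^ (-e) * ((d : ℝ) ^ ε) ^ r := by
    rw [div_le_iff₀ hc₁] at hdA
    rw [mul_assoc, ← Real.rpow_mul_natCast hd0.le, ← Real.rpow_add hd0]
    refine hdA.trans ?_
    rw [mul_comm]
    gcongr
    exact Real.self_le_rpow_of_one_le hd (by linarith)
  refine (XWmeas_singVal_lt_le hd4 hs hN hN0 hσs hl (c := c₁ * (d : ℝ) ^ (-e)) (by positivity)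
    (fun τ _ hτ => ?_) (hn d) (hp d) (T := (d : ℝ) ^ ε) (by positivity) hmom hA
    ((div_le_one hp0).1 (hratio₁.trans hsmall)) ((div_le_one hn0).1 (hratio₂.trans hsmall))
    (by positivity) ?_ q).trans ?_
  · obtain ⟨φ, lam, h1, h2, h3, h4⟩ := hbasis τ hτ
    exact ⟨φ, lam, h1, h2, h3, fun b => hc₀.trans (h4 b)⟩
  · rw [mul_pow, Real.sq_sqrt (by positivity), Real.sq_sqrt (by positivity),
      ← min_mul_max (n d : ℝ) (p d)]
    exact le_of_eq (by ring)
  · rw [← ENNReal.ofReal_add (by positivity) (by positivity)]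
    refine ENNReal.ofReal_le_ofReal ?_
    have h1 := hq _ _ (by positivity) (by positivity) hratio₁ hF
    have h2 := hq _ _ (by positivity) (by positivity) hratio₂ hF
    linarith

end
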